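/- Let p be an odd prime. If p ≡ 1 or 3 (mod 8), write p = x^2 + 2y^2 with integers x, y; then (−1)^{(p−1)/2}·Σ_{k=0}^{p−1} k^2·C(2k,k)^3/(−64)^k ≡ (1/8)x^2 − (3/16)p + p^2/(64x^2) (mod p^3) and (−1)^{(p−1)/2}·Σ_{k=0}^{p−1} k^3·C(2k,k)^3/(−64)^k ≡ (1/32)x^2 − p/64 − 5p^2/(256x^2) (mod p^3). If p ≡ 5 or 7 (mod 8), then (−1)^{(p−1)/2}·Σ_{k=0}^{p−1} k^2·C(2k,k)^3/(−64)^k ≡ −(1/32)R_2(p) − p/8 (mod p^2) and (−1)^{(p−1)/2}·Σ_{k=0}^{p−1} k^3·C(2k,k)^3/(−64)^k ≡ (3/128)R_2(p) (mod p^2). -/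

import Mathlib

/-- `a ≡ b (mod p^r)` for rationals: the numerator of `a - b` in lowest terms
is divisible by `p^r`. -/
def ratCongr (p r : ℕ) (a b : ℚ) : Prop := (p : ℤ)^r ∣ (a - b).num
/-- `R_2(p)`. -/
def R2 (p : ℕ) : ℚ :=
  (5 - 4*(-1:ℚ)^((p-1)/2)) *
    (1 + (4 + 2*(-1:ℚ)^((p-1)/2))*(p:ℚ) - 4*(2^(p-1) - 1)
      - (p:ℚ)/2 * ∑ k ∈ Finset.Icc 1 (p/8), (1:ℚ)/k) *
    (((p-1)/2).choose (p/8) : ℚ)^2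


set_option linter.all false

namespace S5

section A
variable {R : Type*} [CommRing R]

def cc (Y : R) (k : ℕ) : R :=
  ((2*k).choose k : R) * (-1)^k * ∏ j ∈ Finset.range k, ((2*(j:R)+1)^2 - Y)

def PP (g : ℕ → R) (Y : R) : ℕ → R
  | 0 => g 0
  | N+1 => 4*(4*((N:R)+1)^2 - Y) * PP g Y N + g (N+1) * cc Y (N+1)

def Nr (Y : R) (N : ℕ) : R := 4^N * ∏ j ∈ Finset.range N, (4*((j:R)+1)^2 - Y)

def gW (Y : R) (k : ℕ) : R := 32*(k:R)^2 + 16*k + 3 - 4*Y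
def g1 (R : Type*) [CommRing R] (k : ℕ) : R := 4*(k:R)+1
def g0 (R : Type*) [CommRing R] (_ : ℕ) : R := 1

lemma cc_zero (Y : R) : cc Y 0 = 1 := by simp [cc]

lemma prod_shift (b : R) (N : ℕ) :
    ∏ j ∈ Finset.range (N+1), ((2*(j:R)+1)^2 - (b+2)^2) =
      -(2*N+1+b)*(2*N+3+b) * ∏ j ∈ Finset.range N, ((2*(j:R)+1)^2 - b^2) := by
  induction N with
  | zero => simp; ring
  | succ N ih =>
    rw [Finset.prod_range_succ, ih, Finset.prod_range_succ]
    push_cast; ring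

lemma cb (N : ℕ) : ((N:R)+1) * ((2*(N+1)).choose (N+1) : R) = 2*(2*N+1)*((2*N).choose N : R) := by
  have := Nat.succ_mul_centralBinom_succ N
  simp only [Nat.centralBinom] at this
  exact_mod_cast congrArg (Nat.cast : ℕ → R) this

lemma cc_succ (b : R) (N : ℕ) : cc (b^2) (N+1) =
    -((2*(N+1)).choose (N+1) : R) * (-1)^N * (∏ j ∈ Finset.range N, ((2*(j:R)+1)^2 - b^2)) *
      ((2*(N:R)+1)^2-b^2) := by
  simp only [cc, Finset.prod_range_succ]; ring
lemma cc_succ2 (b : R) (N : ℕ) : cc ((b+2)^2) (N+1) =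
    ((2*(N+1)).choose (N+1) : R) * (-1)^N * (∏ j ∈ Finset.range N, ((2*(j:R)+1)^2 - b^2)) *
      (2*N+1+b)*(2*N+3+b) := by
  rw [cc, prod_shift]; ring

lemma idW (b : R) (N : ℕ) :
    (2*N+2+b) * PP (gW (b^2)) (b^2) N = (2*b+1)*(2*b+3)*(2*N-b) * PP (g0 R) ((b+2)^2) N
      + 2*(2*N+1)*(4*N+3)*(2*N+1+b) * cc (b^2) N := by
  induction N with
  | zero => simp [PP, gW, g0, cc]; ring
  | succ N ih =>
    simp only [PP]
    rw [cc_succ, cc_succ2]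
    simp only [cc] at ih
    have hc := cb (R := R) N
    generalize ((2*(N+1)).choose (N+1) : R) = u at *
    generalize ((2*N).choose N : R) = v at *
    generalize (∏ j ∈ Finset.range N, ((2*(j:R)+1)^2 - b^2)) = Q at *
    generalize ((-1:R)^N) = e at *
    simp only [gW, g0]
    push_cast
    linear_combination 4*(2*N+4+b)*(2*N+2-b)*ih - 4*(2*N+4+b)*(2*N+2-b)*(4*N+3)*(2*N+1+b)*e*Q * hc

lemma id1 (b : R) (N : ℕ) :
    (2*N+2+b) * PP (g1 R) (b^2) N - (2*N-b) * PP (g1 R) ((b+2)^2) N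
      = 2*(2*N+1)*(2*N+1+b) * cc (b^2) N := by
  induction N with
  | zero => simp [PP, g1, cc]; ring
  | succ N ih =>
    simp only [PP]
    rw [cc_succ, cc_succ2]
    simp only [cc] at ih
    have hc := cb (R := R) N
    generalize ((2*(N+1)).choose (N+1) : R) = u at *
    generalize ((2*N).choose N : R) = v at *
    generalize (∏ j ∈ Finset.range N, ((2*(j:R)+1)^2 - b^2)) = Q at *
    generalize ((-1:R)^N) = e at *
    simp only [g1]
    push_cast
    linear_combination 4*(2*N+4+b)*(2*N+2-b)*ih - 4*(2*N+4+b)*(2*N+2-b)*(2*N+1+b)*e*Q * hc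

lemma Nr_shift (b : R) (N : ℕ) :
    Nr ((b+2)^2) N * ((2*N-b)*(b+2)) = -b*(2*N+2+b) * Nr (b^2) N := by
  induction N with
  | zero => simp [Nr]; ring
  | succ N ih =>
    simp only [Nr, Finset.prod_range_succ] at ih ⊢
    push_cast
    generalize (∏ j ∈ Finset.range N, (4*((j:R)+1)^2 - (b+2)^2)) = Q at *
    generalize (∏ j ∈ Finset.range N, (4*((j:R)+1)^2 - b^2)) = Q' at *
    rw [pow_succ (4:R) N]
    generalize ((4:R)^N) = e at *
    linear_combination 4*(2*N+4+b)*(2*N+2-b)*ih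

lemma cc_van (m k : ℕ) (h : m < k) : cc ((2*(m:R)+1)^2) k = 0 := by
  unfold cc
  rw [Finset.prod_eq_zero (Finset.mem_range.2 h) (by ring), mul_zero]

lemma PP_neg (g : ℕ → R) (b : R) (N : ℕ) : PP g ((-b)^2) N = PP g (b^2) N := by
  rw [neg_sq]

lemma PP_one (g : ℕ → R) (hg : g 0 = 1) (N : ℕ) : PP g 1 N = Nr 1 N := by
  induction N with
  | zero => simp [PP, Nr, hg]
  | succ N ih =>
    have := cc_van (R := R) 0 (N+1) (by omega)
    simp at this
    rw [PP, this, ih]; simp only [Nr, Finset.prod_range_succ]; ring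

end A

section map
variable {R S : Type*} [CommRing R] [CommRing S] (φ : R →+* S)
lemma map_cc (Y : R) (k : ℕ) : φ (cc Y k) = cc (φ Y) k := by
  simp [cc, map_prod, map_ofNat φ 2]
lemma map_PP (g : ℕ → R) (Y : R) (N : ℕ) : φ (PP g Y N) = PP (fun k => φ (g k)) (φ Y) N := by
  induction N with
  | zero => rfl
  | succ N ih => simp [PP, ih, map_cc, map_ofNat φ 4]
lemma map_PP0 (Y : R) (N : ℕ) : φ (PP (g0 R) Y N) = PP (g0 S) (φ Y) N := by
  rw [map_PP]; congr 1; ext k; simp [g0]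
lemma map_PP1 (Y : R) (N : ℕ) : φ (PP (g1 R) Y N) = PP (g1 S) (φ Y) N := by
  rw [map_PP]; congr 1; ext k; simp [g1, map_ofNat φ 4]
lemma map_PPW (Y : R) (N : ℕ) : φ (PP (gW Y) Y N) = PP (gW (φ Y)) (φ Y) N := by
  rw [map_PP]; congr 1; ext k; simp [gW, map_ofNat φ 4, map_ofNat φ 32, map_ofNat φ 16, map_ofNat φ 3]
lemma map_Nr (Y : R) (N : ℕ) : φ (Nr Y N) = Nr (φ Y) N := by
  simp [Nr, map_prod, map_ofNat φ 4]
end map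

end S5

namespace S5

def FF (N m : ℕ) : ℚ := PP (g0 ℚ) ((2*(m:ℚ)+1)^2) N
def NN (N m : ℕ) : ℚ := Nr ((2*(m:ℚ)+1)^2) N

lemma odd_ne (a b : ℕ) : (2*(a:ℚ) - 2*b - 1) ≠ 0 := by
  intro h
  have h2 : (2*(a:ℤ) - 2*b - 1) = 0 := by exact_mod_cast h
  omega

lemma NN_ne (N m : ℕ) : NN N m ≠ 0 := by
  unfold NN Nr
  refine mul_ne_zero (by positivity) (Finset.prod_ne_zero_iff.2 ?_)
  intro j _ h
  have h2 : (4*((j:ℤ)+1)^2 - (2*(m:ℤ)+1)^2) = 0 := by exact_mod_cast h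
  have h3 : 2 * (2*((j:ℤ)+1)^2 - 2*(m:ℤ)^2-2*m) = 1 := by linear_combination h2
  omega

lemma NN_succ (N m : ℕ) : NN N (m+1) * ((2*N-2*m-1)*(2*m+3)) = -(2*m+1)*(2*N+2*m+3) * NN N m := by
  have := Nr_shift (2*(m:ℚ)+1) N
  unfold NN
  push_cast
  rw [show (2*((m:ℚ)+1)+1) = 2*m+1+2 by ring]
  linear_combination this

lemma FF_zero (N : ℕ) : FF N 0 = NN N 0 := by
  unfold FF NN
  simp [PP_one (g0 ℚ) rfl]

lemma FF_rec (N m : ℕ) (h : m + 1 < N) :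
    FF N (m+2) * ((4*m+7)*(4*m+9)*(2*N-2*m-3)*(2*N-2*m-1)) =
      (4*m+5)*(4*m+3)*(2*N+2*m+3)*(2*N+2*m+5) * FF N m := by
  have h1 := idW (2*((m+1:ℕ):ℚ)+1) N
  have h2 := idW (-(2*((m+1:ℕ):ℚ)+1)) N
  rw [cc_van _ _ h] at h1
  rw [neg_sq, cc_van _ _ h] at h2
  have e1 : (2*((m+1:ℕ):ℚ)+1+2)^2 = (2*((m+2:ℕ):ℚ)+1)^2 := by push_cast; ring
  have e2 : (-(2*((m+1:ℕ):ℚ)+1)+2)^2 = (2*((m:ℕ):ℚ)+1)^2 := by push_cast; ring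
  rw [e1] at h1
  rw [e2] at h2
  unfold FF
  generalize PP (R := ℚ) (gW _) _ N = W at h1 h2
  generalize PP (g0 ℚ) ((2*((m+2:ℕ):ℚ)+1)^2) N = A at *
  generalize PP (g0 ℚ) ((2*((m:ℕ):ℚ)+1)^2) N = B at *
  push_cast at h1 h2
  linear_combination -(2*N-2*m-1) * h1 + (2*N+2*m+5)*h2

lemma FF_01 (N : ℕ) (h : 0 < N) :
    FF N 1 * (15*(2*N-1)) = - (2*N+3) * FF N 0 := by
  have h1 := idW (1:ℚ) N
  have h2 := idW (-1:ℚ) N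
  have h3 := cc_van (R := ℚ) 0 N h
  simp only [Nat.cast_zero, mul_zero, zero_add, one_pow] at h3
  rw [neg_sq] at h2
  simp only [one_pow] at h1 h2
  rw [h3] at h1 h2
  have e1 : ((1:ℚ)+2)^2 = (2*((1:ℕ):ℚ)+1)^2 := by push_cast; ring
  have e2 : ((-1:ℚ)+2)^2 = (2*((0:ℕ):ℚ)+1)^2 := by push_cast; ring
  rw [e1] at h1
  rw [e2] at h2
  unfold FF
  have : (2*(N:ℚ)+1) ≠ 0 := by positivity
  apply mul_left_cancel₀ this
  linear_combination -(2*N+1) * h1 + (2*N+3)*h2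

lemma FF_mul (N m : ℕ) (h : m < N) :
    FF N m * FF N (m+1) * ((4*m+3)*(4*m+5)) = (2*m+1)*(2*m+3) * NN N m * NN N (m+1) := by
  induction m with
  | zero =>
    have h1 := FF_01 N h
    have h2 := NN_succ N 0
    have h3 := odd_ne N 0
    rw [FF_zero] at *
    push_cast at *
    simp only [zero_add, mul_zero, sub_zero] at *
    apply mul_left_cancel₀ h3
    linear_combination NN N 0 * h1 - NN N 0 * h2
  | succ m ih =>
    have ih := ih (by omega)
    have h1 := FF_rec N m h
    have h2 := NN_succ N m
    have h3 := NN_succ N (m+1)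
    have o1 := odd_ne N m
    have o2 := odd_ne N (m+1)
    push_cast at *
    have hm : (4*(m:ℚ)+3)*(4*m+5) ≠ 0 := by positivity
    have hm2 : (2*(m:ℚ)+1)  ≠ 0 := by positivity
    have hm3 : (2*(m:ℚ)+3)  ≠ 0 := by positivity
    apply mul_left_cancel₀ (mul_ne_zero (mul_ne_zero (mul_ne_zero (mul_ne_zero o1 o2) hm) hm2) hm3)
    rw [show m+1+1 = m+2 from rfl] at *
    have e1 : (FF N (m+1) * FF N (m+2) * (4*(m+1)+3)*(4*(m+1)+5)) * ((2*N-2*m-1)*(2*N-2*(m+1)-1)) * ((4*m+3)*(4*m+5))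
      = (4*m+5)*(4*m+3)*(2*N+2*m+3)*(2*N+2*m+5) * ((2*m+1)*(2*m+3) * NN N m * NN N (m+1)) := by
      linear_combination FF N (m+1) * ((4*m+3)*(4*m+5)) * h1 + (4*m+5)*(4*m+3)*(2*N+2*m+3)*(2*N+2*m+5) * ih
    have e2 : NN N (m+2) * ((2*N-2*m-1)*(2*N-2*(m+1)-1)) * (2*m+5) * (2*m+3) = (2*m+3)*(2*N+2*m+5) * (2*m+1)*(2*N+2*m+3) * NN N m := by
      linear_combination (2*N-2*m-1) * (2*m+3)* h3 - (2*m+3)*(2*N+2*m+5) * h2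
    linear_combination (2*m+1)*(2*m+3)*e1 - NN N (m+1)*(4*m+3)*(4*m+5)*(2*m+1)*(2*m+3)*e2

def E1 (R : Type*) [CommRing R] (l : ℕ) : R := ∏ i ∈ Finset.range l, ((8*(i:R)+7)*(8*i+9))
def E2 (R : Type*) [CommRing R] (l : ℕ) : R := ∏ i ∈ Finset.range l, ((8*(i:R)+3)*(8*i+5))

lemma E1_ne (l : ℕ) : E1 ℚ l ≠ 0 := by
  unfold E1; exact Finset.prod_ne_zero_iff.2 (fun i _ => by positivity)
lemma E2_ne (l : ℕ) : E2 ℚ l ≠ 0 := by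
  unfold E2; exact Finset.prod_ne_zero_iff.2 (fun i _ => by positivity)

lemma FF_even (N l : ℕ) (h : 2*l ≤ N) :
    FF N (2*l) * E1 ℚ l = NN N (2*l) * (4*l+1) * E2 ℚ l := by
  induction l with
  | zero => simp [FF_zero, E1, E2]
  | succ l ih =>
    have ih := ih (by omega)
    have h1 := FF_rec N (2*l) (by omega)
    have h2 := NN_succ N (2*l)
    have h3 := NN_succ N (2*l+1)
    have o1 := odd_ne N (2*l)
    have o2 := odd_ne N (2*l+1)
    simp only [E1, E2, Finset.prod_range_succ] at ih ⊢
    rw [show 2*(l+1) = 2*l+2 by ring]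
    rw [show 2*l+1+1 = 2*l+2 from rfl] at *
    generalize ∏ i ∈ Finset.range l, ((8*(i:ℚ)+7)*(8*i+9)) = U at *
    generalize ∏ i ∈ Finset.range l, ((8*(i:ℚ)+3)*(8*i+5)) = V at *
    push_cast at *
    have hm : (4*(l:ℚ)+3) ≠ 0 := by positivity
    apply mul_left_cancel₀ (mul_ne_zero (mul_ne_zero o1 o2) hm)
    have e2 : NN N (2*l+2) * ((2*N-2*(2*l)-1)*(2*N-2*(2*l+1)-1)) * (2*(2*l)+5) * (2*(2*l)+3) = (2*(2*l)+3)*(2*N+2*(2*l)+5) * (2*(2*l)+1)*(2*N+2*(2*l)+3) * NN N (2*l) := by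
      linear_combination (2*N-2*(2*l)-1) * (2*(2*l)+3)* h3 - (2*(2*l)+3)*(2*N+2*(2*l)+5) * h2
    linear_combination (4*l+3)*U*h1 + (4*l+3)*(8*l+5)*(8*l+3)*(2*N+2*(2*l)+3)*(2*N+2*(2*l)+5)*ih - (8*l+3)*(8*l+5)*V*e2

lemma FF_odd (N l : ℕ) (h : 2*l+1 ≤ N) :
    FF N (2*l+1) * E2 ℚ (l+1) = NN N (2*l+1) * (4*l+3) * E1 ℚ l := by
  have h1 := FF_even N l (by omega)
  have h2 := FF_mul N (2*l) (by omega)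
  have n0 := NN_ne N (2*l)
  have n1 : (4*(l:ℚ)+1) ≠ 0 := by positivity
  have : E2 ℚ (l+1) = E2 ℚ l * ((8*l+3)*(8*l+5)) := by
    simp [E2, Finset.prod_range_succ]
  rw [this]
  push_cast at *
  apply mul_left_cancel₀ (mul_ne_zero n0 n1)
  linear_combination -FF N (2*l+1) * ((8*l+3)*(8*l+5)) * h1 + E1 ℚ l * h2

lemma FW (N : ℕ) (h : 0 < N) :
    FF N N * PP (gW ((2*(N:ℚ)+1)^2)) ((2*(N:ℚ)+1)^2) N = -(2*N+1)^2 * NN N N ^2 := by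
  obtain ⟨m, rfl⟩ : ∃ m, N = m+1 := ⟨N-1, by omega⟩
  have h2 := idW (-(2*((m+1:ℕ):ℚ)+1)) (m+1)
  have h3 := FF_mul (m+1) m (by omega)
  have h4 := NN_succ (m+1) m
  rw [neg_sq] at h2
  have e2 : (-(2*((m+1:ℕ):ℚ)+1)+2)^2 = (2*((m:ℕ):ℚ)+1)^2 := by push_cast; ring
  rw [e2] at h2
  change _ = _ * FF (m+1) m + _ at h2
  generalize cc (R := ℚ) _ (m+1) = cx at h2
  generalize PP (R := ℚ) (gW _) _ (m+1) = W at *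
  push_cast at *
  have : W = (4*m+5)*(4*m+3)*(4*m+5)*FF (m+1) m := by linear_combination h2
  rw [this]
  linear_combination (4*m+5)*h3 + NN (m+1) (m+1)*(2*m+3) * h4

lemma FW_even (N l : ℕ) (h : 0 < N) (hl : N = 2*l) :
    PP (gW ((2*(N:ℚ)+1)^2)) ((2*(N:ℚ)+1)^2) N * E2 ℚ l = -(2*N+1) * NN N N * E1 ℚ l := by
  have h1 := FW N h
  have h2 := FF_even N l (by omega)
  rw [← hl] at h2
  have hc : (N:ℚ) = 2*l := by exact_mod_cast hl
  have n0 := NN_ne N N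
  have n1 : (4*(l:ℚ)+1) ≠ 0 := by positivity
  apply mul_left_cancel₀ (mul_ne_zero n0 n1)
  generalize PP (R := ℚ) (gW _) _ N = W at *
  rw [hc] at h1 ⊢
  linear_combination -W * h2 + E1 ℚ l * h1

lemma FW_odd (N l : ℕ) (h : 0 < N) (hl : N = 2*l+1) :
    PP (gW ((2*(N:ℚ)+1)^2)) ((2*(N:ℚ)+1)^2) N * E1 ℚ l = -(2*N+1) * NN N N * E2 ℚ (l+1) := by
  have h1 := FW N h
  have h2 := FF_odd N l (by omega)
  rw [← hl] at h2
  have hc : (N:ℚ) = 2*l+1 := by exact_mod_cast hl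
  have n0 := NN_ne N N
  have n1 : (4*(l:ℚ)+3) ≠ 0 := by positivity
  apply mul_left_cancel₀ (mul_ne_zero n0 n1)
  generalize PP (R := ℚ) (gW _) _ N = W at *
  rw [hc] at h1 ⊢
  linear_combination -W * h2 + E2 ℚ (l+1) * h1

lemma F1_eq (N m : ℕ) (h : m ≤ N) :
    PP (g1 ℚ) ((2*(m:ℚ)+1)^2) N = NN N m * ((-1)^m * (2*m+1)) := by
  induction m with
  | zero =>
    unfold NN
    simp [PP_one (g1 ℚ) (by simp [g1])]
  | succ m ih =>
    have ih := ih (by omega)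
    have h1 := id1 (2*(m:ℚ)+1) N
    rw [cc_van _ _ (by omega)] at h1
    have e1 : (2*((m:ℕ):ℚ)+1+2)^2 = (2*((m+1:ℕ):ℚ)+1)^2 := by push_cast; ring
    rw [e1, ih] at h1
    have h2 := NN_succ N m
    have o1 := odd_ne N m
    push_cast at *
    apply mul_left_cancel₀ o1
    rw [pow_succ (-1:ℚ) m]
    linear_combination -h1 + (-1)^m * h2

/-! transfer to arbitrary rings -/
section
variable (R : Type*) [CommRing R]
lemma map_E1 {S : Type*} [CommRing S] (φ : R →+* S) (l : ℕ) : φ (E1 R l) = E1 S l := by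
  simp [E1, map_prod, map_ofNat φ 8, map_ofNat φ 7, map_ofNat φ 9]
lemma map_E2 {S : Type*} [CommRing S] (φ : R →+* S) (l : ℕ) : φ (E2 R l) = E2 S l := by
  simp [E2, map_prod, map_ofNat φ 8, map_ofNat φ 3, map_ofNat φ 5]

lemma T_even (n l : ℕ) (hl : n = 2*l) :
    PP (g0 R) ((2*(n:R)+1)^2) n * E1 R l = Nr ((2*(n:R)+1)^2) n * (2*n+1) * E2 R l := by
  have h := FF_even n l (by omega)
  have key : PP (g0 ℤ) ((2*(n:ℤ)+1)^2) n * E1 ℤ l = Nr ((2*(n:ℤ)+1)^2) n * (2*n+1) * E2 ℤ l := by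
    apply (RingHom.injective_int (Int.castRingHom ℚ))
    simp only [map_mul, map_PP0, map_E1, map_E2, map_Nr]
    simp only [map_pow, map_add, map_mul, map_one, map_natCast, map_ofNat]
    rw [← hl] at h
    unfold FF NN at h
    rw [h]
    have : (n:ℚ) = 2*l := by exact_mod_cast hl
    rw [show 4*(l:ℚ)+1 = 2*n+1 by rw [this]; ring]
  have := congrArg (Int.castRingHom R) key
  simp only [map_mul, map_PP0, map_E1, map_E2, map_Nr] at this
  simpa only [map_pow, map_add, map_mul, map_one, map_natCast, map_ofNat] using this

lemma T_odd (n l : ℕ) (hl : n = 2*l+1) :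
    PP (g0 R) ((2*(n:R)+1)^2) n * E2 R (l+1) = Nr ((2*(n:R)+1)^2) n * (2*n+1) * E1 R l := by
  have h := FF_odd n l (by omega)
  have key : PP (g0 ℤ) ((2*(n:ℤ)+1)^2) n * E2 ℤ (l+1) = Nr ((2*(n:ℤ)+1)^2) n * (2*n+1) * E1 ℤ l := by
    apply (RingHom.injective_int (Int.castRingHom ℚ))
    simp only [map_mul, map_PP0, map_E1, map_E2, map_Nr]
    simp only [map_pow, map_add, map_mul, map_one, map_natCast, map_ofNat]
    rw [← hl] at h
    unfold FF NN at h
    rw [h]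
    have : (n:ℚ) = 2*l+1 := by exact_mod_cast hl
    rw [show 4*(l:ℚ)+3 = 2*n+1 by rw [this]; ring]
  have := congrArg (Int.castRingHom R) key
  simp only [map_mul, map_PP0, map_E1, map_E2, map_Nr] at this
  simpa only [map_pow, map_add, map_mul, map_one, map_natCast, map_ofNat] using this

lemma TW_even (n l : ℕ) (h : 0 < n) (hl : n = 2*l) :
    PP (gW ((2*(n:R)+1)^2)) ((2*(n:R)+1)^2) n * E2 R l = -(2*n+1) * Nr ((2*(n:R)+1)^2) n * E1 R l := by
  have h := FW_even n l h hl
  have key : PP (gW ((2*(n:ℤ)+1)^2)) ((2*(n:ℤ)+1)^2) n * E2 ℤ l = -(2*n+1) * Nr ((2*(n:ℤ)+1)^2) n * E1 ℤ l := by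
    apply (RingHom.injective_int (Int.castRingHom ℚ))
    simp only [map_mul, map_PPW, map_E1, map_E2, map_Nr]
    simp only [map_pow, map_add, map_mul, map_one, map_natCast, map_ofNat, map_neg]
    exact h
  have := congrArg (Int.castRingHom R) key
  simp only [map_mul, map_PPW, map_E1, map_E2, map_Nr] at this
  simpa only [map_pow, map_add, map_mul, map_one, map_natCast, map_ofNat, map_neg] using this

lemma TW_odd (n l : ℕ) (h : 0 < n) (hl : n = 2*l+1) :
    PP (gW ((2*(n:R)+1)^2)) ((2*(n:R)+1)^2) n * E1 R l = -(2*n+1) * Nr ((2*(n:R)+1)^2) n * E2 R (l+1) := by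
  have h := FW_odd n l h hl
  have key : PP (gW ((2*(n:ℤ)+1)^2)) ((2*(n:ℤ)+1)^2) n * E1 ℤ l = -(2*n+1) * Nr ((2*(n:ℤ)+1)^2) n * E2 ℤ (l+1) := by
    apply (RingHom.injective_int (Int.castRingHom ℚ))
    simp only [map_mul, map_PPW, map_E1, map_E2, map_Nr]
    simp only [map_pow, map_add, map_mul, map_one, map_natCast, map_ofNat, map_neg]
    exact h
  have := congrArg (Int.castRingHom R) key
  simp only [map_mul, map_PPW, map_E1, map_E2, map_Nr] at this
  simpa only [map_pow, map_add, map_mul, map_one, map_natCast, map_ofNat, map_neg] using this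

lemma TFW (n : ℕ) (h : 0 < n) :
    PP (g0 R) ((2*(n:R)+1)^2) n * PP (gW ((2*(n:R)+1)^2)) ((2*(n:R)+1)^2) n =
      -(2*n+1)^2 * Nr ((2*(n:R)+1)^2) n ^2 := by
  have h := FW n h
  have key : PP (g0 ℤ) ((2*(n:ℤ)+1)^2) n * PP (gW ((2*(n:ℤ)+1)^2)) ((2*(n:ℤ)+1)^2) n =
      -(2*n+1)^2 * Nr ((2*(n:ℤ)+1)^2) n ^2 := by
    apply (RingHom.injective_int (Int.castRingHom ℚ))
    simp only [map_mul, map_PPW, map_PP0, map_neg, map_pow, map_Nr]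
    simp only [map_pow, map_add, map_mul, map_one, map_natCast, map_ofNat, map_neg]
    exact h
  have := congrArg (Int.castRingHom R) key
  simp only [map_mul, map_PPW, map_PP0, map_neg, map_pow, map_Nr] at this
  simpa only [map_pow, map_add, map_mul, map_one, map_natCast, map_ofNat, map_neg] using this

lemma T1_eq (n : ℕ) :
    PP (g1 R) ((2*(n:R)+1)^2) n = Nr ((2*(n:R)+1)^2) n * ((-1)^n * (2*n+1)) := by
  have h := F1_eq n n le_rfl
  have key : PP (g1 ℤ) ((2*(n:ℤ)+1)^2) n = Nr ((2*(n:ℤ)+1)^2) n * ((-1)^n * (2*n+1)) := by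
    apply (RingHom.injective_int (Int.castRingHom ℚ))
    simp only [map_mul, map_PP1, map_neg, map_pow, map_Nr]
    simp only [map_pow, map_add, map_mul, map_one, map_natCast, map_ofNat, map_neg]
    exact h
  have := congrArg (Int.castRingHom R) key
  simp only [map_mul, map_PP1, map_neg, map_pow, map_Nr] at this
  simpa only [map_pow, map_add, map_mul, map_one, map_natCast, map_ofNat, map_neg] using this
end
end S5

namespace S5
open Polynomial

section per
variable {p : ℕ} [hp : Fact p.Prime]

lemma eval_all (a : ZMod p) (ha : a ≠ 0) (P : ZMod p → Prop) (h0 : P 0)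
    (hs : ∀ x, P x → P (x + a)) (x : ZMod p) : P x := by
  have : ∀ k : ℕ, P (k * a) := by
    intro k
    induction k with
    | zero => simpa using h0
    | succ k ih =>
      have := hs _ ih
      push_cast
      rwa [add_mul, one_mul]
  have h := this (x * a⁻¹).val
  rw [ZMod.natCast_zmod_val, mul_assoc, inv_mul_cancel₀ ha, mul_one] at h
  exact h

lemma zero_of_eval (F : (ZMod p)[X]) (hd : F.natDegree < p) (h : ∀ x, F.eval x = 0) : F = 0 := by
  apply Polynomial.eq_zero_of_natDegree_lt_card_of_eval_eq_zero F (f := fun x : ZMod p => x)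
    Function.injective_id h
  simpa [ZMod.card] using hd

lemma per_const (a : ZMod p) (ha : a ≠ 0) (F : (ZMod p)[X]) (hd : F.natDegree < p)
    (h : taylor a F = F) : F = C (F.eval 0) := by
  rw [← sub_eq_zero]
  apply zero_of_eval
  · exact lt_of_le_of_lt (natDegree_sub_le _ _) (by simpa using hd)
  · apply eval_all a ha
    · simp
    · intro x hx
      have := congrArg (fun q => eval x q) h
      simp only [taylor_eval] at this
      simp only [eval_sub, eval_C, sub_eq_zero] at *
      rw [this, hx]

noncomputable def Lam (p : ℕ) : (ZMod p)[X] := X^p - X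

lemma Lam_per (a : ZMod p) : taylor a (Lam p) = Lam p := by
  unfold Lam
  rw [map_sub, taylor_X_pow, taylor_X, add_pow_char, ← C_pow, ZMod.pow_card]
  ring

lemma Lam_monic : (Lam p).Monic := by
  apply monic_X_pow_sub
  rw [degree_X]
  exact_mod_cast hp.out.one_lt

lemma Lam_natDegree : (Lam p).natDegree = p := by
  unfold Lam
  exact FiniteField.X_pow_card_sub_X_natDegree_eq _ hp.out.one_lt

lemma Lam_eval (x : ZMod p) : (Lam p).eval x = 0 := by
  simp [Lam, ZMod.pow_card]

lemma Lam_dvd (F : (ZMod p)[X]) (h : ∀ x, F.eval x = 0) : Lam p ∣ F := by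
  rw [← Polynomial.modByMonic_eq_zero_iff_dvd Lam_monic]
  apply zero_of_eval
  · have := natDegree_modByMonic_lt F (Lam_monic (p := p)) ?_
    · rwa [Lam_natDegree] at this
    · intro h1
      have := Lam_natDegree (p := p)
      rw [h1] at this
      simp at this
      exact hp.out.ne_zero this.symm
  · intro x
    have := modByMonic_add_div F (Lam p)
    have := congrArg (fun q => eval x q) this
    simpa [Lam_eval, h] using this

lemma nd_lt {R : Type*} [CommRing R] (F : R[X]) (m : ℕ) (hm : m ≠ 0) (h1 : F.natDegree ≤ m)
    (h3 : F.coeff m = 0) : F.natDegree < m := by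
  apply lt_of_le_of_ne h1
  intro h2
  rw [← h2] at h3
  have h4 : F = 0 := leadingCoeff_eq_zero.1 h3
  rw [h4] at h2
  simp at h2
  exact hm h2.symm

lemma per_lin (a : ZMod p) (ha : a ≠ 0) (F : (ZMod p)[X]) (hd : F.natDegree ≤ p)
    (h : taylor a F = F) : ∃ c e, F = C c * Lam p + C e := by
  refine ⟨F.coeff p, (F - C (F.coeff p) * Lam p).eval 0, ?_⟩
  rw [← per_const a ha (F - C (F.coeff p) * Lam p)]
  · ring
  · have h1 : (F - C (F.coeff p) * Lam p).natDegree ≤ p := by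
      apply (natDegree_sub_le _ _).trans
      apply max_le hd
      exact (natDegree_C_mul_le _ _).trans Lam_natDegree.le
    apply nd_lt _ _ hp.out.ne_zero h1
    have := Lam_monic (p := p)
    rw [Monic, leadingCoeff, Lam_natDegree] at this
    simp [this]
  · rw [map_sub, taylor_mul, taylor_C, Lam_per, h]

lemma cross (a : ZMod p) (ha : a ≠ 0) (F G : (ZMod p)[X]) (hF : F.natDegree < p) (hG : G.natDegree < p)
    (hG0 : G ≠ 0) (h : taylor a F * G = F * taylor a G) : ∃ c, F = C c * G := by
  have hg := gcd_ne_zero_of_right (a := F) hG0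
  have hco := isCoprime_div_gcd_div_gcd (p := F) hG0
  have e1 := EuclideanDomain.mul_div_cancel' hg (gcd_dvd_left F G)
  have e2 := EuclideanDomain.mul_div_cancel' hg (gcd_dvd_right F G)
  set d := GCDMonoid.gcd F G
  set E := F / d
  set H := G / d
  have hH : H ≠ 0 := by rintro h0; rw [h0] at e2; simp at e2; exact hG0 e2.symm
  have ht : taylor a d ≠ 0 := by rwa [Ne, taylor_eq_zero]
  have hEH : taylor a E * H = E * taylor a H := by
    rw [← e1, ← e2, taylor_mul, taylor_mul] at h
    apply mul_left_cancel₀ (mul_ne_zero hg ht)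
    linear_combination h
  have key : ∀ U V : (ZMod p)[X], IsCoprime U V → U ≠ 0 → taylor a U * V = U * taylor a V →
      taylor a U = U := by
    intro U V hc hU hUV
    have hdvd : U ∣ taylor a U := hc.dvd_of_dvd_mul_right (Dvd.intro _ hUV.symm)
    obtain ⟨w, hw⟩ := hdvd
    have hw0 : w ≠ 0 := by
      rintro rfl
      rw [mul_zero, taylor_eq_zero] at hw
      exact hU hw
    have hdeg := natDegree_taylor U a
    have hlead := leadingCoeff_taylor a U
    rw [hw, natDegree_mul hU hw0] at hdeg
    have hwd : w.natDegree = 0 := by omega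
    rw [hw, leadingCoeff_mul] at hlead
    have hw1 : w.leadingCoeff = 1 := by
      have := leadingCoeff_ne_zero.2 hU
      apply mul_left_cancel₀ this
      rw [hlead, mul_one]
    have : w = 1 := by
      rw [eq_C_of_natDegree_eq_zero hwd]
      rw [leadingCoeff, hwd] at hw1
      rw [hw1, C_1]
    rw [hw, this, mul_one]
  have degle : ∀ U V : (ZMod p)[X], d * U = V → V.natDegree < p → U.natDegree < p := by
    intro U V h1 h2
    by_cases hU : U = 0
    · rw [hU]; simpa using hp.out.pos
    · rw [← h1, natDegree_mul hg hU] at h2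
      omega
  have hHc := per_const a ha H (degle _ _ e2 hG) (key H E hco.symm hH (by linear_combination -hEH))
  have hEc : E = C (E.eval 0) := by
    by_cases hE : E = 0
    · rw [hE]; simp
    · exact per_const a ha E (degle _ _ e1 hF) (key E H hco hE hEH)
  have hh : H.eval 0 ≠ 0 := by
    intro h0; rw [h0] at hHc; simp at hHc; exact hH hHc
  refine ⟨E.eval 0 * (H.eval 0)⁻¹, ?_⟩
  rw [← e1, ← e2, hEc, hHc]
  simp only [eval_C]
  have : (C (eval 0 H) : (ZMod p)[X]) * C (eval 0 H)⁻¹ = 1 := by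
    rw [← C_mul, mul_inv_cancel₀ hh, C_1]
  rw [C_mul]
  linear_combination -d * C (eval 0 E) * this
end per
end S5

namespace S5
open Polynomial

section deg
variable {R : Type*} [CommRing R]

lemma nd_lin (a : R) : (C a - X : R[X]).natDegree ≤ 1 := by
  apply (natDegree_sub_le _ _).trans
  simp [natDegree_X_le]

lemma prod_lin (a : ℕ → R) (k : ℕ) :
    (∏ j ∈ Finset.range k, (C (a j) - X : R[X])).natDegree ≤ k ∧
    (∏ j ∈ Finset.range k, (C (a j) - X : R[X])).coeff k = (-1)^k := by
  induction k with
  | zero => simp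
  | succ k ih =>
    rw [Finset.prod_range_succ]
    refine ⟨natDegree_mul_le.trans (Nat.add_le_add ih.1 (nd_lin _)), ?_⟩
    rw [coeff_mul_add_eq_of_natDegree_le ih.1 (nd_lin _), ih.2]
    simp [pow_succ, coeff_C]

lemma cc_deg (k : ℕ) : (cc (X : R[X]) k).natDegree ≤ k ∧
    (cc (X : R[X]) k).coeff k = ((2*k).choose k : R) := by
  have e : cc (X : R[X]) k = C (((2*k).choose k : R) * (-1)^k) *
      ∏ j ∈ Finset.range k, (C ((2*(j:R)+1)^2) - X : R[X]) := by
    simp [cc, C_mul, C_pow, map_ofNat C 2]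
  have := prod_lin (fun j => (2*(j:R)+1)^2) k
  rw [e]
  refine ⟨(natDegree_C_mul_le _ _).trans this.1, ?_⟩
  rw [coeff_C_mul, this.2, mul_assoc, ← mul_pow]; simp

def LL (R : Type*) [CommRing R] : ℕ → R
  | 0 => 1
  | N+1 => -4 * LL R N + ((2*(N+1)).choose (N+1) : R)

lemma Nr_eq (N : ℕ) : Nr (X : R[X]) N = C (4^N) * ∏ j ∈ Finset.range N, (C (4*((j:R)+1)^2) - X : R[X]) := by
  simp [Nr, C_mul, C_pow, map_ofNat C 4]

lemma Nr_deg (N : ℕ) : (Nr (X : R[X]) N).natDegree ≤ N := by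
  rw [Nr_eq]
  exact (natDegree_C_mul_le _ _).trans (prod_lin _ _).1

lemma fac_eq (N : ℕ) : (4*(4*((N:R[X])+1)^2 - X) : R[X]) = C 4 * (C (4*((N:R)+1)^2) - X) := by
  simp [C_mul, C_pow, map_ofNat C 4]

lemma fac_deg (N : ℕ) : (4*(4*((N:R[X])+1)^2 - X) : R[X]).natDegree ≤ 1 := by
  rw [fac_eq]; exact (natDegree_C_mul_le _ _).trans (nd_lin _)
lemma fac_coeff (N : ℕ) : (4*(4*((N:R[X])+1)^2 - X) : R[X]).coeff 1 = -4 := by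
  rw [fac_eq, coeff_C_mul, coeff_sub, coeff_C]; simp

lemma PP_deg (g : ℕ → R) (N : ℕ) : (PP (fun k => C (g k)) (X : R[X]) N).natDegree ≤ N := by
  induction N with
  | zero => simp [PP]
  | succ N ih =>
    rw [PP]
    apply natDegree_add_le_of_degree_le
    · apply natDegree_mul_le.trans
      have := fac_deg (R := R) N
      omega
    · exact (natDegree_C_mul_le _ _).trans (cc_deg _).1

lemma PP0_C : (g0 R[X]) = fun k => C (g0 R k) := by ext1; simp [g0]
lemma PP1_C : (g1 R[X]) = fun k => C (g1 R k) := by ext1; simp [g1, map_ofNat C 4]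

lemma PP0_coeff (N : ℕ) : (PP (g0 R[X]) X N).coeff N = LL R N := by
  induction N with
  | zero => simp [PP, LL, g0]
  | succ N ih =>
    rw [PP, LL, coeff_add, add_comm N 1, coeff_mul_add_eq_of_natDegree_le (fac_deg N)
      (by rw [PP0_C]; exact PP_deg _ N), ih, fac_coeff, add_comm 1 N]
    simp [g0, (cc_deg _).2]

lemma gW_eq (k : ℕ) : gW (X : R[X]) k = C 4 * (C (8*(k:R)^2) - X) + C (16*(k:R)+3) := by
  simp only [gW, C_mul, C_add, C_pow, map_ofNat C, map_natCast]
  ring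
lemma gW_deg (k : ℕ) : (gW (X : R[X]) k).natDegree ≤ 1 := by
  rw [gW_eq]
  apply natDegree_add_le_of_degree_le
  · exact (natDegree_C_mul_le _ _).trans (nd_lin _)
  · rw [natDegree_C]; omega
lemma gW_coeff (k : ℕ) : (gW (X : R[X]) k).coeff 1 = -4 := by
  rw [gW_eq, coeff_add, coeff_C_mul, coeff_sub, coeff_C, coeff_C]; simp

lemma PPW_deg (N : ℕ) : (PP (gW X) (X : R[X]) N).natDegree ≤ N + 1 ∧
    (PP (gW X) (X : R[X]) N).coeff (N+1) = -4 * LL R N := by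
  induction N with
  | zero =>
    simp only [PP, LL, mul_one, zero_add]
    exact ⟨gW_deg _, gW_coeff _⟩
  | succ N ih =>
    constructor
    · rw [PP]
      apply natDegree_add_le_of_degree_le
      · apply natDegree_mul_le.trans
        have := fac_deg (R := R) N
        omega
      · apply natDegree_mul_le.trans
        have := gW_deg (R := R) (N+1)
        have := (cc_deg (R := R) (N+1)).1
        omega
    · rw [PP, LL, coeff_add, show N+1+1 = 1 + (N+1) by ring,
        coeff_mul_add_eq_of_natDegree_le (fac_deg N) ih.1, ih.2, fac_coeff,
        coeff_mul_add_eq_of_natDegree_le (gW_deg _) (cc_deg _).1, gW_coeff, (cc_deg _).2]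
      ring
end deg

section modp
variable {p : ℕ} [hp : Fact p.Prime]

lemma exp_PP0 (N : ℕ) : expand (ZMod p) 2 (PP (g0 _) X N) = PP (g0 _) (X^2) N := by
  have := map_PP0 (expand (ZMod p) 2).toRingHom X N
  simpa using this
lemma exp_PP1 (N : ℕ) : expand (ZMod p) 2 (PP (g1 _) X N) = PP (g1 _) (X^2) N := by
  have := map_PP1 (expand (ZMod p) 2).toRingHom X N
  simpa using this
lemma exp_PPW (N : ℕ) : expand (ZMod p) 2 (PP (gW X) X N) = PP (gW (X^2)) (X^2) N := by
  have := map_PPW (expand (ZMod p) 2).toRingHom X N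
  simpa using this
lemma exp_Nr (N : ℕ) : expand (ZMod p) 2 (Nr X N) = Nr (X^2) N := by
  have := map_Nr (expand (ZMod p) 2).toRingHom X N
  simpa using this
lemma tay_PP0 (a : ZMod p) (Y) (N : ℕ) : taylor a (PP (g0 _) Y N) = PP (g0 _) (taylor a Y) N := by
  have := map_PP0 (taylorAlgHom a).toRingHom Y N
  simpa using this
lemma tay_PP1 (a : ZMod p) (Y) (N : ℕ) : taylor a (PP (g1 _) Y N) = PP (g1 _) (taylor a Y) N := by
  have := map_PP1 (taylorAlgHom a).toRingHom Y N
  simpa using this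
lemma tay_PPW (a : ZMod p) (Y) (N : ℕ) : taylor a (PP (gW Y) Y N) = PP (gW (taylor a Y)) (taylor a Y) N := by
  have := map_PPW (taylorAlgHom a).toRingHom Y N
  simpa using this
lemma tay_Nr (a : ZMod p) (Y) (N : ℕ) : taylor a (Nr Y N) = Nr (taylor a Y) N := by
  have := map_Nr (taylorAlgHom a).toRingHom Y N
  simpa using this
lemma tay_sq (a : ZMod p) : taylor a (X^2) = (X + C a)^2 := taylor_X_pow a 2


lemma n_rel (n : ℕ) (hn : p = 2*n+1) : 2*(n:ZMod p)+1 = 0 := by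
  have : ((p:ℕ):ZMod p) = 0 := by simp
  have h2 : ((p:ℕ):ZMod p) = ((2*n+1:ℕ):ZMod p) := congrArg _ hn
  rw [this] at h2; push_cast at h2; exact h2.symm
lemma n_relX (n : ℕ) (hn : p = 2*n+1) : 2*(n:(ZMod p)[X])+1 = 0 := by
  have := congrArg (C : ZMod p → (ZMod p)[X]) (n_rel n hn)
  simpa [map_ofNat C 2] using this

lemma two_ne (n : ℕ) (hn : p = 2*n+1) : (2:ZMod p) ≠ 0 := by
  intro h
  have h1 := n_rel n hn
  rw [h] at h1
  simp at h1

lemma X1_ne : (1 + X : (ZMod p)[X]) ≠ 0 := by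
  intro h
  have := congrArg (fun q => coeff q 1) h
  simp [coeff_one] at this

lemma W_rel (n : ℕ) (hn : p = 2*n+1) (b : (ZMod p)[X]) (hb : 1 + b ≠ 0) :
    PP (gW (b^2)) (b^2) n = -(2*b+1)*(2*b+3) * PP (g0 _) ((b+2)^2) n := by
  have h := idW b n
  have h2 := n_relX n hn
  apply mul_left_cancel₀ hb
  linear_combination h - PP (gW (b^2)) (b^2) n * h2 + (2*b+1)*(2*b+3) * PP (g0 _) ((b+2)^2) n * h2 +
     2*(4*n+3)*(2*n+1+b) * cc (b^2) n * h2

lemma P1_zero (n : ℕ) (hn : p = 2*n+1) : PP (g1 (ZMod p)[X]) X n = 0 := by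
  have h2 := n_relX n hn
  have h : taylor 2 (PP (g1 (ZMod p)[X]) (X^2) n) = - PP (g1 (ZMod p)[X]) (X^2) n := by
    rw [tay_PP1, tay_sq, map_ofNat C 2]
    have h := id1 (X : (ZMod p)[X]) n
    apply mul_left_cancel₀ X1_ne
    linear_combination h - PP (g1 _) (X^2) n * h2 + PP (g1 _) ((X+2)^2) n * h2 +
      2 * (2*n+1+X) * cc (X^2) n * h2
  rw [← exp_PP1] at h
  have hd : (PP (g1 (ZMod p)[X]) X n).natDegree ≤ n := by
    rw [PP1_C]; exact PP_deg _ n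
  set f := PP (g1 (ZMod p)[X]) X n
  have e1 : ∀ x, (expand (ZMod p) 2 f).eval (x+2) = - (expand (ZMod p) 2 f).eval x := by
    intro x
    have := congrArg (fun q => eval x q) h
    simpa only [taylor_eval, eval_neg] using this
  have e2 : ∀ k : ℕ, (expand (ZMod p) 2 f).eval (k*2:ZMod p) = (-1)^k * (expand (ZMod p) 2 f).eval 0 := by
    intro k
    induction k with
    | zero => simp
    | succ k ih => push_cast; rw [add_mul, one_mul, e1, ih]; ring
  have e3 := e2 p
  have hodd : Odd p := ⟨n, hn⟩
  rw [hodd.neg_one_pow] at e3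
  simp only [CharP.cast_eq_zero, zero_mul] at e3
  have e4 : (expand (ZMod p) 2 f).eval 0 = 0 := by
    apply mul_left_cancel₀ (two_ne n hn)
    linear_combination e3
  have e5 : expand (ZMod p) 2 f = 0 := by
    apply zero_of_eval
    · rw [natDegree_expand]; omega
    · apply eval_all 2 (two_ne n hn) (fun x => eval x ((expand (ZMod p) 2) f) = 0) e4
      intro x hx; rw [e1, hx, neg_zero]
  rwa [expand_eq_zero (by norm_num)] at e5

lemma Nr_coeff (n : ℕ) (hn : p = 2*n+1) (h3 : 3 < p) : (Nr (X : (ZMod p)[X]) n).coeff 1 = 0 := by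
  have h2 := n_relX n hn
  have hs := Nr_shift (X : (ZMod p)[X]) n
  have h : taylor 2 (X * Nr (X^2 : (ZMod p)[X]) n) = X * Nr (X^2) n := by
    rw [taylor_mul, taylor_X, tay_Nr, tay_sq, map_ofNat C 2]
    apply mul_left_cancel₀ X1_ne
    linear_combination -hs + (X * Nr (X^2) n + (X+2)*Nr ((X+2)^2) n) * h2
  obtain ⟨c, e, he⟩ := per_lin 2 (two_ne n hn) _ (by
    rw [← exp_Nr]
    apply natDegree_mul_le.trans
    have := Nr_deg (R := ZMod p) n
    rw [natDegree_expand, natDegree_X]; omega) h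
  have h5 := congrArg (fun q => coeff q 3) he
  rw [← exp_Nr] at h5
  simp only [coeff_X_mul] at h5
  rw [show 2 = 1 * 2 by norm_num, coeff_expand_mul (by norm_num)] at h5
  rw [h5]
  simp [Lam, coeff_X_pow, coeff_X, coeff_C, h3.ne]

lemma central_modp (n : ℕ) (hn : p = 2*n+1) (k : ℕ) (hk : k ≤ n) : ((2*k).choose k : ZMod p) = (-4)^k * (n.choose k : ZMod p) := by
  induction k with
  | zero => simp
  | succ k ih =>
    have ih := ih (by omega)
    have h1 := cb (R := ZMod p) k
    have h2 : ((n.choose (k+1) : ZMod p)) * (k+1) = (n.choose k : ZMod p) * (n - k) := by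
      have := Nat.choose_succ_right_eq n k
      have h3 := congrArg (Nat.cast : ℕ → ZMod p) this
      push_cast [Nat.cast_sub (show k ≤ n by omega)] at h3
      exact h3
    have hk1 : ((k:ZMod p)+1) ≠ 0 := by
      have : ((k+1:ℕ):ZMod p) ≠ 0 := by
        rw [Ne, ZMod.natCast_eq_zero_iff]
        intro hd
        have := Nat.le_of_dvd (by omega) hd
        omega
      exact_mod_cast this
    apply mul_left_cancel₀ hk1
    rw [h1, ih, pow_succ]
    have := n_rel n hn
    linear_combination 4 * (-4)^k * h2 + 2*(-4)^k*(n.choose k : ZMod p) * this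

lemma LL_n (n : ℕ) (hn : p = 2*n+1) : LL (ZMod p) n = (-8)^n := by
  have : ∀ N, N ≤ n → LL (ZMod p) N = (-4)^N * ∑ k ∈ Finset.range (N+1), (n.choose k : ZMod p) := by
    intro N
    induction N with
    | zero => intro _; simp [LL]
    | succ N ih =>
      intro h
      rw [LL, ih (by omega), central_modp n hn _ h, Finset.sum_range_succ _ (N+1)]
      ring
  rw [this n le_rfl]
  have h2 := Nat.sum_range_choose n
  have := congrArg (Nat.cast : ℕ → ZMod p) h2
  push_cast at this
  rw [this, ← mul_pow]; norm_num

lemma LL_sq (n : ℕ) (hn : p = 2*n+1) : LL (ZMod p) n ^ 2 = 1 := by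
  rw [LL_n n hn, ← pow_mul, mul_comm, pow_mul]
  have h8 : (8:ZMod p) ≠ 0 := by
    have := two_ne n hn
    rw [show (8:ZMod p) = 2^3 by norm_num]; exact pow_ne_zero _ this
  rw [neg_sq, ← pow_mul]
  have := ZMod.pow_card_sub_one_eq_one h8
  rwa [show p - 1 = 2*n by omega] at this

lemma mX1_ne : (1 + -X : (ZMod p)[X]) ≠ 0 := by
  intro h
  have := congrArg (fun q => coeff q 1) h
  simp [coeff_one] at this

/-- shifted relation -/
lemma W_rel2 (n : ℕ) (hn : p = 2*n+1) : taylor 2 (PP (gW (X^2)) (X^2 : (ZMod p)[X]) n) =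
    -(2*X+1)*(2*X+3) * PP (g0 _) (X^2) n := by
  have h := W_rel n hn (-X) mX1_ne
  rw [neg_sq] at h
  have h1 := congrArg (taylor (2:ZMod p)) h
  rw [h1]
  rw [taylor_mul, tay_PP0]
  have e : taylor (2:ZMod p) ((-X+2)^2) = X^2 := by
    rw [taylor_pow, map_add, map_neg, taylor_X]
    have : taylor (2:ZMod p) 2 = 2 := by
      have := taylor_C (2:ZMod p) (2:ZMod p)
      rwa [map_ofNat C 2] at this
    rw [this, map_ofNat C 2]; ring
  rw [e]
  congr 1
  have t2 : ∀ k : ZMod p, taylor (2:ZMod p) (C k) = C k := taylor_C 2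
  have e3 : (-(2 * -X + 1) * (2 * -X + 3) : (ZMod p)[X]) = C 8 * X - C 4 * X^2 - C 3 := by
    simp only [map_ofNat C]; ring
  rw [e3]
  simp only [map_sub, taylor_mul, t2, taylor_X, taylor_X_pow]
  simp only [map_ofNat C]
  ring

lemma PW_coeff (n : ℕ) (hn : p = 2*n+1) (hW0 : (PP (g0 (ZMod p)[X]) X n * PP (gW X) X n).coeff 0 = 0) :
    (PP (g0 (ZMod p)[X]) X n * PP (gW X) X n).coeff 1 = -4 := by
  have hW := W_rel n hn X X1_ne
  have hW2 := W_rel2 n hn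
  have hper : taylor 2 (PP (g0 (ZMod p)[X]) (X^2) n * PP (gW (X^2)) (X^2) n) =
      (PP (g0 (ZMod p)[X]) (X^2) n * PP (gW (X^2)) (X^2) n) := by
    rw [taylor_mul, hW2, hW, tay_PP0, tay_sq, map_ofNat C 2]; ring
  rw [← exp_PP0, ← exp_PPW, ← map_mul] at hper
  have hd0 : (PP (g0 (ZMod p)[X]) X n).natDegree ≤ n := by rw [PP0_C]; exact PP_deg _ n
  have hdW := PPW_deg (R := ZMod p) n
  have hdeg : (PP (g0 (ZMod p)[X]) X n * PP (gW X) X n).natDegree ≤ p := by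
    apply natDegree_mul_le.trans; omega
  have hco : (PP (g0 (ZMod p)[X]) X n * PP (gW X) X n).coeff p = -4 := by
    have e : (PP (g0 (ZMod p)[X]) X n * PP (gW X) X n).coeff p = (PP (g0 (ZMod p)[X]) X n * PP (gW X) X n).coeff (n + (n+1)) :=
      congrArg (fun m => (PP (g0 (ZMod p)[X]) X n * PP (gW X) X n).coeff m) (by omega)
    rw [e]
    rw [coeff_mul_add_eq_of_natDegree_le hd0 hdW.1, PP0_coeff, hdW.2]
    linear_combination -4 * LL_sq n hn
  set Q := PP (g0 (ZMod p)[X]) X n * PP (gW X) X n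
  have pp := hp.out.pos
  have hp2 : 2 ≤ p := hp.out.two_le
  have hLL : taylor 2 (Lam p ^2) = Lam p ^2 := by rw [taylor_pow, Lam_per]
  set E := expand (ZMod p) 2 Q + C 4 * Lam p ^2 with hE
  have hEper : taylor 2 E = E := by
    rw [hE, map_add, hper, taylor_mul, taylor_C, hLL]
  have hL2 : (Lam p ^2).natDegree = 2*p := by
    rw [(Lam_monic (p := p)).natDegree_pow, Lam_natDegree]
  have hEdeg : E.natDegree ≤ 2*p := by
    apply natDegree_add_le_of_degree_le
    · rw [natDegree_expand]; omega
    · exact (natDegree_C_mul_le _ _).trans hL2.le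
  have hEc : E.coeff (2*p) = 0 := by
    have h1 := (Lam_monic (p := p)).pow 2
    rw [Monic, leadingCoeff, hL2] at h1
    rw [hE, coeff_add, coeff_C_mul, h1, mul_comm 2 p, coeff_expand_mul (by norm_num), hco]; ring
  have hElt := nd_lt E (2*p) (by omega) hEdeg hEc
  have hE0 : E.eval 0 = 0 := by
    rw [hE, eval_add, eval_mul, eval_pow, Lam_eval, ← coeff_zero_eq_eval_zero]
    rw [show (0:ℕ) = 0 * 2 by norm_num, coeff_expand_mul (by norm_num), hW0]; simp
  have hall : ∀ x, E.eval x = 0 := by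
    apply eval_all 2 (two_ne n hn) (fun x => eval x E = 0) hE0
    intro x hx
    have := congrArg (fun q => eval x q) hEper
    simp only [taylor_eval] at this
    rw [this, hx]
  obtain ⟨E1, hE1⟩ := Lam_dvd E hall
  have hL0 : Lam p ≠ 0 := (Lam_monic (p := p)).ne_zero
  have hE1per : taylor 2 E1 = E1 := by
    rw [hE1, taylor_mul, Lam_per] at hEper
    exact mul_left_cancel₀ hL0 hEper
  have hE1deg : E1.natDegree < p := by
    by_cases h0 : E1 = 0
    · rw [h0]; simpa using pp
    · rw [hE1, natDegree_mul hL0 h0, Lam_natDegree] at hElt; omega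
  have hE1c := per_const 2 (two_ne n hn) E1 hE1deg hE1per
  have c1 := congrArg (fun q => coeff q 1) hE1
  have c2 := congrArg (fun q => coeff q 2) hE1
  have hpo : p ≠ 2 := by omega
  rw [hE1c] at c1 c2
  have L1 : (Lam p).coeff 1 = -1 := by
    simp [Lam, coeff_X_pow, coeff_X]; omega
  have L2 : (Lam p).coeff 2 = 0 := by
    simp [Lam, coeff_X_pow, coeff_X]; omega
  have Ls : Lam p ^2 = X^(2*p) - 2*X^(p+1) + X^2 := by unfold Lam; ring
  have Ls' : Lam p ^2 = X^(2*p) - C 2*X^(p+1) + X^2 := by rw [Ls, map_ofNat C 2]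
  have Ls1 : (Lam p ^2).coeff 1 = 0 := by
    rw [Ls']; simp [coeff_X_pow, show ¬ (1 = 2*p) by omega]; omega
  have Ls2 : (Lam p ^2).coeff 2 = 1 := by
    rw [Ls']; simp [coeff_X_pow, show ¬ (2 = 2*p) by omega]; omega
  have x1 : (expand (ZMod p) 2 Q).coeff 1 = 0 := by
    rw [coeff_expand (by norm_num)]; simp
  have x2 : (expand (ZMod p) 2 Q).coeff 2 = Q.coeff 1 := by
    rw [show 2 = 1 * 2 by norm_num, coeff_expand_mul (by norm_num)]
  simp only [hE, coeff_add, coeff_C_mul, coeff_mul_C, L1, L2, Ls1, Ls2, x1, x2] at c1 c2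
  linear_combination c2

noncomputable def GG (R : Type*) [CommRing R] (n : ℕ) : R[X] :=
  ∏ i ∈ Finset.range n, (C ((8*(i:R)+7)^2) - C 4 * X)

lemma prodA (N : ℕ) : (∏ i ∈ Finset.range N, (8*(i:(ZMod p)[X])-1 - 2*X)) * (8*(N:(ZMod p)[X])-1-2*X) =
    (∏ i ∈ Finset.range N, (8*(i:(ZMod p)[X])+7 - 2*X)) * (-1-2*X) := by
  induction N with
  | zero => simp
  | succ N ih =>
    rw [Finset.prod_range_succ, Finset.prod_range_succ]
    push_cast
    linear_combination (8*N+7-2*X) * ih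
lemma prodB (N : ℕ) : (∏ i ∈ Finset.range N, (8*(i:(ZMod p)[X])+15 + 2*X)) * (7+2*X) =
    (∏ i ∈ Finset.range N, (8*(i:(ZMod p)[X])+7 + 2*X)) * (8*(N:(ZMod p)[X])+7+2*X) := by
  induction N with
  | zero => simp
  | succ N ih =>
    rw [Finset.prod_range_succ, Finset.prod_range_succ]
    push_cast
    linear_combination (8*N+15+2*X) * ih

lemma P_GG (n : ℕ) (hn : p = 2*n+1) : ∃ c, PP (g0 (ZMod p)[X]) X n = C c * GG (ZMod p) n := by
  have h2 := n_relX n hn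
  have h20 := two_ne n hn
  have h40 : (4:ZMod p) ≠ 0 := by
    rw [show (4:ZMod p) = 2*2 by norm_num]; exact mul_ne_zero h20 h20
  have hC2 : (C (2:ZMod p)) = 2 := map_ofNat C 2
  have hC4 : (C (4:ZMod p)) = 4 := map_ofNat C 4
  have hG : expand (ZMod p) 2 (GG (ZMod p) n) = (∏ i ∈ Finset.range n, (8*(i:(ZMod p)[X])+7 - 2*X))
      * (∏ i ∈ Finset.range n, (8*(i:(ZMod p)[X])+7 + 2*X)) := by
    rw [GG, map_prod, ← Finset.prod_mul_distrib]
    apply Finset.prod_congr rfl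
    intro i _
    rw [map_sub, map_mul, expand_C, expand_C, expand_X]
    simp only [C_pow, C_add, C_mul, map_natCast, map_ofNat C]
    ring
  have hGt : taylor 4 (expand (ZMod p) 2 (GG (ZMod p) n)) = (∏ i ∈ Finset.range n, (8*(i:(ZMod p)[X])-1 - 2*X))
      * (∏ i ∈ Finset.range n, (8*(i:(ZMod p)[X])+15 + 2*X)) := by
    rw [hG, taylor_mul]
    have t4 : ∀ k : ZMod p, taylor (4:ZMod p) (C k) = C k := taylor_C 4
    have hh : ∀ q : (ZMod p)[X], taylor (4:ZMod p) q = taylorAlgHom 4 q := fun q => by simp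
    congr 1
    · rw [hh, map_prod]
      apply Finset.prod_congr rfl
      intro i _
      simp only [coe_taylorAlgHom, map_sub, map_add, map_mul, taylor_X, map_ofNat, map_natCast, hC4]
      rw [taylorAlgHom_apply, taylor_X, hC4]
      ring
    · rw [hh, map_prod]
      apply Finset.prod_congr rfl
      intro i _
      simp only [coe_taylorAlgHom, map_sub, map_add, map_mul, taylor_X, map_ofNat, map_natCast, hC4]
      rw [taylorAlgHom_apply, taylor_X, hC4]
      ring
  have hA := prodA (p := p) n
  have hB := prodB (p := p) n
  have hGrec : taylor 4 (expand (ZMod p) 2 (GG (ZMod p) n)) * ((2*X+5)*(2*X+7)) =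
      expand (ZMod p) 2 (GG (ZMod p) n) * ((2*X+1)*(2*X+3)) := by
    rw [hGt, hG]
    generalize (∏ i ∈ Finset.range n, (8*(i:(ZMod p)[X])-1 - 2*X)) = a at *
    generalize (∏ i ∈ Finset.range n, (8*(i:(ZMod p)[X])+15 + 2*X)) = b at *
    generalize (∏ i ∈ Finset.range n, (8*(i:(ZMod p)[X])+7 + 2*X)) = c at *
    generalize (∏ i ∈ Finset.range n, (8*(i:(ZMod p)[X])+7 - 2*X)) = d at *
    have hA' : a * (2*X+5) = d * (2*X+1) := by linear_combination -hA + 4*a*h2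
    have hB' : b * (7+2*X) = c * (2*X+3) := by linear_combination hB + 4*c*h2
    linear_combination b*(2*X+7) * hA' + d*(2*X+1)*hB'
  have hW := congrArg (taylor (2:ZMod p)) (W_rel n hn X X1_ne)
  rw [W_rel2 n hn, taylor_mul, tay_PP0] at hW
  have hPrec : taylor 4 (PP (g0 (ZMod p)[X]) (X^2) n) * ((2*X+5)*(2*X+7)) =
      (PP (g0 (ZMod p)[X]) (X^2) n) * ((2*X+1)*(2*X+3)) := by
    have e1 : taylor (2:ZMod p) ((X+2)^2) = (X+4)^2 := by
      rw [taylor_pow, map_add, taylor_X, ← hC2, taylor_C, hC2]; ring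
    have e2 : taylor (2:ZMod p) (-(2*X+1)*(2*X+3)) = -(2*X+5)*(2*X+7) := by
      have t2 : ∀ k : ZMod p, taylor (2:ZMod p) (C k) = C k := taylor_C 2
      have e3 : (-(2 * X + 1) * (2 * X + 3) : (ZMod p)[X]) = - C 8 * X - C 4 * X^2 - C 3 := by
        simp only [map_ofNat C]; ring
      rw [e3]
      rw [show - C (8:ZMod p) = C (-8) by simp]
      simp only [map_sub, taylor_mul, t2, taylor_X, taylor_X_pow]
      simp only [map_ofNat C, C_neg]
      ring
    rw [e1, e2] at hW
    rw [tay_PP0, tay_sq, hC4]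
    linear_combination hW
  rw [← exp_PP0] at hPrec
  have hGG0 : GG (ZMod p) n ≠ 0 := by
    unfold GG
    refine Finset.prod_ne_zero_iff.2 ?_
    intro i _ h
    have := congrArg (fun q => coeff q 1) h
    simp only [coeff_sub, coeff_C_mul, coeff_X_one, coeff_zero, coeff_C] at this
    norm_num at this
    exact h40 this
  have hd0 : (PP (g0 (ZMod p)[X]) X n).natDegree ≤ n := by rw [PP0_C]; exact PP_deg _ n
  have hdG : (GG (ZMod p) n).natDegree ≤ n := by
    unfold GG
    apply (natDegree_prod_le _ _).trans
    apply (Finset.sum_le_card_nsmul _ _ 1 _).trans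
    · simp
    · intro i _
      apply (natDegree_sub_le _ _).trans
      simp only [natDegree_C]
      exact max_le (by omega) ((natDegree_C_mul_le _ _).trans natDegree_X_le)
  have hl : ((2*X+1)*(2*X+3) : (ZMod p)[X]) ≠ 0 := by
    intro h
    have := congrArg (fun q => coeff q 2) h
    have e3 : ((2 * X + 1) * (2 * X + 3) : (ZMod p)[X]) = C 8 * X + C 4 * X^2 + C 3 := by
        simp only [map_ofNat C]; ring
    simp only [e3] at this
    simp [coeff_X, coeff_C, coeff_X_pow] at this
    exact h40 this
  have hl2 : ((2*X+5)*(2*X+7) : (ZMod p)[X]) ≠ 0 := by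
    intro h
    have := congrArg (fun q => coeff q 2) h
    have e3 : ((2 * X + 5) * (2 * X + 7) : (ZMod p)[X]) = C 24 * X + C 4 * X^2 + C 35 := by
        simp only [map_ofNat C]; ring
    simp only [e3] at this
    simp [coeff_X, coeff_C, coeff_X_pow] at this
    exact h40 this
  obtain ⟨c, hc⟩ := cross 4 h40 (expand (ZMod p) 2 (PP (g0 (ZMod p)[X]) X n)) (expand (ZMod p) 2 (GG (ZMod p) n))
    (by rw [natDegree_expand]; omega) (by rw [natDegree_expand]; omega)
    (by rwa [Ne, expand_eq_zero (by norm_num)])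
    (by
      apply mul_left_cancel₀ (mul_ne_zero hl hl2)
      linear_combination expand (ZMod p) 2 (GG (ZMod p) n) * ((2*X+1)*(2*X+3)) * hPrec - expand (ZMod p) 2 (PP (g0 (ZMod p)[X]) X n) * ((2*X+1)*(2*X+3)) * hGrec)
  refine ⟨c, ?_⟩
  apply expand_injective (R := ZMod p) (n := 2) (by norm_num)
  rw [hc, map_mul, expand_C]
end modp
end S5

namespace S5
open Polynomial

abbrev ZZ (p : ℕ) := ZMod (p^3)

section Zring
variable {p : ℕ} [hp : Fact p.Prime]

def pi (p : ℕ) : ZZ p →+* ZMod p := ZMod.castHom (dvd_pow_self p (by norm_num)) (ZMod p)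

lemma p_cube : (p : ZZ p)^3 = 0 := by
  have := ZMod.natCast_self (p^3)
  exact_mod_cast this

lemma pi_ker (a : ZZ p) (h : pi p a = 0) : ∃ b, a = p * b := by
  haveI : NeZero (p^3) := ⟨pow_ne_zero _ hp.out.ne_zero⟩
  obtain ⟨m, rfl⟩ := ZMod.natCast_zmod_surjective a
  rw [map_natCast, ZMod.natCast_eq_zero_iff] at h
  obtain ⟨c, rfl⟩ := h
  exact ⟨c, by push_cast; ring⟩

lemma pi_eq (a b : ZZ p) (h : pi p a = pi p b) : ∃ c, a = b + p * c := by
  obtain ⟨c, hc⟩ := pi_ker (a - b) (by rw [map_sub, h, sub_self])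
  exact ⟨c, by rw [← hc]; ring⟩

lemma p2_eq (a b : ZZ p) (h : pi p a = pi p b) : (p:ZZ p)^2 * a = p^2 * b := by
  obtain ⟨c, rfl⟩ := pi_eq a b h
  linear_combination c * p_cube (p := p)

lemma pi_p : pi p (p : ZZ p) = 0 := by rw [map_natCast, ZMod.natCast_self]

lemma unit_of (a : ZZ p) (h : pi p a ≠ 0) : IsUnit a := by
  haveI : NeZero (p^3) := ⟨pow_ne_zero _ hp.out.ne_zero⟩
  obtain ⟨m, rfl⟩ := ZMod.natCast_zmod_surjective a
  rw [map_natCast, Ne, ZMod.natCast_eq_zero_iff] at h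
  rw [ZMod.isUnit_iff_coprime]
  exact Nat.Coprime.pow_right 3 ((hp.out.coprime_iff_not_dvd.2 h).symm)

lemma uinv (a : ZZ p) (h : pi p a ≠ 0) : a * a⁻¹ = 1 := ZMod.mul_inv_of_unit _ (unit_of a h)

lemma pi_inv (a : ZZ p) (h : pi p a ≠ 0) : pi p a⁻¹ = (pi p a)⁻¹ := by
  have := congrArg (pi p) (uinv a h)
  rw [map_mul, map_one] at this
  exact eq_inv_of_mul_eq_one_right this

lemma unit_ne (a : ZZ p) (h : IsUnit a) : pi p a ≠ 0 := (h.map (pi p)).ne_zero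

lemma ev_poly (f : ℤ[X]) : eval₂ (Int.castRingHom (ZZ p)) ((p:ZZ p)^2) f = f.coeff 0 + p^2 * f.coeff 1 := by
  have h1 := divX_mul_X_add f
  have h2 := divX_mul_X_add f.divX
  rw [← h1, ← h2]
  simp only [eval₂_add, eval₂_mul, eval₂_X, eval₂_C]
  simp only [coeff_add, coeff_C_zero, coeff_mul_X_zero, mul_coeff_zero, coeff_X_zero, coeff_mul_X, coeff_C_succ, coeff_divX]
  simp [coeff_C]
  linear_combination (eval₂ (Int.castRingHom (ZZ p)) ((p:ZZ p)^2) f.divX.divX) * (p:ZZ p) * p_cube (p := p)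

lemma ev_zero (f : ℤ[X]) : eval₂ (Int.castRingHom (ZZ p)) 0 f = f.coeff 0 := by
  simp [eval₂_at_zero]
end Zring

section Evals
variable {S : Type*} [CommRing S]
lemma ev_PP0 (n : ℕ) (y : S) : eval₂ (Int.castRingHom S) y (PP (g0 ℤ[X]) X n) = PP (g0 S) y n := by
  have := map_PP0 (eval₂RingHom (Int.castRingHom S) y) X n
  simpa using this
lemma ev_PP1 (n : ℕ) (y : S) : eval₂ (Int.castRingHom S) y (PP (g1 ℤ[X]) X n) = PP (g1 S) y n := by
  have := map_PP1 (eval₂RingHom (Int.castRingHom S) y) X n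
  simpa using this
lemma ev_PPW (n : ℕ) (y : S) : eval₂ (Int.castRingHom S) y (PP (gW (X:ℤ[X])) X n) = PP (gW y) y n := by
  have := map_PPW (eval₂RingHom (Int.castRingHom S) y) X n
  simpa using this
lemma ev_Nr (n : ℕ) (y : S) : eval₂ (Int.castRingHom S) y (Nr (X : ℤ[X]) n) = Nr y n := by
  have := map_Nr (eval₂RingHom (Int.castRingHom S) y) X n
  simpa using this
lemma mp_PP0 (n : ℕ)  : (PP (g0 ℤ[X]) X n).map (Int.castRingHom S) = PP (g0 S[X]) X n := by
  have := map_PP0 (mapRingHom (Int.castRingHom S)) X n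
  simpa using this
lemma mp_PP1 (n : ℕ)  : (PP (g1 ℤ[X]) X n).map (Int.castRingHom S) = PP (g1 S[X]) X n := by
  have := map_PP1 (mapRingHom (Int.castRingHom S)) X n
  simpa using this
lemma mp_PPW (n : ℕ)  : (PP (gW (X:ℤ[X])) X n).map (Int.castRingHom S) = PP (gW (X : S[X])) X n := by
  have := map_PPW (mapRingHom (Int.castRingHom S)) X n
  simpa using this
lemma mp_Nr (n : ℕ)  : (Nr (X:ℤ[X]) n).map (Int.castRingHom S) = Nr (X : S[X]) n := by
  have := map_Nr (mapRingHom (Int.castRingHom S)) X n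
  simpa using this
end Evals

section Der
variable {p : ℕ} [hp : Fact p.Prime]

lemma p_val (n : ℕ) (hn : p = 2*n+1) : (2*(n:ZZ p)+1) = p := by
  have h := congrArg (Nat.cast : ℕ → ZZ p) hn
  push_cast at h
  exact h.symm

lemma Nr_pp (n : ℕ) (hn : p = 2*n+1) (h3 : 3 < p) : Nr ((p:ZZ p)^2) n = Nr 0 n := by
  have h1 := ev_poly (p := p) (Nr X n)
  have h2 := ev_zero (p := p) (Nr X n)
  rw [ev_Nr] at h1 h2
  have h4 := Nr_coeff n hn h3
  rw [← mp_Nr, coeff_map] at h4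
  rw [h1, h2]
  have := p2_eq (p := p) ((Nr (X:ℤ[X]) n).coeff 1 : ZZ p) 0 (by simpa using h4)
  rw [this]; ring

lemma P1_pp (n : ℕ) (hn : p = 2*n+1) : PP (g1 (ZZ p)) ((p:ZZ p)^2) n = PP (g1 (ZZ p)) 0 n := by
  have h1 := ev_poly (p := p) (PP (g1 ℤ[X]) X n)
  have h2 := ev_zero (p := p) (PP (g1 ℤ[X]) X n)
  rw [ev_PP1] at h1 h2
  have h4 := congrArg (fun q => coeff q 1) (P1_zero n hn)
  simp only [coeff_zero] at h4
  rw [← mp_PP1, coeff_map] at h4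
  rw [h1, h2]
  have := p2_eq (p := p) ((PP (g1 ℤ[X]) X n).coeff 1 : ZZ p) 0 (by simpa using h4)
  rw [this]; ring

lemma P1_val (n : ℕ) (hn : p = 2*n+1) (h3 : 3 < p) : PP (g1 (ZZ p)) 0 n = Nr 0 n * ((-1)^n * p) := by
  have := T1_eq (ZZ p) n
  rw [p_val n hn, P1_pp n hn, Nr_pp n hn h3] at this
  exact this

lemma Nr_zero (R : Type*) [CommRing R] (n : ℕ) : Nr (0:R) n = 16^n * (n.factorial : R)^2 := by
  induction n with
  | zero => simp [Nr]
  | succ n ih =>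
    rw [Nr] at ih ⊢
    rw [Finset.prod_range_succ, Nat.factorial_succ]
    push_cast
    rw [pow_succ (4:R), pow_succ (16:R)]
    linear_combination 16*((n:R)+1)^2*ih

lemma fac_sq (n : ℕ) (hn : p = 2*n+1) : ((n.factorial : ZMod p))^4 = 1 := by
  have hw := ZMod.wilsons_lemma p
  have key : ∀ k, k ≤ n → ((p-1).factorial : ZMod p) = (-1)^k * k.factorial * (p-1-k).factorial := by
    intro k
    induction k with
    | zero => intro _; simp
    | succ k ih =>
      intro hk
      rw [ih (by omega)]
      have e : p - 1 - k = (p-1-(k+1)) + 1 := by omega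
      rw [e, Nat.factorial_succ, ← e, Nat.factorial_succ]
      have e2 : ((p-1-k : ℕ) : ZMod p) = -(k+1) := by
        have : ((p-1-k : ℕ) : ZMod p) + ((k+1:ℕ):ZMod p) = 0 := by
          rw [← Nat.cast_add, show p-1-k+(k+1) = p by omega, ZMod.natCast_self]
        push_cast at this
        linear_combination this
      push_cast
      rw [e2]; ring
  have := key n le_rfl
  rw [hw, show p - 1 - n = n by omega] at this
  have h2 : ((-1:ZMod p)^n)^2 = 1 := by rw [← pow_mul, mul_comm, pow_mul]; simp
  linear_combination (1 - (-1)^n * (n.factorial : ZMod p)^2) * this + (-(n.factorial : ZMod p)^4) * h2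

lemma pow_even_one (n : ℕ) (hn : p = 2*n+1) (a : ZMod p) (ha : a ≠ 0) : a^(2*n) = 1 := by
  rw [show 2*n = p-1 by omega]; exact ZMod.pow_card_sub_one_eq_one ha

lemma Nr_sq (n : ℕ) (hn : p = 2*n+1) : (p:ZZ p)^2 * (Nr 0 n)^2 = p^2 := by
  have := p2_eq (p := p) ((Nr 0 n)^2) 1 ?_
  · rw [this, mul_one]
  rw [Nr_zero, map_pow, map_mul, map_pow, map_pow, map_natCast, map_one, map_ofNat]
  rw [mul_pow, ← pow_mul, ← pow_mul, fac_sq n hn, mul_one, mul_comm n 2]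
  apply pow_even_one n hn
  rw [show (16:ZMod p) = 2^4 by norm_num]
  exact pow_ne_zero _ (two_ne n hn)

lemma Nr_unit (n : ℕ) (hn : p = 2*n+1) : pi p (Nr 0 n) ≠ 0 := by
  rw [Nr_zero, map_mul, map_pow, map_pow, map_natCast, map_ofNat]
  have h1 : ((n.factorial : ZMod p)) ≠ 0 := by
    intro h; have := fac_sq n hn; rw [h] at this; simp at this
  have h2 : (16:ZMod p) ≠ 0 := by
    rw [show (16:ZMod p) = 2^4 by norm_num]
    exact pow_ne_zero _ (two_ne n hn)
  exact mul_ne_zero (pow_ne_zero _ h2) (pow_ne_zero _ h1)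

lemma PW_val (n : ℕ) (hn : p = 2*n+1) (h3 : 3 < p) :
    PP (g0 (ZZ p)) 0 n * PP (gW (0:ZZ p)) 0 n = 3 * p^2 := by
  have h1 := ev_poly (p := p) (PP (g0 ℤ[X]) X n * PP (gW X) X n)
  have h2 := ev_zero (p := p) (PP (g0 ℤ[X]) X n * PP (gW X) X n)
  rw [eval₂_mul, ev_PP0, ev_PPW] at h1 h2
  have h4 := TFW (ZZ p) n (by omega)
  rw [p_val n hn, h1, Nr_pp n hn h3] at h4
  have hm : (PP (g0 ℤ[X]) X n * PP (gW X) X n).map (Int.castRingHom (ZMod p)) = PP (g0 (ZMod p)[X]) X n * PP (gW X) X n := by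
    rw [Polynomial.map_mul, mp_PP0, mp_PPW]
  have h5 := PW_coeff n hn ?_
  · rw [← hm, coeff_map] at h5
    have h6 := p2_eq (p := p) ((PP (g0 ℤ[X]) X n * PP (gW X) X n).coeff 1 : ZZ p) (-4) (by rw [map_neg, map_ofNat, map_intCast]; exact h5)
    rw [h2]
    linear_combination h4 - h6 - Nr_sq n hn
  · rw [← hm, coeff_map]
    have := congrArg (pi p) h4
    simpa [pi_p] using this

lemma coeff_GG {F : Type*} [Field F] (n : ℕ) (h : ∀ i < n, (8*(i:F)+7) ≠ 0) :
    (GG F n).coeff 1 = -4 * (GG F n).coeff 0 * ∑ i ∈ Finset.range n, ((8*(i:F)+7)⁻¹)^2 := by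
  induction n with
  | zero => simp [GG, coeff_one]
  | succ n ih =>
    have ih := ih (fun i hi => h i (by omega))
    have e : GG F (n+1) = GG F n * (C ((8*(n:F)+7)^2) - C 4 * X) := by
      rw [GG, Finset.prod_range_succ]; rfl
    rw [e, Finset.sum_range_succ, mul_coeff_zero, mul_sub, coeff_sub, coeff_mul_C, ← mul_assoc, coeff_mul_X, coeff_mul_C, ih]
    have h0 : (C ((8*(n:F)+7)^2) - C 4 * X).coeff 0 = (8*(n:F)+7)^2 := by simp only [coeff_sub, coeff_C_zero, mul_coeff_zero, coeff_X_zero]; ring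
    rw [h0]
    have := h n (by omega)
    field_simp
    ring

lemma P0_val (n : ℕ) (hn : p = 2*n+1) (h : ∀ i < n, (8*(i:ZMod p)+7) ≠ 0) :
    PP (g0 (ZZ p)) ((p:ZZ p)^2) n = PP (g0 (ZZ p)) 0 n * (1 - 4 * p^2 * ∑ i ∈ Finset.range n, ((8*(i:ZZ p)+7)⁻¹)^2) := by
  have h1 := ev_poly (p := p) (PP (g0 ℤ[X]) X n)
  have h2 := ev_zero (p := p) (PP (g0 ℤ[X]) X n)
  rw [ev_PP0] at h1 h2
  obtain ⟨c, hc⟩ := P_GG n hn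
  have h5 : (PP (g0 (ZMod p)[X]) X n).coeff 1 = -4 * (PP (g0 (ZMod p)[X]) X n).coeff 0 * ∑ i ∈ Finset.range n, ((8*(i:ZMod p)+7)⁻¹)^2 := by
    rw [hc, coeff_C_mul, coeff_C_mul, coeff_GG n h]; ring
  rw [← mp_PP0, coeff_map, coeff_map] at h5
  have h6 := p2_eq (p := p) ((PP (g0 ℤ[X]) X n).coeff 1 : ZZ p) (-4 * (PP (g0 ℤ[X]) X n).coeff 0 *
      ∑ i ∈ Finset.range n, ((8*(i:ZZ p)+7)⁻¹)^2) ?_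
  · rw [h1, h6, h2]; ring
  · rw [map_intCast, map_mul, map_mul, map_neg, map_ofNat, map_intCast, map_sum]
    have : ∀ i ∈ Finset.range n, pi p (((8*(i:ZZ p)+7)⁻¹)^2) = ((8*(i:ZMod p)+7)⁻¹)^2 := by
      intro i hi
      have e : pi p (8*(i:ZZ p)+7) = 8*(i:ZMod p)+7 := by rw [map_add, map_mul, map_ofNat, map_ofNat, map_natCast]
      rw [map_pow, pi_inv, e]
      rw [e]; exact h i (Finset.mem_range.1 hi)
    rw [Finset.sum_congr rfl this]
    simpa using h5

lemma p_PP (n : ℕ)  : (p:ZZ p) * PP (g0 (ZZ p)) ((p:ZZ p)^2) n = p * PP (g0 (ZZ p)) 0 n ∧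
    (p:ZZ p) * PP (gW ((p:ZZ p)^2)) ((p:ZZ p)^2) n = p * PP (gW (0:ZZ p)) 0 n := by
  constructor
  · have h1 := ev_poly (p := p) (PP (g0 ℤ[X]) X n)
    have h2 := ev_zero (p := p) (PP (g0 ℤ[X]) X n)
    rw [ev_PP0] at h1 h2
    rw [h1, h2]; linear_combination ((PP (g0 ℤ[X]) X n).coeff 1 : ZZ p) * p_cube (p := p)
  · have h1 := ev_poly (p := p) (PP (gW (X:ℤ[X])) X n)
    have h2 := ev_zero (p := p) (PP (gW (X:ℤ[X])) X n)
    rw [ev_PPW] at h1 h2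
    rw [h1, h2]; linear_combination ((PP (gW (X:ℤ[X])) X n).coeff 1 : ZZ p) * p_cube (p := p)

end Der

section Sums
variable {R : Type*} [CommRing R]

lemma cc0 (k : ℕ) : cc (0:R) k * (-4)^k = ((2*k).choose k : R)^3 * (k.factorial : R)^2 := by
  have h : ∀ k : ℕ, (∏ j ∈ Finset.range k, (2*(j:R)+1)) * 2^k = ((2*k).choose k : R) * k.factorial := by
    intro k
    induction k with
    | zero => simp
    | succ k ih =>
      have := cb (R := R) k
      rw [Finset.prod_range_succ, Nat.factorial_succ, pow_succ]
      push_cast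
      linear_combination 2*(2*(k:R)+1)*ih - (k.factorial : R) * this
  have h1 := h k
  rw [cc]
  simp only [sub_zero]
  rw [Finset.prod_pow, show (-4:R) = (-1)*2^2 by norm_num, mul_pow, ← pow_mul]
  rw [mul_comm 2 k, pow_mul, mul_comm k 2] at *
  have h2 : ((-1:R)^k)^2 = 1 := by rw [← pow_mul, mul_comm, pow_mul]; simp
  generalize (∏ j ∈ Finset.range k, (2*(j:R)+1)) = Q at *
  generalize ((2*k).choose k : R) = u at *
  generalize ((-1:R)^k) = e at *
  generalize ((2:R)^k) = v at *
  linear_combination u * Q^2 * v^2 * h2 + u * (Q*v+u*k.factorial) * h1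

lemma PP_sum (g : ℕ → R) (w : R) (hw : w * (-64) = 1) (N : ℕ) :
    PP g 0 N = Nr 0 N * ∑ k ∈ Finset.range (N+1), g k * (((2*k).choose k : R)^3 * w^k) := by
  induction N with
  | zero => simp [PP, Nr]
  | succ N ih =>
    rw [PP, ih, Finset.sum_range_succ _ (N+1), mul_add]
    have h1 : Nr (0:R) (N+1) = 4*(4*((N:R)+1)^2 - 0) * Nr 0 N := by
      rw [Nr, Nr, Finset.prod_range_succ]; ring
    have h2 := cc0 (R := R) (N+1)
    rw [h1]
    have h3 : cc (0:R) (N+1) = Nr 0 (N+1) * (((2*(N+1)).choose (N+1) : R)^3 * w^(N+1)) := by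
      rw [Nr_zero]
      have h4 : (w*16)^(N+1) * (-4)^(N+1) = 1 := by
        rw [← mul_pow, show w * 16 * (-4) = 1 by linear_combination hw, one_pow]
      rw [mul_pow] at h4
      generalize (-4:R)^(N+1) = x at *
      linear_combination -cc (0:R) (N+1) * h4 + w^(N+1) * 16^(N+1) * h2
    rw [h3, h1]; ring
end Sums

section SumsZ
variable {p : ℕ} [hp : Fact p.Prime]

def ww (p : ℕ) : ZZ p := (-64 : ZZ p)⁻¹

lemma ww_eq (h2 : p ≠ 2) : ww p * (-64) = 1 := by
  rw [mul_comm]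
  apply uinv
  rw [map_neg, map_ofNat, show (64:ZMod p) = 2^6 by norm_num]
  obtain ⟨n, hn⟩ := hp.out.eq_two_or_odd'.resolve_left h2
  exact neg_ne_zero.2 (pow_ne_zero _ (two_ne n hn))

def SS (p : ℕ) (j : ℕ) : ZZ p := ∑ k ∈ Finset.range p, (k:ZZ p)^j * (((2*k).choose k : ZZ p)^3 * ww p^k)

lemma choose_van (n : ℕ) (hn : p = 2*n+1) (k : ℕ) (hk : n < k) (hk2 : k < p) : ((2*k).choose k : ZZ p)^3 = 0 := by
  have : p ∣ (2*k).choose k := by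
    apply hp.out.dvd_choose hk2 (by omega) (by omega)
  obtain ⟨c, hc⟩ := this
  rw [hc]; push_cast
  rw [mul_pow, p_cube, zero_mul]

lemma SS_eq (n : ℕ) (hn : p = 2*n+1) (j : ℕ) : SS p j = ∑ k ∈ Finset.range (n+1), (k:ZZ p)^j * (((2*k).choose k : ZZ p)^3 * ww p^k) := by
  rw [SS]
  symm
  apply Finset.sum_subset
  · intro k; simp only [Finset.mem_range]; omega
  · intro k h1 h2
    simp only [Finset.mem_range] at h1 h2
    rw [choose_van n hn k (by omega) h1]; ring

lemma P0_SS (n : ℕ) (hn : p = 2*n+1) : PP (g0 (ZZ p)) 0 n = Nr 0 n * SS p 0 := by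
  rw [PP_sum _ (ww p) (ww_eq (by omega)), SS_eq n hn]
  simp [g0]

lemma P1_SS (n : ℕ) (hn : p = 2*n+1) : PP (g1 (ZZ p)) 0 n = Nr 0 n * (4 * SS p 1 + SS p 0) := by
  rw [PP_sum _ (ww p) (ww_eq (by omega)), SS_eq n hn, SS_eq n hn]
  congr 1; rw [Finset.mul_sum, ← Finset.sum_add_distrib]; apply Finset.sum_congr rfl; intro k _; simp [g1]; ring

lemma PW_SS (n : ℕ) (hn : p = 2*n+1) : PP (gW (0:ZZ p)) 0 n = Nr 0 n * (32 * SS p 2 + 16 * SS p 1 + 3 * SS p 0) := by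
  rw [PP_sum _ (ww p) (ww_eq (by omega)), SS_eq n hn, SS_eq n hn, SS_eq n hn]
  congr 1; rw [Finset.mul_sum, Finset.mul_sum, Finset.mul_sum,
    ← Finset.sum_add_distrib, ← Finset.sum_add_distrib]
  apply Finset.sum_congr rfl; intro k _; simp [gW]; ring

lemma tele (h2 : p ≠ 2) : 16 * SS p 3 + 12 * SS p 2 + 6 * SS p 1 + SS p 0 = 0 := by
  have h := Finset.sum_range_sub (fun k : ℕ => (k:ZZ p)^3 * (((2*k).choose k : ZZ p)^3 * ww p^k)) p
  have hw := ww_eq h2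
  have e : ∀ k ∈ Finset.range p, (((k+1:ℕ):ZZ p)^3 * (((2*(k+1)).choose (k+1) : ZZ p)^3 * ww p^(k+1)) - (k:ZZ p)^3 * (((2*k).choose k : ZZ p)^3 * ww p^k))
      = (8 * (2*(k:ZZ p)+1)^3 * ww p - k^3) * (((2*k).choose k : ZZ p)^3 * ww p^k) := by
    intro k _
    have := cb (R := ZZ p) k
    have h3 : ((k:ZZ p)+1)^3 * ((2*(k+1)).choose (k+1) : ZZ p)^3 = 8 * (2*(k:ZZ p)+1)^3 * ((2*k).choose k : ZZ p)^3 := by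
      rw [← mul_pow, this]; ring
    push_cast
    rw [pow_succ (ww p)]
    linear_combination ww p^k * ww p * h3
  rw [Finset.sum_congr rfl e, p_cube] at h
  simp only [SS]
  rw [Finset.mul_sum, Finset.mul_sum, Finset.mul_sum, ← Finset.sum_add_distrib, ← Finset.sum_add_distrib, ← Finset.sum_add_distrib]
  have h5 : -8 * (∑ k ∈ Finset.range p, (8 * (2*(k:ZZ p)+1)^3 * ww p - k^3) * (((2*k).choose k : ZZ p)^3 * ww p^k)) = 0 := by
    rw [h]; ring
  rw [← h5, Finset.mul_sum]
  apply Finset.sum_congr rfl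
  intro k _
  linear_combination (-(2*(k:ZZ p)+1)^3 * (((2*k).choose k : ZZ p)^3 * ww p^k)) * hw

/-- Consequences. -/
lemma S1_rel (n : ℕ) (hn : p = 2*n+1) (h3 : 3 < p) : 4 * SS p 1 + SS p 0 = (-1)^n * p := by
  have h := P1_val n hn h3
  rw [P1_SS n hn] at h
  exact (unit_of _ (Nr_unit n hn)).mul_left_cancel h

lemma S02_rel (n : ℕ) (hn : p = 2*n+1) (h3 : 3 < p) : SS p 0 * (32 * SS p 2 + 16 * SS p 1 + 3 * SS p 0) = 3 * p^2 := by
  have h := PW_val n hn h3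
  rw [P0_SS n hn, PW_SS n hn] at h
  have hu := (unit_of _ (Nr_unit n hn))
  apply (hu.pow 2).mul_left_cancel
  linear_combination h - 3*Nr_sq n hn
end SumsZ
end S5

namespace S5
open Polynomial

section Gam
variable {p : ℕ} [hp : Fact p.Prime]

lemma two_neZ (h2 : p ≠ 2) : (2:ZMod p) ≠ 0 := by
  obtain ⟨n, hn⟩ := hp.out.eq_two_or_odd'.resolve_left h2
  exact two_ne n hn

/-- Wilson mod p^3 -/
lemma wilson3 (h2 : p ≠ 2) : (∏ u : (ZZ p)ˣ, (u : ZZ p)) = -1 := by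
  classical
  haveI : NeZero (p^3) := ⟨pow_ne_zero _ hp.out.ne_zero⟩
  have hne : (1 : (ZZ p)ˣ) ≠ -1 := by
    intro h
    have h3 := congrArg (fun u : (ZZ p)ˣ => pi p (u : ZZ p)) h
    simp only [Units.val_one, Units.val_neg, map_one, map_neg] at h3
    apply two_neZ (p := p) h2
    linear_combination h3
  have hsub : ∏ u ∈ (Finset.univ : Finset (ZZ p)ˣ) \ {1, -1}, u = 1 := by
    apply Finset.prod_involution (fun u _ => u⁻¹)
    · intro a _; simp
    · intro a ha _ h
      simp only [Finset.mem_sdiff, Finset.mem_univ, true_and, Finset.mem_insert, Finset.mem_singleton, not_or] at ha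
      have hs : (a : ZZ p) * a = 1 := by
        have : a * a = 1 := by
          nth_rewrite 1 [← h]; simp
        have h9 := congrArg (Units.val) this
        rwa [Units.val_mul, Units.val_one] at h9
      by_cases h1 : pi p ((a:ZZ p) - 1) = 0
      · have h4 : IsUnit ((a:ZZ p) + 1) := by
          apply unit_of
          intro h5
          apply two_neZ (p := p) h2
          rw [map_sub, map_one] at h1
          rw [map_add, map_one] at h5
          linear_combination h5 - h1
        have : (a:ZZ p) - 1 = 0 := by
          apply h4.mul_left_cancel
          linear_combination hs
        apply ha.1
        ext
        simpa [sub_eq_zero] using this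
      · have h4 : (a:ZZ p) + 1 = 0 := by
          apply (unit_of _ h1).mul_left_cancel
          linear_combination hs
        apply ha.2
        ext
        rw [Units.val_neg, Units.val_one]
        linear_combination h4
    · intro a _; simp
    · intro a ha
      simp only [Finset.mem_sdiff, Finset.mem_univ, true_and, Finset.mem_insert, Finset.mem_singleton, not_or] at ha ⊢
      constructor
      · intro h; apply ha.1; exact inv_eq_one.1 h
      · intro h; apply ha.2; rw [← inv_inv a, h]; simp
  have h := Finset.prod_sdiff (f := fun u : (ZZ p)ˣ => u) (Finset.subset_univ ({1,-1} : Finset (ZZ p)ˣ))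
  rw [hsub, Finset.prod_pair hne] at h
  have h' := congrArg Units.val h
  rw [Units.coe_prod] at h'
  rw [← h']; simp

def gfac (p : ℕ) (i : ℕ) : ZZ p := if p ∣ i then 1 else (i : ZZ p)

def Gn (p : ℕ) (N : ℕ) : ZZ p := (-1)^N * ∏ i ∈ Finset.range N, gfac p i

lemma Gn_succ (N : ℕ) : Gn p (N+1) = - gfac p N * Gn p N := by
  rw [Gn, Gn, Finset.prod_range_succ]; ring

lemma gfac_per (i : ℕ) : gfac p (i + p^3) = gfac p i := by
  unfold gfac
  have : p ∣ i + p^3 ↔ p ∣ i := (Nat.dvd_add_left (dvd_pow_self p (by norm_num)))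
  simp only [this]
  push_cast
  rw [p_cube, add_zero]

lemma Gn_p3 (h2 : p ≠ 2) : Gn p (p^3) = 1 := by
  classical
  haveI : NeZero (p^3) := ⟨pow_ne_zero _ hp.out.ne_zero⟩
  rw [Gn]
  have ho : Odd (p^3) := (hp.out.odd_of_ne_two h2).pow
  rw [ho.neg_one_pow]
  have hu : ∀ i : ℕ, ¬ p ∣ i ↔ IsUnit (i : ZZ p) := by
    intro i
    rw [ZMod.isUnit_iff_coprime, Nat.coprime_pow_right_iff (by norm_num), Nat.coprime_comm, hp.out.coprime_iff_not_dvd]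
  have h1 : ∏ i ∈ Finset.range (p^3), gfac p i = ∏ i ∈ (Finset.range (p^3)).filter (fun i => ¬ p ∣ i), (i : ZZ p) := by
    rw [Finset.prod_filter]
    apply Finset.prod_congr rfl
    intro i _
    unfold gfac
    by_cases h : p ∣ i <;> simp [h]
  have hw := wilson3 (p := p) h2
  rw [h1]
  suffices hh : ∏ i ∈ (Finset.range (p^3)).filter (fun i => ¬ p ∣ i), (i : ZZ p) = ∏ u : (ZZ p)ˣ, (u : ZZ p) by
    rw [hh, hw]; ring
  symm
  apply Finset.prod_bij (fun (u : (ZZ p)ˣ) _ => (u : ZZ p).val)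
  · intro u _
    simp only [Finset.mem_filter, Finset.mem_range]
    refine ⟨ZMod.val_lt _, ?_⟩
    rw [hu, ZMod.natCast_zmod_val]; exact u.isUnit
  · intro u _ v _ h
    ext; exact ZMod.val_injective _ h
  · intro i hi
    simp only [Finset.mem_filter, Finset.mem_range] at hi
    refine ⟨((hu i).1 hi.2).unit, Finset.mem_univ _, ?_⟩
    rw [IsUnit.unit_spec, ZMod.val_natCast, Nat.mod_eq_of_lt hi.1]
  · intro u _
    rw [ZMod.natCast_zmod_val]

lemma Gn_per (h2 : p ≠ 2) (N : ℕ) : Gn p (N + p^3) = Gn p N := by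
  induction N with
  | zero => rw [zero_add, Gn_p3 h2]; simp [Gn]
  | succ N ih =>
    rw [show N + 1 + p^3 = (N+p^3) + 1 by ring, Gn_succ, ih, gfac_per, Gn_succ]

lemma Gn_per' (h2 : p ≠ 2) (N k : ℕ) : Gn p (N + k * p^3) = Gn p N := by
  induction k with
  | zero => simp
  | succ k ih => rw [show N + (k+1)*p^3 = (N + k*p^3) + p^3 by ring, Gn_per h2, ih]

def Gm (p : ℕ) (x : ZZ p) : ZZ p := Gn p x.val

lemma Gm_nat (h2 : p ≠ 2) (N : ℕ) : Gm p (N : ZZ p) = Gn p N := by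
  rw [Gm, ZMod.val_natCast]
  have := Gn_per' h2 (N % p^3) (N / p^3)
  rw [Nat.mod_add_div'] at this
  exact this.symm

lemma nat_surj (x : ZZ p) : ∃ N : ℕ, x = N := by
  haveI : NeZero (p^3) := ⟨pow_ne_zero _ hp.out.ne_zero⟩
  obtain ⟨m, rfl⟩ := ZMod.natCast_zmod_surjective x
  exact ⟨m, rfl⟩

lemma Gm_succ (h2 : p ≠ 2) (x : ZZ p) (hx : pi p x ≠ 0) : Gm p (x+1) = -x * Gm p x := by
  obtain ⟨N, rfl⟩ := nat_surj x
  have : ((N:ZZ p) + 1) = ((N+1:ℕ) : ZZ p) := by push_cast; ring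
  rw [this, Gm_nat h2, Gm_nat h2, Gn_succ, gfac, if_neg]
  rw [map_natCast, Ne, ZMod.natCast_eq_zero_iff] at hx
  exact hx

lemma Gm_succ0 (h2 : p ≠ 2) (x : ZZ p) (hx : pi p x = 0) : Gm p (x+1) = -Gm p x := by
  obtain ⟨N, rfl⟩ := nat_surj x
  have : ((N:ZZ p) + 1) = ((N+1:ℕ) : ZZ p) := by push_cast; ring
  rw [this, Gm_nat h2, Gm_nat h2, Gn_succ, gfac, if_pos]
  · ring
  rw [map_natCast, ZMod.natCast_eq_zero_iff] at hx
  exact hx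

lemma Gm_zero (h2 : p ≠ 2) : Gm p 0 = 1 := by
  have := Gm_nat (p := p) h2 0
  rw [Nat.cast_zero] at this
  rw [this]; simp [Gn]

lemma Gm_unit (x : ZZ p) : pi p (Gm p x) ≠ 0 := by
  rw [Gm, Gn, map_mul, map_prod, map_pow, map_neg, map_one]
  apply mul_ne_zero (pow_ne_zero _ (by simp))
  apply Finset.prod_ne_zero_iff.2
  intro i _
  unfold gfac
  split_ifs with h
  · rw [map_one]; exact one_ne_zero
  · rw [map_natCast, Ne, ZMod.natCast_eq_zero_iff]; exact h

/-- induction on ZZ p -/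
lemma ZZ_ind (P : ZZ p → Prop) (h0 : P 0) (hs : ∀ x, P x → P (x+1)) (x : ZZ p) : P x := by
  obtain ⟨N, rfl⟩ := nat_surj x
  induction N with
  | zero => simpa using h0
  | succ N ih => push_cast; exact hs _ ih

/-- the block product -/
lemma ev_three (f : ℤ[X]) (y : ZZ p) : eval₂ (Int.castRingHom (ZZ p)) ((p:ZZ p)*y) f = f.coeff 0 + p * y * f.coeff 1 + p^2 * y^2 * f.coeff 2 := by
  have h : ∀ g : ℤ[X], eval₂ (Int.castRingHom (ZZ p)) ((p:ZZ p)*y) g =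
      eval₂ (Int.castRingHom (ZZ p)) ((p:ZZ p)*y) g.divX * (p*y) + (g.coeff 0 : ℤ) := by
    intro g
    conv_lhs => rw [← divX_mul_X_add g]
    rw [eval₂_add, eval₂_mul, eval₂_X, eval₂_C, eq_intCast]
  have h1 := h f
  have h2 := h f.divX
  have h3 := h f.divX.divX
  simp only [coeff_divX] at h1 h2 h3
  rw [h1, h2, h3]
  linear_combination (eval₂ (Int.castRingHom (ZZ p)) ((p:ZZ p)*y) f.divX.divX.divX) * y^3 * p_cube (p := p)

noncomputable def Fb (p : ℕ) : ℤ[X] := ∏ i ∈ Finset.range (p-1), (X + C ((i:ℤ)+1))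

lemma Fb_coeff2 (h3 : 3 < p) : (((Fb p).coeff 2 : ℤ) : ZMod p) = 0 := by
  have e : (Fb p).map (Int.castRingHom (ZMod p)) * X = Lam p := by
    have hm : (Fb p).map (Int.castRingHom (ZMod p)) = ∏ i ∈ Finset.range (p-1), (X + C ((i:ZMod p)+1)) := by
      rw [Fb, Polynomial.map_prod]; simp
    have hmon : ((Fb p).map (Int.castRingHom (ZMod p)) * X).Monic := by
      apply Monic.mul _ monic_X
      rw [hm]
      exact monic_prod_of_monic _ _ (fun i _ => monic_X_add_C _)
    have hdeg : ((Fb p).map (Int.castRingHom (ZMod p)) * X).natDegree = p := by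
      rw [hm, natDegree_mul_X, natDegree_prod_of_monic _ _ (fun i _ => monic_X_add_C _)]
      · rw [Finset.sum_congr rfl (fun i _ => natDegree_X_add_C _)]; simp; omega
      · exact (monic_prod_of_monic _ _ (fun i _ => monic_X_add_C _)).ne_zero
    rw [← sub_eq_zero]
    apply zero_of_eval
    · have hd : ((Fb p).map (Int.castRingHom (ZMod p)) * X - Lam p).degree < ((Fb p).map (Int.castRingHom (ZMod p)) * X).degree := by
        apply degree_sub_lt_left
        · rw [degree_eq_natDegree hmon.ne_zero, degree_eq_natDegree Lam_monic.ne_zero, hdeg, Lam_natDegree]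
        · exact hmon.ne_zero
        · rw [hmon.leadingCoeff, Lam_monic.leadingCoeff]
      by_cases hz : (Fb p).map (Int.castRingHom (ZMod p)) * X - Lam p = 0
      · rw [hz, natDegree_zero]; exact hp.out.pos
      · exact (natDegree_lt_natDegree hz hd).trans_eq hdeg
    · intro x
      rw [eval_sub, Lam_eval, sub_zero, eval_mul, eval_X, hm, eval_prod]
      by_cases hx : x = 0
      · rw [hx, mul_zero]
      · have : (-x).val < p := ZMod.val_lt _
        have h0 : (-x).val ≠ 0 := by rw [Ne, ZMod.val_eq_zero]; simpa using hx
        rw [Finset.prod_eq_zero (i := (-x).val - 1), zero_mul]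
        · simp; omega
        · rw [eval_add, eval_X, eval_C]
          have h5 : (((-x).val - 1 : ℕ) : ZMod p) + 1 = (((-x).val - 1 + 1 : ℕ) : ZMod p) := by push_cast; ring
          rw [h5, Nat.sub_add_cancel (by omega), ZMod.natCast_zmod_val]; ring
  have h := congrArg (fun q => coeff q 3) e
  simp only [coeff_mul_X, coeff_map] at h
  rw [eq_intCast] at h
  rw [h, Lam, coeff_sub, coeff_X_pow, coeff_X]
  rw [if_neg (by omega), if_neg (by omega), sub_zero]

lemma Fb_coeff1 (h3 : 3 < p) : (p:ZZ p) * ((Fb p).coeff 1 : ℤ) = 0 := by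
  have h1 := ev_three (p := p) (Fb p) (-1)
  have h2 : (p:ZZ p)^2 * ((Fb p).coeff 2 : ℤ) = p^2 * 0 := p2_eq _ _ (by rw [map_intCast, Fb_coeff2 h3, map_zero])
  have h0 := ev_zero (p := p) (Fb p)
  have h4 : eval₂ (Int.castRingHom (ZZ p)) ((p:ZZ p) * (-1)) (Fb p) = eval₂ (Int.castRingHom (ZZ p)) 0 (Fb p) := by
    rw [Fb, eval₂_finsetProd, eval₂_finsetProd]
    simp only [eval₂_add, eval₂_X, eval₂_C, zero_add]
    rw [← Finset.prod_range_reflect]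
    have : ∀ j ∈ Finset.range (p-1), ((p:ZZ p) * (-1) + (Int.castRingHom (ZZ p)) (((p-1-1-j:ℕ):ℤ)+1)) =
        - (Int.castRingHom (ZZ p)) ((j:ℤ)+1) := by
      intro j hj
      rw [Finset.mem_range] at hj
      have : (p:ZZ p) = ((p-1-1-j:ℕ):ZZ p) + 1 + (j+1) := by
        have h5 : p = (p-1-1-j) + 1 + (j+1) := by omega
        have h6 := congrArg (Nat.cast : ℕ → ZZ p) h5
        push_cast at h6 ⊢
        exact h6
      rw [this]; simp; ring
    rw [Finset.prod_congr rfl this, Finset.prod_neg, Finset.card_range]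
    have ho := hp.out.odd_of_ne_two (by omega)
    rw [(Nat.Odd.sub_odd ho odd_one).neg_one_pow, one_mul]
  rw [h4, h0] at h1
  linear_combination h1 + h2

lemma Gm_block (h3 : 3 < p) (y : ZZ p) : Gm p (p * (y+1)) = - ((p-1).factorial : ZZ p) * Gm p (p * y) := by
  obtain ⟨N, rfl⟩ := nat_surj y
  have h2 : p ≠ 2 := by omega
  have e1 : (p:ZZ p) * ((N:ZZ p)+1) = ((p*N+1+(p-1):ℕ):ZZ p) := by
    rw [show p*N+1+(p-1) = p*N+p by omega]; push_cast; ring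
  have key : ∀ k, k ≤ p-1 → Gn p (p*N+1+k) = (-1)^k * (∏ i ∈ Finset.range k, ((p:ZZ p)*N + (i+1))) * Gn p (p*N+1) := by
    intro k
    induction k with
    | zero => intro _; simp
    | succ k ih =>
      intro hk
      rw [← add_assoc, Gn_succ, ih (by omega), Finset.prod_range_succ, gfac, if_neg]
      · push_cast; ring
      · intro hd
        rw [add_assoc, Nat.dvd_add_right (dvd_mul_right p N)] at hd
        have := Nat.le_of_dvd (by omega) hd
        omega
  have e2 : (p:ZZ p) * N = ((p*N:ℕ):ZZ p) := by push_cast; ring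
  rw [e1, e2, Gm_nat h2, Gm_nat h2, key _ le_rfl, Gn_succ, gfac, if_pos (dvd_mul_right p N)]
  have h1 := ev_three (p := p) (Fb p) N
  have h5 : (p:ZZ p)^2 * ((Fb p).coeff 2 : ℤ) = p^2 * 0 := p2_eq _ _ (by rw [map_intCast, Fb_coeff2 h3, map_zero])
  have h6 := Fb_coeff1 (p := p) h3
  have h0 := ev_zero (p := p) (Fb p)
  rw [← h0] at h1
  rw [Fb, eval₂_finsetProd, eval₂_finsetProd, ← Fb] at h1
  simp only [eval₂_add, eval₂_X, eval₂_C, zero_add] at h1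
  have hf : ∏ x ∈ Finset.range (p-1), (Int.castRingHom (ZZ p)) ((x:ℤ)+1) = ((p-1).factorial : ZZ p) := by
    rw [← Finset.prod_range_add_one_eq_factorial]; push_cast; simp
  rw [hf] at h1
  have ho := hp.out.odd_of_ne_two (by omega)
  rw [(Nat.Odd.sub_odd ho odd_one).neg_one_pow, one_mul]
  have h7 : ∏ i ∈ Finset.range (p-1), ((p:ZZ p)*N + (i+1)) = ((p-1).factorial : ZZ p) := by
    have : ∀ i ∈ Finset.range (p-1), ((p:ZZ p)*N + (i+1)) = (p:ZZ p)*N + (Int.castRingHom (ZZ p)) ((i:ℤ)+1) := by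
      intro i _; simp
    rw [Finset.prod_congr rfl this, h1]
    linear_combination N * h6 + N^2 * h5
  rw [h7]; ring
end Gam
end S5

namespace S5
open Polynomial

section Gam2
variable {p : ℕ} [hp : Fact p.Prime]

def Ex (p : ℕ) (x A C : ZZ p) : Prop := ∀ y, Gm p (x + p*y) = Gm p x * (1 + p*A*y + p^2*C*y^2)

lemma half (h2 : p ≠ 2) : (2:ZZ p) * (2:ZZ p)⁻¹ = 1 := by
  apply uinv; rw [map_ofNat]; exact two_neZ h2

lemma Ex_zero (h3 : 3 < p) : ∃ A C, Ex p 0 A C := by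
  obtain ⟨w, hw⟩ := pi_eq (p := p) (-((p-1).factorial : ZZ p)) 1 (by
    rw [map_neg, map_natCast, ZMod.wilsons_lemma, map_one]; ring)
  have ht := half (p := p) (by omega)
  generalize (2:ZZ p)⁻¹ = t at ht
  refine ⟨w - p*w^2*t, w^2*t, ?_⟩
  have h2 : p ≠ 2 := by omega
  intro y
  rw [zero_add, Gm_zero h2]
  have := p_cube (p := p)
  induction y using ZZ_ind with
  | h0 => simp [Gm_zero h2]
  | hs y ih =>
    rw [Gm_block h3, ih, hw]
    linear_combination (-w^3*t*y + w^3*t*y^2) * this + (-p^2*w^2*y) * ht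

lemma Ex_all (h3 : 3 < p) (x : ZZ p) : ∃ A C, Ex p x A C := by
  have h2 : p ≠ 2 := by omega
  induction x using ZZ_ind with
  | h0 => exact Ex_zero h3
  | hs x ih =>
    obtain ⟨A, C, h⟩ := ih
    have hpi : ∀ y : ZZ p, pi p (x + p * y) = pi p x := fun y => by rw [map_add, map_mul, pi_p]; ring
    by_cases hx : pi p x = 0
    · refine ⟨A, C, fun y => ?_⟩
      rw [show x + 1 + p*y = (x+p*y)+1 by ring, Gm_succ0 h2 _ (by rw [hpi, hx]), Gm_succ0 h2 _ hx, h y]; ring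
    · refine ⟨A + x⁻¹, C + A * x⁻¹, fun y => ?_⟩
      rw [show x + 1 + p*y = (x+p*y)+1 by ring, Gm_succ h2 _ (by rwa [hpi]), Gm_succ h2 _ hx, h y]
      have := p_cube (p := p)
      have hi := uinv x hx
      linear_combination (- Gm p x * C * y^3) * this +  (Gm p x * y * p * (1 + p * A * y)) * hi

lemma Ex_uniq (h2 : p ≠ 2) (x A C A' C' : ZZ p) (h : Ex p x A C) (h' : Ex p x A' C') :
    p * A = p * A' ∧ p^2 * C = p^2 * C' := by
  have hu := unit_of _ (Gm_unit x)
  have ht := half (p := p) h2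
  have e : ∀ y : ZZ p, p*A*y + p^2*C*y^2 = p*A'*y + p^2*C'*y^2 := by
    intro y
    apply hu.mul_left_cancel
    linear_combination h' y - h y
  constructor
  · linear_combination (2:ZZ p)⁻¹ * (e 1 - e (-1)) - (p * A - p * A') * ht
  · linear_combination (2:ZZ p)⁻¹ * (e 1 + e (-1)) - (p^2 * C - p^2 * C') * ht

open Classical in
noncomputable def LA (p : ℕ) (x : ZZ p) : ZZ p :=
  if h : ∃ A C, Ex p x A C then h.choose else 0
open Classical in
noncomputable def LC (p : ℕ) (x : ZZ p) : ZZ p :=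
  if h : ∃ A C, Ex p x A C then h.choose_spec.choose else 0

lemma Gm_exp (h3 : 3 < p) (x : ZZ p) : Ex p x (LA p x) (LC p x) := by
  have h := Ex_all h3 x
  rw [LA, LC, dif_pos h, dif_pos h]
  exact h.choose_spec.choose_spec

noncomputable def LB (p : ℕ) (x : ZZ p) : ZZ p := 2 * LC p x - LA p x^2

lemma pi_addp (x y : ZZ p) : pi p (x + p * y) = pi p x := by rw [map_add, map_mul, pi_p]; ring

lemma LA_succ0 (h3 : 3 < p) (x : ZZ p) (hx : pi p x = 0) :
    p * LA p (x+1) = p * LA p x ∧ p^2 * LC p (x+1) = p^2 * LC p x := by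
  have h2 : p ≠ 2 := by omega
  apply Ex_uniq h2 (x+1) _ _ _ _ (Gm_exp h3 _)
  intro y
  rw [show x + 1 + p*y = (x+p*y)+1 by ring, Gm_succ0 h2 _ (by rw [pi_addp, hx]), Gm_succ0 h2 _ hx, Gm_exp h3 x y]; ring

lemma LA_succ (h3 : 3 < p) (x : ZZ p) (hx : pi p x ≠ 0) :
    p * LA p (x+1) = p * (LA p x + x⁻¹) ∧ p^2 * LC p (x+1) = p^2 * (LC p x + LA p x * x⁻¹) := by
  have h2 : p ≠ 2 := by omega
  apply Ex_uniq h2 (x+1) _ _ _ _ (Gm_exp h3 _)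
  intro y
  rw [show x + 1 + p*y = (x+p*y)+1 by ring, Gm_succ h2 _ (by rwa [pi_addp]), Gm_succ h2 _ hx, Gm_exp h3 x y]
  have := p_cube (p := p)
  have hi := uinv x hx
  linear_combination (- Gm p x * LC p x * y^3) * this +  (Gm p x * y * p * (1 + p * LA p x * y)) * hi

lemma LB_succ (h3 : 3 < p) (x : ZZ p) (hx : pi p x ≠ 0) :
    p^2 * LB p (x+1) = p^2 * (LB p x - (x⁻¹)^2) := by
  obtain ⟨h1, h2⟩ := LA_succ h3 x hx
  rw [LB, LB]
  linear_combination 2 * h2 - (p * LA p (x+1) + p * (LA p x + x⁻¹)) * h1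

lemma LA_shift (h3 : 3 < p) (x z : ZZ p) :
    p * LA p (x+p*z) = p * (LA p x + p * LB p x * z) ∧ p^2 * LC p (x+p*z) = p^2 * LC p x := by
  have h2 : p ≠ 2 := by omega
  apply Ex_uniq h2 (x+p*z) _ _ _ _ (Gm_exp h3 _)
  intro y
  rw [show x + p*z + p*y = x+p*(z+y) by ring, Gm_exp h3 x, Gm_exp h3 x, LB]
  have := p_cube (p := p)
  generalize LA p x = A
  generalize LC p x = C
  generalize Gm p x = G
  linear_combination (exp := 1) (-G*(A*C*z*y^2 + A*y*C*z^2 + C^2*p*z^2*y^2 + 2*A*C*z^2*y+ 2*C^2*p*z^3*y - A^3*z^2*y - A^2*C*z^3*y*p)) * this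

lemma LB_shift (h3 : 3 < p) (x z : ZZ p) : p^2 * LB p (x+p*z) = p^2 * LB p x := by
  obtain ⟨h1, h2⟩ := LA_shift h3 x z
  rw [LB, LB] at *
  have := p_cube (p := p)
  linear_combination 2*h2 - (p * LA p (x+p*z) + p * (LA p x + p * (2 * LC p x - LA p x^2) * z)) * h1
     - (2 * LA p x * (2 * LC p x - LA p x^2) * z + p * ((2 * LC p x - LA p x^2) * z)^2) * this

lemma LA_shift2 (h3 : 3 < p) (x z : ZZ p) : p^2 * LA p (x+p*z) = p^2 * LA p x := by
  obtain ⟨h1, h2⟩ := LA_shift h3 x z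
  linear_combination p * h1 + LB p x * z * p_cube (p := p)

def rr (p : ℕ) (x : ZZ p) : ZZ p := Gm p x * Gm p (1-x)

lemma rr_succ (h2 : p ≠ 2) (x : ZZ p) (hx : pi p x ≠ 0) : rr p (x+1) = - rr p x := by
  rw [rr, rr, Gm_succ h2 x hx, show 1 - x = (-x) + 1 by ring, Gm_succ h2 (-x) (by rwa [map_neg, neg_ne_zero]),
    show 1 - (x+1) = -x by ring]; ring

lemma rr_succ0 (h2 : p ≠ 2) (x : ZZ p) (hx : pi p x = 0) : rr p (x+1) = rr p x := by
  rw [rr, rr, Gm_succ0 h2 x hx, show 1 - x = (-x) + 1 by ring, Gm_succ0 h2 (-x) (by rw [map_neg, hx, neg_zero]),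
    show 1 - (x+1) = -x by ring]; ring

lemma rr_zero (h2 : p ≠ 2) : rr p 0 = -1 := by
  have := Gm_succ0 (p := p) h2 0 (map_zero _)
  rw [zero_add] at this
  rw [rr, sub_zero, this, Gm_zero h2]; ring

lemma rr_step (h2 : p ≠ 2) (z : ZZ p) (N : ℕ) (hN : N < p) : rr p (p*z + (N+1:ℕ)) = (-1)^N * rr p (p*z) := by
  induction N with
  | zero => rw [zero_add, Nat.cast_one, rr_succ0 h2, pow_zero, one_mul]; rw [map_mul, pi_p, zero_mul]
  | succ N ih =>
    have := ih (by omega)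
    rw [Nat.cast_add, Nat.cast_one, ← add_assoc, rr_succ h2, this]
    · ring
    · rw [add_comm (p*z : ZZ p), pi_addp, map_natCast, Ne, ZMod.natCast_eq_zero_iff]
      intro h; have := Nat.le_of_dvd (by omega) h; omega

lemma rr_pz (h2 : p ≠ 2) (z : ZZ p) : rr p (p*z) = -1 := by
  induction z using ZZ_ind with
  | h0 => rw [mul_zero, rr_zero h2]
  | hs z ih =>
    have h := rr_step h2 z (p-1) (by have := hp.out.pos; omega)
    rw [ih, Nat.sub_add_cancel hp.out.pos] at h
    rw [mul_add, mul_one, h]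
    have ho := hp.out.odd_of_ne_two (by omega)
    rw [(Nat.Odd.sub_odd ho odd_one).neg_one_pow, one_mul]

lemma rr_val (h2 : p ≠ 2) (z : ZZ p) (N : ℕ) (h1 : 1 ≤ N) (hN : N ≤ p) : rr p (p*z + N) = (-1)^N := by
  obtain ⟨M, rfl⟩ : ∃ M, N = M+1 := ⟨N-1, by omega⟩
  rw [rr_step h2 z M (by omega), rr_pz h2]; ring

lemma rr_per (h2 : p ≠ 2) (x y : ZZ p) : rr p (x + p*y) = rr p x := by
  induction x using ZZ_ind with
  | h0 => rw [zero_add, rr_pz h2, rr_zero h2]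
  | hs x ih =>
    rw [show x + 1 + p*y = (x+p*y)+1 by ring]
    by_cases hx : pi p x = 0
    · rw [rr_succ0 h2 _ (by rwa [pi_addp]), rr_succ0 h2 _ hx, ih]
    · rw [rr_succ h2 _ (by rwa [pi_addp]), rr_succ h2 _ hx, ih]

lemma rr_unit (x : ZZ p) : IsUnit (rr p x) :=
  (unit_of _ (Gm_unit x)).mul (unit_of _ (Gm_unit _))

lemma LA_refl (h3 : 3 < p) (x : ZZ p) : p * LA p (1-x) = p * LA p x ∧ p^2 * LB p (1-x) = - (p^2 * LB p x) := by
  have h2 : p ≠ 2 := by omega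
  have ht := half (p := p) h2
  have e : ∀ y : ZZ p, (1 + p*LA p x*y + p^2*LC p x*y^2) * (1 + p*LA p (1-x)*(-y) + p^2*LC p (1-x)*(-y)^2) = 1 := by
    intro y
    have h := rr_per h2 x y
    apply (rr_unit x).mul_left_cancel
    rw [rr, rr, Gm_exp h3 x y, show 1 - (x + p*y) = (1-x) + p*(-y) by ring, Gm_exp h3 (1-x) (-y)] at h
    rw [rr]
    linear_combination h
  have e1 := e 1
  have e2 := e (-1)
  have := p_cube (p := p)
  have h1 : p * LA p (1-x) = p * LA p x := by
    linear_combination (2:ZZ p)⁻¹ * (e2 - e1) - (p * LA p (1-x) - p * LA p x - p^3*(LA p x * LC p (1-x) - LC p x * LA p (1-x))) * ht + (LA p x * LC p (1-x) - LC p x * LA p (1-x)) * this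
  refine ⟨h1, ?_⟩
  rw [LB, LB]
  linear_combination e1 + e2 - (p * LA p (1-x) - p * LA p x) * h1 - 2 * p * LC p x * LC p (1-x) * this

lemma Gm_prod (h2 : p ≠ 2) (x : ZZ p) (L : ℕ) (h : ∀ l < L, pi p (x + l) ≠ 0) :
    Gm p (x + L) = (-1)^L * (∏ l ∈ Finset.range L, (x+l)) * Gm p x := by
  induction L with
  | zero => simp
  | succ L ih =>
    rw [Finset.prod_range_succ]
    push_cast
    rw [← add_assoc, Gm_succ h2 _ (h L (by omega)), ih (fun l hl => h l (by omega))]; ring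
end Gam2
end S5

namespace S5
open Polynomial

section Gam3
variable {p : ℕ} [hp : Fact p.Prime]

lemma rr_sq (h2 : p ≠ 2) (x : ZZ p) : rr p x ^2 = 1 := by
  induction x using ZZ_ind with
  | h0 => rw [rr_zero h2]; ring
  | hs x ih =>
    by_cases hx : pi p x = 0
    · rw [rr_succ0 h2 _ hx, ih]
    · rw [rr_succ h2 _ hx, neg_sq, ih]

noncomputable def ee (p : ℕ) : ZZ p := (8:ZZ p)⁻¹

lemma eight_ne (h2 : p ≠ 2) : (8:ZMod p) ≠ 0 := by
  rw [show (8:ZMod p) = 2^3 by norm_num]; exact pow_ne_zero _ (two_neZ h2)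

lemma ee_eq (h2 : p ≠ 2) : 8 * ee p = 1 := by
  apply uinv; rw [map_ofNat]; exact eight_ne h2

lemma pi_lin_ne (h2 : p ≠ 2) (c a : ℕ) (h : ¬ p ∣ 8*a+c) : pi p (c * ee p + a) ≠ 0 := by
  intro h0
  apply h
  rw [← ZMod.natCast_eq_zero_iff]
  have h1 : ((8*a+c : ℕ) : ZZ p) = 8 * (c * ee p + a) := by
    push_cast; linear_combination -(c:ZZ p) * ee_eq h2
  have h2 := congrArg (pi p) h1
  rw [map_natCast, map_mul, h0, mul_zero] at h2
  exact h2

lemma PL (h2 : p ≠ 2) (c a L : ℕ) (h : ∀ i < L, ¬ p ∣ 8*(a+i)+c) :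
    Gm p (c * ee p + a + L) * 8^L = (-1)^L * (∏ i ∈ Finset.range L, (8*((a:ZZ p)+i)+c)) * Gm p (c * ee p + a) := by
  rw [Gm_prod h2]
  · have : (∏ i ∈ Finset.range L, (8*((a:ZZ p)+i)+c)) = (∏ i ∈ Finset.range L, (c * ee p + a + i)) * 8^L := by
      rw [show (8:ZZ p)^L = ∏ i ∈ Finset.range L, 8 by simp, ← Finset.prod_mul_distrib]
      apply Finset.prod_congr rfl
      intro i _
      linear_combination -(c:ZZ p) * ee_eq h2
    rw [this]; ring
  · intro l hl
    have := pi_lin_ne h2 c (a+l) (h l hl)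
    rw [Nat.cast_add, ← add_assoc] at this
    exact this

lemma ndvd (N : ℕ) (h0 : N ≠ 0) (h1 : N ≠ p) (h2 : N < 2*p) : ¬ p ∣ N := by
  rintro ⟨m, rfl⟩
  have : m < 2 := by
    by_contra h
    have : p * 2 ≤ p * m := Nat.mul_le_mul_left p (by omega)
    omega
  interval_cases m <;> simp at h0 h1

lemma ndvd4 (N : ℕ) (h0 : N ≠ 0) (h1 : N ≠ p) (h2 : N ≠ 2*p) (h3 : N ≠ 3*p) (h4 : N < 4*p) : ¬ p ∣ N := by
  rintro ⟨m, rfl⟩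
  have : m < 4 := by
    by_contra h
    have : p * 4 ≤ p * m := Nat.mul_le_mul_left p (by omega)
    omega
  interval_cases m <;> simp at h0 h1 <;> omega

lemma Gne (x : ZZ p) : IsUnit (Gm p x) := unit_of _ (Gm_unit x)

/-- value of the quotient, p = 8k+1 -/
lemma f_one (k : ℕ) (hk : p = 8*k+1) (h3 : 3 < p) :
    PP (g0 (ZZ p)) ((p:ZZ p)^2) (4*k) = Nr ((p:ZZ p)^2) (4*k) *
      (-(Gm p (ee p + p * (2 * ee p)) * Gm p (ee p - p * (2 * ee p)) * (Gm p (3 * ee p + p * (2 * ee p)) * Gm p (3 * ee p - p*(2 * ee p))))) := by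
  have h2 : p ≠ 2 := by omega
  have he := ee_eq (p := p) h2
  have hkpos : 0 < k := by omega
  obtain ⟨j, rfl⟩ : ∃ j, k = j + 1 := ⟨k-1, by omega⟩
  set k := j + 1 with hkdef
  -- integer cancellation
  have hZ := T_even ℤ (4*k) (2*k) (by ring)
  have hpz : (2*((4*k:ℕ):ℤ)+1) = p := by rw [hk]; push_cast; ring
  rw [hpz] at hZ
  have hE1 : E1 ℤ (2*k) = p * ((∏ i ∈ Finset.range (2*k), (8*(i:ℤ)+7)) * ((∏ i ∈ Finset.range j, (8*(i:ℤ)+9)) *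
      ∏ i ∈ Finset.range k, (8*((k:ℤ)+i)+9))) := by
    rw [E1, Finset.prod_mul_distrib, two_mul k, Finset.prod_range_add (fun i : ℕ => 8*(i:ℤ)+9), hkdef,
      Finset.prod_range_succ (fun i : ℕ => 8*(i:ℤ)+9) j, ← hkdef]
    have : (8*(j:ℤ)+9) = p := by rw [hk, hkdef]; push_cast; ring
    rw [this]; push_cast; ring
  have hp0 : (p:ℤ) ≠ 0 := by exact_mod_cast hp.out.ne_zero
  have hZ2 : PP (g0 ℤ) ((p:ℤ)^2) (4*k) * ((∏ i ∈ Finset.range (2*k), (8*(i:ℤ)+7)) * ((∏ i ∈ Finset.range j, (8*(i:ℤ)+9)) *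
      ∏ i ∈ Finset.range k, (8*((k:ℤ)+i)+9))) = Nr ((p:ℤ)^2) (4*k) * ((∏ i ∈ Finset.range (2*k), (8*(i:ℤ)+3)) *
        ∏ i ∈ Finset.range (2*k), (8*(i:ℤ)+5)) := by
    apply mul_left_cancel₀ hp0
    rw [hE1, E2, Finset.prod_mul_distrib] at hZ
    linear_combination hZ
  have hZ3 := congrArg (Int.castRingHom (ZZ p)) hZ2
  rw [map_mul, map_mul (Int.castRingHom (ZZ p)) (Nr _ _), map_PP0, map_Nr] at hZ3
  simp only [map_mul, map_prod, map_pow] at hZ3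
  simp only [eq_intCast, Int.cast_add, Int.cast_mul, Int.cast_natCast, Int.cast_ofNat] at hZ3
  -- gamma
  have c7 := PL h2 7 0 (2*k) (fun i hi => ndvd _ (by omega) (by omega) (by omega))
  have c3 := PL h2 3 0 (2*k) (fun i hi => ndvd _ (by omega) (by omega) (by omega))
  have c5 := PL h2 5 0 (2*k) (fun i hi => ndvd _ (by omega) (by omega) (by omega))
  have c9 := PL h2 9 0 j (fun i hi => ndvd _ (by omega) (by omega) (by omega))
  have c9' := PL h2 9 k k (fun i hi => ndvd _ (by omega) (by omega) (by omega))
  simp only [Nat.cast_zero, zero_add, add_zero] at c7 c3 c5 c9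
  have hkz : (k:ZZ p) = p * ee p - ee p := by
    have : (p:ZZ p) = 8*k+1 := by
      have := congrArg (Nat.cast : ℕ → ZZ p) hk; push_cast at this ⊢; exact this
    linear_combination -(k:ZZ p) * he - ee p * this
  have hjz : (j:ZZ p) = k - 1 := by rw [hkdef]; push_cast; ring
  push_cast at c7 c3 c5 c9 c9'
  rw [show (7:ZZ p) * ee p + 2 * k = 5 * ee p + p * (2*ee p) by rw [hkz]; ring] at c7
  rw [show (3:ZZ p) * ee p + 2 * k = ee p + p * (2*ee p) by rw [hkz]; ring] at c3
  rw [show (5:ZZ p) * ee p + 2 * k = 3 * ee p + p * (2*ee p) by rw [hkz]; ring] at c5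
  have c9a : (9:ZZ p) * ee p + j = p * ee p := by rw [hjz, hkz]; linear_combination he
  have c9b : (9:ZZ p) * ee p + k = p * ee p + 1 := by rw [hkz]; linear_combination he
  have c9c : (9:ZZ p) * ee p + k + k = 7 * ee p + p * (2*ee p) := by rw [hkz]; ring
  rw [c9a] at c9
  rw [c9c, c9b, Gm_succ0 h2 _ (by rw [map_mul, pi_p, zero_mul])] at c9'
  have c91 : Gm p (9 * ee p) = - ee p * Gm p (ee p) := by
    rw [show 9 * ee p = ee p + 1 by linear_combination he]
    apply Gm_succ h2
    intro h; have := congrArg (pi p) he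
    rw [map_mul, h, map_one, mul_zero] at this
    exact zero_ne_one this
  rw [c91] at c9
  have r1 := rr_sq h2 (ee p)
  have r3 := rr_sq h2 (3 * ee p)
  have r1p := rr_per h2 (ee p) (p := p) (-(2*ee p))
  have r3p := rr_per h2 (3 * ee p) (p := p) (-(2*ee p))
  have r1e : rr p (ee p) = Gm p (ee p) * Gm p (7 * ee p) := by
    rw [rr]; congr 2; linear_combination -he
  have r3e : rr p (3 * ee p) = Gm p (3 * ee p) * Gm p (5 * ee p) := by
    rw [rr]; congr 2; linear_combination -he
  rw [rr, show 1 - (ee p + p * -(2 * ee p)) = 7 * ee p + p*(2*ee p) by linear_combination -he,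
     show (ee p + p * -(2 * ee p)) = ee p - p * (2 * ee p) by ring] at r1p
  rw [rr, show 1 - (3*ee p + p * -(2 * ee p)) = 5 * ee p + p*(2*ee p) by linear_combination -he,
     show (3*ee p + p * -(2 * ee p)) = 3*ee p - p * (2 * ee p) by ring] at r3p
  rw [r1e] at r1p r1
  rw [r3e] at r3p r3
  have hs2 : (-1:ZZ p)^(2*k) = 1 := by rw [pow_mul]; simp
  rw [hs2] at c7 c3 c5
  have hs3 : (-1:ZZ p)^j * (-1:ZZ p)^k = -1 := by
    rw [hkdef, ← pow_add, show j + (j+1) = 2*j+1 by ring, pow_succ, pow_mul]; simp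
  have h8 : (8:ZZ p)^(2*k) = 8 * (8^j * 8^k) := by rw [← pow_add, ← pow_succ']; congr 1; omega
  rw [h8] at c7 c3 c5
  -- abstract
  generalize hs : (-1:ZZ p)^j = s1 at *
  generalize hs' : (-1:ZZ p)^k = s2 at *
  generalize hw : (8:ZZ p)^j * 8^k = w at *
  have hwu : IsUnit w := by
    rw [← hw]; have : IsUnit (8:ZZ p) := unit_of _ (by rw [map_ofNat]; exact eight_ne h2)
    exact (this.pow _).mul (this.pow _)
  generalize (∏ i ∈ Finset.range (2*k), (8*(i:ZZ p)+7)) = Q7 at *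
  generalize (∏ i ∈ Finset.range (2*k), (8*(i:ZZ p)+3)) = Q3 at *
  generalize (∏ i ∈ Finset.range (2*k), (8*(i:ZZ p)+5)) = Q5 at *
  generalize (∏ i ∈ Finset.range j, (8*(i:ZZ p)+9)) = Qa at *
  generalize (∏ i ∈ Finset.range k, (8*((k:ZZ p)+i)+9)) = Qb at *
  have hGp := Gne (p := p) (p * ee p)
  have u1 := Gne (p := p) (ee p)
  have u3 := Gne (p := p) (3*ee p)
  have u5 := Gne (p := p) (5*ee p)
  have u7 := Gne (p := p) (7*ee p)
  have v1 := Gne (p := p) (7*ee p + p*(2*ee p))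
  have v3 := Gne (p := p) (5*ee p + p*(2*ee p))
  generalize Gm p (p * ee p) = gp at *
  generalize Gm p (7*ee p + p*(2*ee p)) = b7 at *
  generalize Gm p (5*ee p + p*(2*ee p)) = b5 at *
  generalize Gm p (3*ee p + p*(2*ee p)) = b3 at *
  generalize Gm p (ee p + p*(2*ee p)) = b1 at *
  generalize Gm p (3*ee p - p*(2*ee p)) = d3 at *
  generalize Gm p (ee p - p*(2*ee p)) = d1 at *
  generalize Gm p (7*ee p) = a7 at *
  generalize Gm p (5*ee p) = a5 at *
  generalize Gm p (3*ee p) = a3 at *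
  generalize Gm p (ee p) = a1 at *
  generalize PP (g0 (ZZ p)) ((p:ZZ p)^2) (4*k) = P at *
  generalize Nr ((p:ZZ p)^2) (4*k) = N at *
  generalize (8:ZZ p)^j = w1 at *
  generalize (8:ZZ p)^k = w2 at *
  -- Qa*Qb
  have hab : b7 * w = - (Qa * Qb) * (ee p * a1) := by
    apply hGp.mul_left_cancel
    rw [← hw]
    linear_combination (gp * w1) * c9' - s2 * Qb * gp * c9 + Qa * Qb * ee p * a1 * gp * hs3
  apply (((hwu.mul hwu).mul v1).mul v3).mul_left_cancel
  have key : P * (Q7 * (Qa*Qb)) * (ee p * a1 * a7 * a3 * a5) = N * Q3 * Q5 * (ee p * a1 * a7 * a3 * a5) := by linear_combination (ee p * a1 * a7 * a3 * a5) * hZ3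
  have k1 : P * (Q7 * (Qa*Qb)) * (ee p * a1 * a7 * a3 * a5) = - P * (b5 * (8*w)) * (b7 * w) * (a3 * a5) := by
    rw [hab, c7]; ring
  have k2 : N * Q3 * Q5 * (ee p * a1 * a7 * a3 * a5) = N * (b1 * (8 * w)) * (b3 * (8*w)) * (ee p * (a1 * a7)) := by
    rw [c3, c5]; ring
  rw [k1, k2] at key
  have u8 : IsUnit (8:ZZ p) := unit_of _ (by rw [map_ofNat]; exact eight_ne h2)
  apply (u8.mul (u3.mul u5)).mul_left_cancel
  linear_combination (-1) * key + (8*N*b1*b3*w^2*(a1*a7)) * (- he) + 8*w^2*N*b1*b3*(a3*a5*d3*b5*r1p + a3*a5*a1*a7*r3p + a1*a7*r3)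
/-- value of the quotient, p = 8k+3 -/
lemma f_three (k : ℕ) (hk : p = 8*k+3) (h3 : 3 < p) :
    PP (g0 (ZZ p)) ((p:ZZ p)^2) (4*k+1) = Nr ((p:ZZ p)^2) (4*k+1) *
      (-(Gm p (ee p + p * (2 * ee p)) * Gm p (ee p - p * (2 * ee p)) * (Gm p (3 * ee p + p * (2 * ee p)) * Gm p (3 * ee p - p*(2 * ee p))))) := by
  have h2 : p ≠ 2 := by omega
  have he := ee_eq (p := p) h2
  have hkpos : 0 < k := by omega
  have hZ := T_odd ℤ (4*k+1) (2*k) (by ring)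
  have hpz : (2*((4*k+1:ℕ):ℤ)+1) = p := by rw [hk]; push_cast; ring
  rw [hpz] at hZ
  have hE2 : E2 ℤ (2*k+1) = p * ((∏ i ∈ Finset.range (2*k+1), (8*(i:ℤ)+5)) * ((∏ i ∈ Finset.range k, (8*(i:ℤ)+3)) *
      ∏ i ∈ Finset.range k, (8*(((k+1:ℕ):ℤ)+i)+3))) := by
    rw [E2, Finset.prod_mul_distrib, show ∏ i ∈ Finset.range (2*k+1), (8*(i:ℤ)+3) = ∏ i ∈ Finset.range ((k+1)+k), (8*(i:ℤ)+3) by congr 2; ring,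
      Finset.prod_range_add (fun i : ℕ => 8*(i:ℤ)+3),
      Finset.prod_range_succ (fun i : ℕ => 8*(i:ℤ)+3) k]
    have : (8*(k:ℤ)+3) = p := by rw [hk]; push_cast; ring
    rw [this]; push_cast; ring
  have hp0 : (p:ℤ) ≠ 0 := by exact_mod_cast hp.out.ne_zero
  have hZ2 : PP (g0 ℤ) ((p:ℤ)^2) (4*k+1) * ((∏ i ∈ Finset.range (2*k+1), (8*(i:ℤ)+5)) * ((∏ i ∈ Finset.range k, (8*(i:ℤ)+3)) *
      ∏ i ∈ Finset.range k, (8*(((k+1:ℕ):ℤ)+i)+3))) = Nr ((p:ℤ)^2) (4*k+1) * ((∏ i ∈ Finset.range (2*k), (8*(i:ℤ)+7)) *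
        ∏ i ∈ Finset.range (2*k), (8*(i:ℤ)+9)) := by
    apply mul_left_cancel₀ hp0
    rw [hE2, E1, Finset.prod_mul_distrib] at hZ
    linear_combination hZ
  have hZ3 := congrArg (Int.castRingHom (ZZ p)) hZ2
  rw [map_mul, map_mul (Int.castRingHom (ZZ p)) (Nr _ _), map_PP0, map_Nr] at hZ3
  simp only [map_mul, map_prod, map_pow] at hZ3
  simp only [eq_intCast, Int.cast_add, Int.cast_mul, Int.cast_natCast, Int.cast_ofNat] at hZ3
  -- gamma
  have c7 := PL h2 7 0 (2*k) (fun i hi => ndvd _ (by omega) (by omega) (by omega))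
  have c9 := PL h2 9 0 (2*k) (fun i hi => ndvd _ (by omega) (by omega) (by omega))
  have c5 := PL h2 5 0 (2*k+1) (fun i hi => ndvd _ (by omega) (by omega) (by omega))
  have c3 := PL h2 3 0 k (fun i hi => ndvd _ (by omega) (by omega) (by omega))
  have c3' := PL h2 3 (k+1) k (fun i hi => ndvd _ (by omega) (by omega) (by omega))
  simp only [Nat.cast_zero, zero_add, add_zero] at c7 c3 c5 c9
  have hkz : (k:ZZ p) = p * ee p - 3 * ee p := by
    have : (p:ZZ p) = 8*k+3 := by
      have := congrArg (Nat.cast : ℕ → ZZ p) hk; push_cast at this ⊢; exact this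
    linear_combination -(k:ZZ p) * he - ee p * this
  push_cast at c7 c3 c5 c9 c3' hZ3
  rw [show (7:ZZ p) * ee p + 2 * k = ee p + p * (2*ee p) by rw [hkz]; ring] at c7
  rw [show (9:ZZ p) * ee p + 2 * k = 3 * ee p + p * (2*ee p) by rw [hkz]; ring] at c9
  rw [show (5:ZZ p) * ee p + (2 * k + 1) = 7 * ee p + p * (2*ee p) by rw [hkz]; linear_combination -he] at c5
  have c3a : (3:ZZ p) * ee p + k = p * ee p := by rw [hkz]; ring
  have c3b : (3:ZZ p) * ee p + (k + 1) = p * ee p + 1 := by rw [hkz]; ring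
  have c3c : (3:ZZ p) * ee p + (k + 1) + k = 5 * ee p + p * (2*ee p) := by rw [hkz]; linear_combination -he
  rw [c3a] at c3
  rw [c3c, c3b, Gm_succ0 h2 _ (by rw [map_mul, pi_p, zero_mul])] at c3'
  have c91 : Gm p (9 * ee p) = - ee p * Gm p (ee p) := by
    rw [show 9 * ee p = ee p + 1 by linear_combination he]
    apply Gm_succ h2
    intro h; have := congrArg (pi p) he
    rw [map_mul, h, map_one, mul_zero] at this
    exact zero_ne_one this
  rw [c91] at c9
  have r1 := rr_sq h2 (ee p)
  have r3 := rr_sq h2 (3 * ee p)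
  have r1p := rr_per h2 (ee p) (p := p) (-(2*ee p))
  have r3p := rr_per h2 (3 * ee p) (p := p) (-(2*ee p))
  have r1e : rr p (ee p) = Gm p (ee p) * Gm p (7 * ee p) := by
    rw [rr]; congr 2; linear_combination -he
  have r3e : rr p (3 * ee p) = Gm p (3 * ee p) * Gm p (5 * ee p) := by
    rw [rr]; congr 2; linear_combination -he
  rw [rr, show 1 - (ee p + p * -(2 * ee p)) = 7 * ee p + p*(2*ee p) by linear_combination -he,
     show (ee p + p * -(2 * ee p)) = ee p - p * (2 * ee p) by ring] at r1p
  rw [rr, show 1 - (3*ee p + p * -(2 * ee p)) = 5 * ee p + p*(2*ee p) by linear_combination -he,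
     show (3*ee p + p * -(2 * ee p)) = 3*ee p - p * (2 * ee p) by ring] at r3p
  rw [r1e] at r1p r1
  rw [r3e] at r3p r3
  have hs2 : (-1:ZZ p)^(2*k) = 1 := by rw [pow_mul]; simp
  have hs21 : (-1:ZZ p)^(2*k+1) = -1 := by rw [pow_succ (-1:ZZ p), pow_mul]; simp
  rw [hs2] at c7 c9
  rw [hs21] at c5
  have hs3 : (-1:ZZ p)^k * (-1:ZZ p)^k = 1 := by
    rw [← pow_add, ← two_mul, hs2]
  have h8 : (8:ZZ p)^(2*k) = 8^k * 8^k := by rw [← pow_add, two_mul]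
  have h81 : (8:ZZ p)^(2*k+1) = 8 * (8^k * 8^k) := by rw [pow_succ (8:ZZ p), h8]; ring
  rw [h8] at c7 c9
  rw [h81] at c5
  -- abstract
  generalize hs' : (-1:ZZ p)^k = s2 at *
  generalize hw : (8:ZZ p)^k * 8^k = w at *
  have hwu : IsUnit w := by
    rw [← hw]; have : IsUnit (8:ZZ p) := unit_of _ (by rw [map_ofNat]; exact eight_ne h2)
    exact (this.pow _).mul (this.pow _)
  generalize (∏ i ∈ Finset.range (2*k), (8*(i:ZZ p)+7)) = Q7 at *
  generalize (∏ i ∈ Finset.range (2*k), (8*(i:ZZ p)+9)) = Q9 at *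
  generalize (∏ i ∈ Finset.range (2*k+1), (8*(i:ZZ p)+5)) = Q5 at *
  generalize (∏ i ∈ Finset.range k, (8*(i:ZZ p)+3)) = Qa at *
  generalize (∏ i ∈ Finset.range k, (8*((k:ZZ p)+1+i)+3)) = Qb at *
  have hGp := Gne (p := p) (p * ee p)
  have u1 := Gne (p := p) (ee p)
  have u7 := Gne (p := p) (7*ee p)
  have v1 := Gne (p := p) (7*ee p + p*(2*ee p))
  have v3 := Gne (p := p) (5*ee p + p*(2*ee p))
  generalize Gm p (p * ee p) = gp at *
  generalize Gm p (7*ee p + p*(2*ee p)) = b7 at *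
  generalize Gm p (5*ee p + p*(2*ee p)) = b5 at *
  generalize Gm p (3*ee p + p*(2*ee p)) = b3 at *
  generalize Gm p (ee p + p*(2*ee p)) = b1 at *
  generalize Gm p (3*ee p - p*(2*ee p)) = d3 at *
  generalize Gm p (ee p - p*(2*ee p)) = d1 at *
  generalize Gm p (7*ee p) = a7 at *
  generalize Gm p (5*ee p) = a5 at *
  generalize Gm p (3*ee p) = a3 at *
  generalize Gm p (ee p) = a1 at *
  generalize PP (g0 (ZZ p)) ((p:ZZ p)^2) (4*k+1) = P at *
  generalize Nr ((p:ZZ p)^2) (4*k+1) = N at *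
  generalize (8:ZZ p)^k = w2 at *
  have hab : b5 * w = - (Qa * Qb) * a3 := by
    apply hGp.mul_left_cancel
    rw [← hw]
    linear_combination (gp * w2) * c3' - s2 * Qb * gp * c3 - Qa * Qb * a3 * gp * hs3
  apply (((hwu.mul hwu).mul v1).mul v3).mul_left_cancel
  have key : P * (Q5 * (Qa*Qb)) * (ee p * a1 * a7 * a3 * a5) = N * (Q7 * Q9) * (ee p * a1 * a7 * a3 * a5) := by linear_combination (ee p * a1 * a7 * a3 * a5) * hZ3
  have k1 : P * (Q5 * (Qa*Qb)) * (ee p * a1 * a7 * a3 * a5) = P * (b7 * (8*w)) * (b5 * w) * (ee p * (a1 * a7)) := by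
    rw [hab, c5]; ring
  have k2 : N * (Q7 * Q9) * (ee p * a1 * a7 * a3 * a5) = - N * (b1 * w) * (b3 * w) * (a3*a5) := by
    rw [c7, c9]; ring
  rw [k1, k2] at key
  apply (u1.mul u7).mul_left_cancel
  linear_combination key - P * b7*b5*w^2*a1*a7*he + w^2*N*b1*b3*(a1*a7*d1*b7*r3p + a1*a7*a3*a5*r1p + a3*a5*r1)

end Gam3
end S5

namespace S5
open Polynomial

section Gam4
variable {p : ℕ} [hp : Fact p.Prime]

lemma LB_iter (h3 : 3 < p) (x : ZZ p) (L : ℕ) (h : ∀ i < L, pi p (x + i) ≠ 0) :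
    p^2 * LB p (x + L) = p^2 * (LB p x - ∑ i ∈ Finset.range L, ((x+i)⁻¹)^2) := by
  induction L with
  | zero => simp
  | succ L ih =>
    have ih := ih (fun i hi => h i (by omega))
    have h1 := LB_succ h3 (x+L) (h L (by omega))
    rw [Nat.cast_succ, ← add_assoc, h1, Finset.sum_range_succ]
    linear_combination ih

lemma S0_eq (h3 : 3 < p) (hp8 : p % 8 = 1 ∨ p % 8 = 3) :
    SS p 0 = -(Gm p (ee p) * Gm p (3 * ee p))^2 := by
  have h2 : p ≠ 2 := by omega
  have he := ee_eq (p := p) h2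
  obtain ⟨n, hn⟩ : ∃ n, p = 2*n+1 := ⟨p/2, by omega⟩
  have hnd : ∀ i < n, ¬ p ∣ 8*i+7 := by
    intro i hi
    apply ndvd4 <;> omega
  have hv := P0_val n hn (by
    intro i hi h0
    apply hnd i hi
    rw [← ZMod.natCast_eq_zero_iff]; push_cast; exact h0)
  have hf : PP (g0 (ZZ p)) ((p:ZZ p)^2) n = Nr ((p:ZZ p)^2) n *
      (-(Gm p (ee p + p * (2 * ee p)) * Gm p (ee p - p * (2 * ee p)) * (Gm p (3 * ee p + p * (2 * ee p)) * Gm p (3 * ee p - p*(2 * ee p))))) := by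
    rcases hp8 with h | h
    · obtain ⟨k, hk⟩ : ∃ k, p = 8*k+1 := ⟨p/8, by omega⟩
      have := f_one k hk h3
      rwa [show 4 * k = n by omega] at this
    · obtain ⟨k, hk⟩ : ∃ k, p = 8*k+3 := ⟨p/8, by omega⟩
      have := f_three k hk h3
      rwa [show 4 * k + 1 = n by omega] at this
  rw [hf, P0_SS n hn, Nr_pp n hn h3] at hv
  have hnz : (n:ZZ p) = 4 * ee p * p - 4 * ee p := by
    have : (p:ZZ p) = 2*n+1 := by
      have := congrArg (Nat.cast : ℕ → ZZ p) hn; push_cast at this ⊢; exact this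
    linear_combination -(n:ZZ p) * he - 4 * ee p * this
  have hne7 : ∀ i < n, pi p (7 * ee p + i) ≠ 0 := by
    intro i hi
    have := pi_lin_ne h2 7 i (hnd i hi)
    push_cast at this; exact this
  have hit := LB_iter h3 (7 * ee p) n hne7
  have hsum : ∑ i ∈ Finset.range n, ((7 * ee p + (i:ZZ p))⁻¹)^2 = 64 * ∑ i ∈ Finset.range n, ((8*(i:ZZ p)+7)⁻¹)^2 := by
    rw [Finset.mul_sum]
    apply Finset.sum_congr rfl
    intro i hi
    have hi := Finset.mem_range.1 hi
    have a1 := uinv _ (hne7 i hi)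
    have a2 := uinv (8*(i:ZZ p)+7) (by
      intro h
      have := hnd i hi
      apply this
      rw [← ZMod.natCast_eq_zero_iff]
      rw [← h, show (8*(i:ZZ p)+7) = ((8*i+7:ℕ):ZZ p) by push_cast; ring, map_natCast])
    have : (7 * ee p + (i:ZZ p))⁻¹ = 8 * (8*(i:ZZ p)+7)⁻¹ := by
      apply (unit_of _ (hne7 i hi)).mul_left_cancel
      linear_combination a1 - a2 - 7 * (8*(i:ZZ p)+7)⁻¹ * he
    rw [this]; ring
  rw [hsum, show 7 * ee p + n = 3 * ee p + p * (4 * ee p) by rw [hnz]; ring, LB_shift h3] at hit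
  have hr := (LA_refl h3 (ee p)).2
  rw [show 1 - ee p = 7 * ee p by linear_combination -he] at hr
  generalize ∑ i ∈ Finset.range n, ((8*(i:ZZ p)+7)⁻¹)^2 = Sg at *
  have g1 := Gm_exp h3 (ee p) (2 * ee p)
  have g2 := Gm_exp h3 (ee p) (-(2 * ee p))
  have g3 := Gm_exp h3 (3*ee p) (2 * ee p)
  have g4 := Gm_exp h3 (3*ee p) (-(2 * ee p))
  rw [mul_neg, ← sub_eq_add_neg] at g2 g4
  rw [g1, g2, g3, g4] at hv
  have hc := p_cube (p := p)
  have hu : IsUnit (1 - 4 * (p:ZZ p)^2 * Sg) := by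
    apply unit_of; rw [map_sub, map_mul, map_mul, map_pow, pi_p, map_one]; simp
  have hN := unit_of _ (Nr_unit (p := p) n hn)
  apply (hN.mul hu).mul_left_cancel
  have e1 : (1 + p*LA p (ee p)*(2*ee p) + p^2*LC p (ee p)*(2*ee p)^2) * (1 + p*LA p (ee p)*(-(2*ee p)) + p^2*LC p (ee p)*(-(2*ee p))^2) = 1 + 4 * p^2*ee p^2 * LB p (ee p) := by
    rw [LB]; linear_combination (16 * LC p (ee p)^2*ee p^4 * p) * hc
  have e3 : (1 + p*LA p (3*ee p)*(2*ee p) + p^2*LC p (3*ee p)*(2*ee p)^2) * (1 + p*LA p (3*ee p)*(-(2*ee p)) + p^2*LC p (3*ee p)*(-(2*ee p))^2) = 1 + 4 * p^2*ee p^2 * LB p (3*ee p) := by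
    rw [LB]; linear_combination (16 * LC p (3*ee p)^2*ee p^4 * p) * hc
  have e2 : (1 + 4 * p^2*ee p^2 * LB p (ee p)) * (1 + 4 * p^2*ee p^2 * LB p (3*ee p)) = 1 - 4 * p^2 * Sg := by
    linear_combination 16 * ee p^4 * LB p (ee p) * LB p (3*ee p) * p * hc + 4 * ee p^2 * (hit + hr) - 4*p^2*Sg*(8*ee p + 1) * he
  rw [← e1, ← e3] at e2
  linear_combination -hv - Nr 0 n * (Gm p (ee p) * Gm p (3 * ee p))^2 * e2

end Gam4
end S5

namespace S5
open Polynomial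

section Gam5
variable {p : ℕ} [hp : Fact p.Prime]

def Gi (p N : ℕ) : ℤ := (-1)^N * ∏ i ∈ Finset.range N, (if p ∣ i then 1 else (i:ℤ))

lemma Gi_cast (N : ℕ) : ((Gi p N : ℤ) : ZZ p) = Gn p N := by
  rw [Gi, Gn]; push_cast
  congr 1

lemma fac_Gi (N : ℕ) : (N.factorial : ℤ) = (-1)^(N+1) * Gi p (N+1) * p^(N/p) * ((N/p).factorial : ℤ) := by
  induction N with
  | zero => simp [Gi]
  | succ N ih =>
    have hG : Gi p (N+1+1) = - (if p ∣ N+1 then 1 else ((N+1:ℕ):ℤ)) * Gi p (N+1) := by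
      rw [Gi, Gi, Finset.prod_range_succ, pow_succ]; ring
    rw [hG, Nat.factorial_succ, Nat.succ_div]
    by_cases h : p ∣ N+1
    · rw [if_pos h, if_pos h, Nat.factorial_succ]
      have : (N+1 : ℤ) = p * ((N/p + 1 : ℕ) : ℤ) := by
        have : N + 1 = p * (N/p+1) := by
          have := Nat.succ_div (a := N) (b := p)
          rw [if_pos h] at this
          rw [← this, Nat.mul_div_cancel' h]
        exact_mod_cast this
      push_cast at this ⊢
      rw [ih]
      linear_combination ((-1)^(N+1) * Gi p (N+1) * p^(N/p) * ((N/p).factorial : ℤ)) * this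
    · rw [if_neg h, if_neg h]; push_cast
      rw [ih]; push_cast; ring

lemma fac_Gi2 (N M K : ℕ) (h : N / p = M) (h' : M / p = K) :
    (N.factorial : ℤ) = (-1)^(N+M) * Gi p (N+1) * Gi p (M+1) * p^(M+K) * (K.factorial : ℤ) := by
  rw [fac_Gi (p := p) N, h, fac_Gi (p := p) M, h']; ring

lemma choose_Gi (b c Mb Mc Kb Kc : ℕ) (h1 : b / p = Mb) (h2 : Mb / p = Kb) (h3 : c / p = Mc)
    (h4 : Mc / p = Kc) (h5 : (b+c)/p = Mb + Mc) (h6 : (Mb+Mc)/p = Kb+Kc) :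
    ((b+c).choose b : ZZ p) * (Gn p (b+1) * Gn p (Mb+1)) * (Gn p (c+1) * Gn p (Mc+1)) =
      (Kb+Kc).choose Kb * (Gn p (b+c+1) * Gn p (Mb+Mc+1)) := by
  have hp0 : (p:ℤ) ≠ 0 := by exact_mod_cast hp.out.ne_zero
  have key : ((b+c).choose b : ℤ) * (Gi p (b+1) * Gi p (Mb+1)) * (Gi p (c+1) * Gi p (Mc+1)) =
      (Kb+Kc).choose Kb * (Gi p (b+c+1) * Gi p (Mb+Mc+1)) := by
    have e1 : ((b+c).choose b : ℤ) * b.factorial * c.factorial = (b+c).factorial := by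
      rw [Nat.choose_symm_add]; exact_mod_cast Nat.add_choose_mul_factorial_mul_factorial b c
    have e2 : ((Kb+Kc).choose Kb : ℤ) * Kb.factorial * Kc.factorial = (Kb+Kc).factorial := by
      rw [Nat.choose_symm_add]; exact_mod_cast Nat.add_choose_mul_factorial_mul_factorial Kb Kc
    rw [fac_Gi2 b Mb Kb h1 h2, fac_Gi2 c Mc Kc h3 h4, fac_Gi2 (b+c) (Mb+Mc) (Kb+Kc) h5 h6, ← e2] at e1
    have hb : (Kb.factorial : ℤ) ≠ 0 := by exact_mod_cast Nat.factorial_ne_zero _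
    have hc : (Kc.factorial : ℤ) ≠ 0 := by exact_mod_cast Nat.factorial_ne_zero _
    have hz : (-1:ℤ)^(b+Mb+c+Mc) * p^(Mb+Kb+Mc+Kc) * Kb.factorial * Kc.factorial ≠ 0 := by
      apply mul_ne_zero (mul_ne_zero (mul_ne_zero _ (pow_ne_zero _ hp0)) hb) hc
      exact pow_ne_zero _ (by norm_num)
    apply mul_left_cancel₀ hz
    have s1 : (-1:ℤ)^(b+c+(Mb+Mc)) = (-1)^(b+Mb+c+Mc) := by congr 1; ring
    have s2 : (p:ℤ)^(Mb+Mc+(Kb+Kc)) = p^(Mb+Kb+Mc+Kc) := by congr 1; ring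
    rw [s1, s2] at e1
    have s3 : (-1:ℤ)^(b+Mb) * (-1)^(c+Mc) = (-1)^(b+Mb+c+Mc) := by rw [← pow_add]; congr 1; ring
    have s4 : (p:ℤ)^(Mb+Kb) * p^(Mc+Kc) = p^(Mb+Kb+Mc+Kc) := by rw [← pow_add]; congr 1; ring
    rw [← s3, ← s4] at *
    linear_combination e1
  have := congrArg (Int.cast : ℤ → ZZ p) key
  push_cast at this
  simp only [Gi_cast] at this
  exact this

/-- truncated polynomials in p -/
def tr (p : ℕ) (a b c : ZZ p) : ZZ p := a + p * b + p^2 * c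

lemma tr_mul (a b c a' b' c' : ZZ p) : tr p a b c * tr p a' b' c' = tr p (a*a') (a*b'+b*a') (a*c'+b*b'+c*a') := by
  simp only [tr]
  linear_combination (b*c'+c*b' + p * c * c') * p_cube (p := p)

lemma tr_add (a b c a' b' c' : ZZ p) : tr p a b c + tr p a' b' c' = tr p (a+a') (b+b') (c+c') := by
  simp only [tr]; ring

lemma tr_smul (k a b c : ZZ p) : k * tr p a b c = tr p (k*a) (k*b) (k*c) := by
  simp only [tr]; ring

end Gam5
end S5

namespace S5
open Polynomial

section Gam6
variable {p : ℕ} [hp : Fact p.Prime]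

def Dp (c : ℕ) : ℕ → ℕ
  | 0 => 1
  | 1 => c
  | _ => c*(c+8)

def Dq (c : ℕ) : ℕ → ℕ
  | 0 => 0
  | 1 => c+8
  | _ => (c+16)*(2*c+8)

lemma lowG (h3 : 3 < p) (c m : ℕ) (hm : m ≤ 2) (h0 : ¬ p ∣ c) (h1 : ¬ p ∣ c+8) (X : ZZ p)
    (hX : X + c * ee p + m = 1 + p^2*(ee p * (c + 8*m))) :
    ee p^m * tr p (Dp c m) 0 (-(Dq c m)) * Gm p X =
      Gm p (1 - c * ee p) * tr p 1 0 (ee p * LA p (1 - c * ee p) * (c+8*m)) := by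
  have h2 : p ≠ 2 := by omega
  have he := ee_eq (p := p) h2
  have hc := p_cube (p := p)
  have hg : Gm p (X + m) = Gm p (1 - c * ee p) * tr p 1 0 (ee p * LA p (1 - c * ee p) * (c+8*m)) := by
    have := Gm_exp h3 (1 - c * ee p) (p * (ee p * (c+8*m)))
    rw [show X + m = 1 - c * ee p + p * (p * (ee p * (c+8*m))) by linear_combination hX, this, tr]
    linear_combination Gm p (1 - c * ee p) * LC p (1 - c * ee p) * (ee p * (c+8*m))^2 * p * hc
  rw [← hg]
  have hne : ∀ i : ℕ, ¬ p ∣ c + 8 * i → pi p (X + m - i - 1) ≠ 0 := by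
    intro i hi h
    apply hi
    rw [← ZMod.natCast_eq_zero_iff]
    have e1 : ((c + 8*i : ℕ) : ZZ p) = - 8 * (X + m - i - 1) + p * (p * (c+8*m)) := by
      push_cast; linear_combination 8 * hX + (p^2*(c+8*m) - (c:ZZ p)) * he
    have := congrArg (pi p) e1
    rw [map_natCast, pi_addp, map_mul, h, mul_zero] at this
    exact this
  rw [Gm_prod h2 X m]
  · interval_cases m
    · simp [Dp, Dq, tr]
    · simp only [Dp, Dq, tr, Finset.prod_range_one]
      push_cast at hX ⊢
      linear_combination Gm p X * hX
    · simp only [Dp, Dq, tr, Finset.prod_range_succ, Finset.prod_range_zero]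
      push_cast at hX ⊢
      have e1 : X = ee p * (-(c+8) + p^2*(c+16)) := by linear_combination hX + he
      have e2 : X + 1 = ee p * (-c + p^2*(c+16)) := by linear_combination hX  - 0 * he
      rw [add_zero, e2]
      generalize Gm p X = gx
      rw [e1]
      linear_combination - gx * ee p^2 * p * (c+16)^2 * hc
  · intro l hl
    have hlm : l = 0 ∧ m = 1 ∨ l = 0 ∧ m = 2 ∨ l = 1 ∧ m = 2 := by omega
    rcases hlm with ⟨rfl, rfl⟩ | ⟨rfl, rfl⟩ | ⟨rfl, rfl⟩
    · have := hne 0 (by simpa using h0)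
      convert this using 2; push_cast; ring
    · have := hne 1 (by simpa using h1)
      convert this using 2; push_cast; ring
    · have := hne 0 (by simpa using h0)
      convert this using 2; push_cast; ring

lemma highG (h3 : 3 < p) (x z : ZZ p) :
    Gm p (x + p * (ee p * z)) = Gm p x * tr p 1 (ee p * LA p x * z) (ee p^2 * LC p x * z^2) := by
  rw [Gm_exp h3 x, tr]; ring

lemma dg (N lo M : ℕ) (h : N = lo + p * M) (hl : lo < p) : N / p = M := by
  rw [h, Nat.add_mul_div_left _ _ hp.out.pos, Nat.div_eq_of_lt hl, zero_add]

lemma tr_inv (X Y q1 q2 d d' : ZZ p) (h : X * (tr p 1 q1 q2 * tr p d 0 (-d')) = Y) :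
    d^2 * X = Y * (tr p 1 (-q1) (q1^2-q2) * tr p d 0 d') := by
  rw [← h]
  have e1 : tr p 1 q1 q2 * tr p 1 (-q1) (q1^2-q2) = 1 := by
    rw [tr_mul, tr]; ring
  have e2 : tr p d 0 (-d') * tr p d 0 d' = d^2 := by
    rw [tr_mul, tr]; ring
  linear_combination -X * tr p d 0 (-d') * tr p d 0 d' * e1 - X * e2

lemma term_val (h3 : 3 < p) (n u v h r m : ℕ) (hrm : r + m ≤ 2)
   (nd : ∀ c ∈ [5,13,4,12,1,9], ¬ p ∣ c)
   (h1 : h = u + p * v) (h4 : 4 * h = n + p * n) (h8 : 8 * h + 1 = p^2) (hv : n + v < p) (hu : n + u < p)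
   (hu2 : 2 ≤ u) (hn2 : 2 ≤ n) (x1 x5 : ZZ p)
   (e1 : (v:ZZ p) + 1 = x1 + p * ee p) (e5 : (n:ZZ p) + v + 1 = x5 + p * (ee p*5)) (e4 : (n:ZZ p) + 1 = 4 * ee p + p * (ee p*4))  :
   ((((4+8*r)*h + (1+8*m)*h).choose ((4+8*r)*h) : ℕ) : ZZ p) * (Gm p (1 - (4:ℕ) * ee p) * Gm p (1 - (1:ℕ) * ee p) * (Gm p (4 * ee p) * Gm p x1)) *
     (tr p 1 0 (ee p * LA p (1 - (4:ℕ) * ee p) * ((4:ℕ)+8*r)) * tr p 1 0 (ee p * LA p (1 - (1:ℕ) * ee p) * ((1:ℕ)+8*m)) *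
      (tr p 1 (ee p * LA p (4 * ee p) * ((4:ℕ)+8*r)) (ee p^2 * LC p (4 * ee p) * ((4:ℕ)+8*r)^2) *
       tr p 1 (ee p * LA p x1 * ((1:ℕ)+8*m)) (ee p^2 * LC p x1 * ((1:ℕ)+8*m)^2)) * tr p (Dp 5 (r+m)) 0 (-(Dq 5 (r+m))))
    = (r+m).choose r * (Gm p (1 - (5:ℕ) * ee p) * Gm p x5) *
      (tr p 1 0 (ee p * LA p (1 - (5:ℕ) * ee p) * ((5:ℕ)+8*(r+m:ℕ))) *
       tr p 1 (ee p * LA p x5 * ((5:ℕ)+8*(r+m:ℕ))) (ee p^2 * LC p x5 * ((5:ℕ)+8*(r+m:ℕ))^2) *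
       (tr p (Dp 4 r) 0 (-(Dq 4 r)) * tr p (Dp 1 m) 0 (-(Dq 1 m)))) := by
  have h2 : p ≠ 2 := by omega
  have he := ee_eq (p := p) h2
  have hc := p_cube (p := p)
  have key := choose_Gi (p := p) ((4+8*r)*h) ((1+8*m)*h) (n+p*r) (v+p*m) r m
    (dg _ (n-r) _ (by zify [show r ≤ n by omega]; zify at h4 h8; linear_combination h4 + r*h8) (by omega))
    (dg _ n _ rfl (by omega))
    (dg _ (u-m) _ (by zify [show m ≤ u by omega]; zify at h1 h8; linear_combination h1 + m*h8) (by omega))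
    (dg _ v _ rfl (by omega))
    (dg _ (n+u-(r+m)) _ (by
      zify [show r+m ≤ n+u by omega]; zify at h1 h4 h8; linear_combination h1 + h4 + (r+m)*h8) (by omega))
    (dg _ (n+v) _ (by ring) (by omega))
  have h8z : 8 * (h:ZZ p) + 1 = p^2 := by
    have := congrArg (Nat.cast : ℕ → ZZ p) h8; push_cast at this ⊢; exact this
  have hz : (h:ZZ p) = ee p * (p^2 - 1) := by linear_combination ee p * h8z - h * he
  rw [← Gm_nat h2, ← Gm_nat h2, ← Gm_nat h2, ← Gm_nat h2, ← Gm_nat h2, ← Gm_nat h2] at key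
  have k1 := lowG h3 4 r (by omega) (nd 4 (by simp)) (nd 12 (by simp)) (((4+8*r)*h+1 : ℕ) : ZZ p) (by
    push_cast; rw [hz]; linear_combination (-r:ZZ p) * he )
  have k2 := lowG h3 1 m (by omega) (nd 1 (by simp)) (nd 9 (by simp)) (((1+8*m)*h+1 : ℕ) : ZZ p) (by
    push_cast; rw [hz]; linear_combination (-m:ZZ p) * he )
  have k3 := lowG h3 5 (r+m) (by omega) (nd 5 (by simp)) (nd 13 (by simp)) (((4+8*r)*h+(1+8*m)*h+1 : ℕ) : ZZ p) (by
    push_cast; rw [hz]; linear_combination (-r-m:ZZ p) * he )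
  have j1 := highG h3 (4 * ee p) (((4:ℕ):ZZ p)+8*r)
  have j2 := highG h3 x1 (((1:ℕ):ZZ p)+8*m)
  have j3 := highG h3 x5 (((5:ℕ):ZZ p)+8*(r+m:ℕ))
  rw [show (4 * ee p) + p * (ee p * (((4:ℕ):ZZ p)+8*r)) = ((n+p*r+1 : ℕ) : ZZ p) by
    push_cast; linear_combination -e4 + p*r*he] at j1
  rw [show x1 + p * (ee p * (((1:ℕ):ZZ p)+8*m)) = ((v+p*m+1 : ℕ) : ZZ p) by
    push_cast; linear_combination -e1 + p*m*he] at j2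
  rw [show x5 + p * (ee p * (((5:ℕ):ZZ p)+8*(r+m:ℕ))) = ((n+p*r+(v+p*m)+1 : ℕ) : ZZ p) by
    push_cast; linear_combination -e5 + p*(r+m)*he] at j3
  rw [j1, j2, j3] at key
  generalize tr p 1 (ee p * LA p (4 * ee p) * ((4:ℕ)+8*r)) (ee p^2 * LC p (4 * ee p) * ((4:ℕ)+8*r)^2) = t1 at *
  generalize tr p 1 (ee p * LA p x1 * ((1:ℕ)+8*m)) (ee p^2 * LC p x1 * ((1:ℕ)+8*m)^2) = t2 at *
  generalize tr p 1 (ee p * LA p x5 * ((5:ℕ)+8*(r+m:ℕ))) (ee p^2 * LC p x5 * ((5:ℕ)+8*(r+m:ℕ))^2) = t3 at *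
  generalize tr p (Dp 4 r) 0 (-(Dq 4 r)) = d1 at *
  generalize tr p (Dp 1 m) 0 (-(Dq 1 m)) = d2 at *
  generalize tr p (Dp 5 (r+m)) 0 (-(Dq 5 (r+m))) = d3 at *
  have hpw : ee p^(r+m) = ee p^r * ee p^m := pow_add _ _ _
  rw [hpw] at k3
  generalize ee p^r = er at *
  generalize ee p^m = em at *
  generalize tr p 1 0 (ee p * LA p (1 - (4:ℕ) * ee p) * ((4:ℕ)+8*r)) = s1 at *
  generalize tr p 1 0 (ee p * LA p (1 - (1:ℕ) * ee p) * ((1:ℕ)+8*m)) = s2 at *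
  generalize tr p 1 0 (ee p * LA p (1 - (5:ℕ) * ee p) * ((5:ℕ)+8*(r+m:ℕ))) = s3 at *
  generalize Gm p (((4+8*r)*h+1 : ℕ) : ZZ p) = y1 at *
  generalize Gm p (((1+8*m)*h+1 : ℕ) : ZZ p) = y2 at *
  generalize Gm p (((4+8*r)*h+(1+8*m)*h+1 : ℕ) : ZZ p) = y3 at *
  generalize Gm p (1 - (4:ℕ) * ee p) = z1 at *
  generalize Gm p (1 - (1:ℕ) * ee p) = z2 at *
  generalize Gm p (1 - (5:ℕ) * ee p) = z3 at *
  generalize ((((4+8*r)*h + (1+8*m)*h).choose ((4+8*r)*h) : ℕ) : ZZ p) = cc at *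
  generalize (((r+m).choose r : ℕ) : ZZ p) = c2 at *
  linear_combination (er * d1 * em * d2 * d3) * key - cc * Gm p (4 * ee p) * t1 * Gm p x1 * t2 * d3 * (z2 * s2 * k1 + er * d1 * y1 * k2) + c2 * Gm p x5 * t3 * d1 * d2 * k3

end Gam6
end S5

namespace S5
open Polynomial

section Gam7
variable {p : ℕ} [hp : Fact p.Prime]

lemma term_inv (X Y a3 a4 a7 A5 C5 A4 C4 A1 C1 α β γ d5 q5 d4 q4 d1 q1 : ZZ p)
  (h : X*(tr p 1 0 (a4*β) * tr p 1 0 (a7*γ) * (tr p 1 (A4*β) (C4*β^2) * tr p 1 (A1*γ) (C1*γ^2)) * tr p d5 0 (-q5)) = Y*(tr p 1 0 (a3*α)*tr p 1 (A5*α) (C5*α^2)*(tr p d4 0 (-q4) * tr p d1 0 (-q1)))) :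
  d5^2 * X = Y * tr p (d5*d4*d1) (d5*d4*d1*(A5*α - A4*β - A1*γ))
    (d5*d4*d1*(a3*α - a4*β - a7*γ + C5*α^2 - A5*α*(A4*β+A1*γ) + (A4*β+A1*γ)^2 - C4*β^2 - C1*γ^2 - A4*A1*β*γ)
      + q5*d4*d1 - d5*(q4*d1+d4*q1)) := by
  have e : tr p 1 0 (a4*β) * tr p 1 0 (a7*γ) * (tr p 1 (A4*β) (C4*β^2) * tr p 1 (A1*γ) (C1*γ^2)) =
     tr p 1 (A4*β+A1*γ) (a4*β+a7*γ+C4*β^2+C1*γ^2+A4*A1*β*γ) := by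
    simp only [tr_mul]; congr 1 <;> ring
  rw [e] at h
  have := tr_inv X _ _ _ _ _ h
  rw [this, mul_assoc]
  congr 1
  simp only [tr_mul]; congr 1 <;> ring

lemma V_eq (h3 : 3 < p) (n u v h : ℕ)
   (nd : ∀ c ∈ [5,13,4,12,1,9], ¬ p ∣ c)
   (h1 : h = u + p * v) (h4 : 4 * h = n + p * n) (h8 : 8 * h + 1 = p^2) (hv : n + v < p) (hu : n + u < p)
   (hu2 : 2 ≤ u) (hn2 : 2 ≤ n) (x1 x5 : ZZ p)
   (e1 : (v:ZZ p) + 1 = x1 + p * ee p) (e5 : (n:ZZ p) + v + 1 = x5 + p * (ee p*5)) (e4 : (n:ZZ p) + 1 = 4 * ee p + p * (ee p*4)) (V : ZZ p)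
   (hV : V = (1 - (p:ZZ p)^2) * (273 * (((5*h).choose (4*h) : ℕ) : ZZ p) - 210 * (((13*h).choose (4*h) : ℕ) + ((13*h).choose (12*h) : ℕ))
      + 65 * (((21*h).choose (4*h) : ℕ) + ((21*h).choose (12*h) : ℕ) + ((21*h).choose (20*h) : ℕ)))) :
   V * (Gm p (4 * ee p) * Gm p (7 * ee p) * (Gm p (4 * ee p) * Gm p x1)) = 128 * (Gm p (3 * ee p) * Gm p x5) := by
  have h2 : p ≠ 2 := by omega
  have he := ee_eq (p := p) h2
  have T := fun r m hrm => term_inv _ _ _ _ _ _ _ _ _ _ _ _ _ _ _ _ _ _ _ _ (term_val h3 n u v h r m hrm nd h1 h4 h8 hv hu hu2 hn2 x1 x5 e1 e5 e4)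
  have t00 := T 0 0 (by norm_num)
  have t10 := T 1 0 (by norm_num)
  have t01 := T 0 1 (by norm_num)
  have t20 := T 2 0 (by norm_num)
  have t11 := T 1 1 (by norm_num)
  have t02 := T 0 2 (by norm_num)
  clear T
  rw [show (4+8*0)*h + (1+8*0)*h = 5*h by ring, show (4+8*0)*h = 4*h by ring] at t00
  rw [show (4+8*1)*h + (1+8*0)*h = 13*h by ring, show (4+8*1)*h = 12*h by ring] at t10
  rw [show (4+8*0)*h + (1+8*1)*h = 13*h by ring, show (4+8*0)*h = 4*h by ring] at t01
  rw [show (4+8*2)*h + (1+8*0)*h = 21*h by ring, show (4+8*2)*h = 20*h by ring] at t20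
  rw [show (4+8*1)*h + (1+8*1)*h = 21*h by ring, show (4+8*1)*h = 12*h by ring] at t11
  rw [show (4+8*0)*h + (1+8*2)*h = 21*h by ring, show (4+8*0)*h = 4*h by ring] at t02
  rw [show (1:ZZ p) - (4:ℕ) * ee p = 4 * ee p by push_cast; linear_combination -he,
    show (1:ZZ p) - (1:ℕ) * ee p = 7 * ee p by push_cast; linear_combination -he,
    show (1:ZZ p) - (5:ℕ) * ee p = 3 * ee p by push_cast; linear_combination -he] at t00 t10 t01 t20 t11 t02
  have v5 := unit_of (5:ZZ p) (by
    rw [map_ofNat, show (5:ZMod p) = (5:ℕ) by norm_num, Ne, ZMod.natCast_eq_zero_iff]; exact nd 5 (by simp))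
  have v13 := unit_of (13:ZZ p) (by
    rw [map_ofNat, show (13:ZMod p) = (13:ℕ) by norm_num, Ne, ZMod.natCast_eq_zero_iff]; exact nd 13 (by simp))
  have v65 : IsUnit ((5:ZZ p)^2*13^2) := (v5.pow 2).mul (v13.pow 2)
  generalize (((5*h).choose (4*h) : ℕ) : ZZ p) = F00 at *
  generalize (((13*h).choose (12*h) : ℕ) : ZZ p) = F10 at *
  generalize (((13*h).choose (4*h) : ℕ) : ZZ p) = F01 at *
  generalize (((21*h).choose (20*h) : ℕ) : ZZ p) = F20 at *
  generalize (((21*h).choose (12*h) : ℕ) : ZZ p) = F11 at *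
  generalize (((21*h).choose (4*h) : ℕ) : ZZ p) = F02 at *
  generalize Gm p (4 * ee p) * Gm p (7 * ee p) * (Gm p (4 * ee p) * Gm p x1) = B at *
  generalize Gm p (3 * ee p) * Gm p x5 = A at *
  generalize ee p * LA p (3 * ee p) = a3 at *
  generalize ee p * LA p (4 * ee p) = A4 at *
  generalize ee p ^ 2 * LC p (4 * ee p) = C4 at *
  generalize ee p * LA p (7 * ee p) = a7 at *
  generalize ee p * LA p x5 = A5 at *
  generalize ee p ^ 2 * LC p x5 = C5 at *
  generalize ee p * LA p x1 = A1 at *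
  generalize ee p ^ 2 * LC p x1 = C1 at *
  clear nd h1 h4 h8 hv hu hu2 hn2 e1 e5 e4
  simp only [Dp, Dq] at t00 t10 t01 t20 t11 t02
  simp only [Nat.choose] at t00 t10 t01 t20 t11 t02
  push_cast at t00 t10 t01 t20 t11 t02
  simp only [tr] at *
  apply v65.mul_left_cancel
  rw [hV]
  have hc := p_cube (p := p)
  generalize (p:ZZ p) = P at *
  linear_combination (exp := 1) (1 - P^2) * (5^2*13^2*273 * t00 - 210*13^2*(t10+t01) + 65 * (t20+t11+t02)) - 540800 * P * A * hc

end Gam7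
end S5

namespace S5
open Polynomial

section Gam8
variable {p : ℕ} [hp : Fact p.Prime]

def VV (p h : ℕ) : ℤ := (1 - (p:ℤ)^2) * (273 * (((5*h).choose (4*h) : ℕ) : ℤ) - 210 * (((13*h).choose (4*h) : ℕ) + ((13*h).choose (12*h) : ℕ))
      + 65 * (((21*h).choose (4*h) : ℕ) + ((21*h).choose (12*h) : ℕ) + ((21*h).choose (20*h) : ℕ)))

lemma rr_ee (h2 : p ≠ 2) (c N : ℕ) (h1 : 1 ≤ N) (hN : N ≤ p) (z : ℤ) (hz : (c:ℤ) = 8*N + p*z) : rr p (c * ee p) = (-1)^N := by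
  have he := ee_eq (p := p) h2
  rw [← rr_val h2 (z * ee p) N h1 hN]
  congr 1
  have : (c:ZZ p) = 8*N+p*z := by
    have := congrArg (Int.cast : ℤ → ZZ p) hz; push_cast at this; exact this
  linear_combination ee p * this + N * he

lemma VV_S0 (h3 : 3 < p) (hp8 : p % 8 = 1 ∨ p % 8 = 3) (h : ℕ) (h8 : 8*h+1 = p^2) :
    ((VV p h : ℤ) : ZZ p) = 128 * SS p 0 := by
  have h2 : p ≠ 2 := by omega
  have he := ee_eq (p := p) h2
  have h11 : 11 ≤ p := by
    have h9 : p ≠ 9 := by rintro rfl; exact absurd hp.out (by norm_num)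
    omega
  have nd : ∀ c ∈ [5,13,4,12,1,9], ¬ p ∣ c := by
    have hpp := hp.out
    intro c hc
    by_cases h17 : p < 14
    · have : p = 11 := by omega
      subst this
      simp at hc; omega
    · intro hd
      have := Nat.le_of_dvd (by simp at hc; omega) hd
      simp at hc; omega
  rw [S0_eq h3 hp8]
  have r1 := rr_sq h2 (ee p)
  have r3 := rr_sq h2 (3 * ee p)
  have r1e : rr p (ee p) = Gm p (ee p) * Gm p (7 * ee p) := by
    rw [rr]; congr 2; linear_combination -he
  have r3e : rr p (3 * ee p) = Gm p (3 * ee p) * Gm p (5 * ee p) := by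
    rw [rr]; congr 2; linear_combination -he
  have r4e : rr p (4 * ee p) = Gm p (4 * ee p) * Gm p (4 * ee p) := by
    rw [rr]; congr 2; linear_combination -he
  rcases hp8 with h' | h'
  · obtain ⟨k, hk⟩ : ∃ k, p = 8*k+1 := ⟨p/8, by omega⟩
    have hkz : 8 * (k:ZZ p) + 1 = p := by
      have := congrArg (Nat.cast : ℕ → ZZ p) hk; push_cast at this ⊢; exact this.symm
    have hh : h = k + p * k := by
      have : 8 * h + 1 = 8 * (k + p*k) + 1 := by
        rw [h8]; zify; zify at hk; linear_combination (p+1:ℤ) * hk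
      omega
    have key := V_eq h3 (4*k) k k h nd hh (by rw [hh]; ring) h8 (by omega) (by omega) (by omega) (by omega)
      (7 * ee p) (3 * ee p) (by linear_combination -k*he + ee p * hkz - he)
      (by push_cast; linear_combination -5*k*he + 5*ee p * hkz - he)
      (by push_cast; linear_combination -4*k*he + 4*ee p * hkz - he) ((VV p h : ℤ) : ZZ p) (by rw [VV]; push_cast; rfl)
    have r4 := rr_ee (p := p) h2 4 (4*k+1) (by omega) (by omega) (-4) (by push_cast; zify at hk; linear_combination 4*hk)
    push_cast at r4
    rw [r4e, pow_succ (-1:ZZ p), pow_mul, show (-1:ZZ p)^4 = 1 by norm_num, one_pow] at r4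
    rw [r1e] at r1
    generalize Gm p (ee p) = a1 at *
    generalize Gm p (3*ee p) = a3 at *
    generalize Gm p (4*ee p) = a4 at *
    generalize Gm p (7*ee p) = a7 at *
    generalize ((VV p h : ℤ) : ZZ p) = V at *
    linear_combination -a1^2*key + V*a7^2*a1^2*r4 - V*r1
  · obtain ⟨k, hk⟩ : ∃ k, p = 8*k+3 := ⟨p/8, by omega⟩
    have hkz : 8 * (k:ZZ p) + 3 = p := by
      have := congrArg (Nat.cast : ℕ → ZZ p) hk; push_cast at this ⊢; exact this.symm
    have hh : h = (3*k+1) + p * k := by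
      have : 8 * h + 1 = 8 * ((3*k+1) + p*k) + 1 := by
        rw [h8]; zify; zify at hk; linear_combination (p+3:ℤ) * hk
      omega
    have key := V_eq h3 (4*k+1) (3*k+1) k h nd hh (by rw [hh]; zify; zify at hk; linear_combination -hk) h8 (by omega) (by omega) (by omega) (by omega)
      (5 * ee p) (ee p) (by linear_combination -k*he + ee p * hkz - he)
      (by push_cast; linear_combination -5*k*he + 5*ee p * hkz - 2*he)
      (by push_cast; linear_combination -4*k*he + 4*ee p * hkz - 2*he) ((VV p h : ℤ) : ZZ p) (by rw [VV]; push_cast; rfl)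
    have r4 := rr_ee (p := p) h2 4 (4*k+2) (by omega) (by omega) (-4) (by push_cast; zify at hk; linear_combination 4*hk)
    have q1 := rr_ee (p := p) h2 1 (5*k+2) (by omega) (by omega) (-5) (by push_cast; zify at hk; linear_combination 5*hk)
    have q3 := rr_ee (p := p) h2 3 (7*k+3) (by omega) (by omega) (-7) (by push_cast; zify at hk; linear_combination 7*hk)
    push_cast at r4 q1 q3
    rw [r4e, show 4*k+2 = 2*(2*k+1) by ring, pow_mul, show (-1:ZZ p)^2 = 1 by norm_num, one_pow] at r4
    rw [one_mul, r1e] at q1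
    rw [r3e] at q3
    have q13 : (-1:ZZ p)^(5*k+2) * (-1:ZZ p)^(7*k+3) = -1 := by
      rw [← pow_add, show 5*k+2+(7*k+3) = 2*(6*k+2)+1 by ring, pow_succ (-1:ZZ p), pow_mul]; simp
    rw [← q1, ← q3] at q13
    generalize Gm p (ee p) = a1 at *
    generalize Gm p (3*ee p) = a3 at *
    generalize Gm p (4*ee p) = a4 at *
    generalize Gm p (5*ee p) = a5 at *
    generalize Gm p (7*ee p) = a7 at *
    generalize ((VV p h : ℤ) : ZZ p) = V at *
    linear_combination -a1*a3*key + V*a1*a3*a5*a7*r4 + V*q13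

end Gam8
end S5

namespace S5
open Finset

section Jac
variable {F R : Type*} [Field F] [Fintype F] [DecidableEq F] [CommRing R] [IsDomain R]

lemma jac_refl (α β : MulChar F R) : jacobiSum α β = β (-1) * jacobiSum (α⁻¹ * β⁻¹) β := by
  rw [jacobiSum, jacobiSum, Finset.mul_sum]
  have h0 : ∀ γ δ : MulChar F R, γ (0:F) * δ (1 - (0:F)) = 0 := by
    intro γ δ; rw [MulChar.map_zero, zero_mul]
  apply Fintype.sum_equiv (Equiv.inv F)
  intro t
  by_cases ht : t = 0
  · subst ht
    simp only [Equiv.inv_apply, inv_zero]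
    rw [h0, h0, mul_zero]
  · simp only [Equiv.inv_apply, MulChar.mul_apply, MulChar.inv_apply', inv_inv]
    rw [show β (-1) * (α t * β t * β (1 - t⁻¹)) = α t * (β (-1) * β t * β (1-t⁻¹)) by ring]
    rw [← map_mul, ← map_mul]
    congr 2
    field_simp; ring

lemma jac_eq (χ : MulChar F R) (h8 : χ^8 = 1) : jacobiSum (χ^4) χ = jacobiSum (χ^4) (χ^3) := by
  have e1 := jac_refl χ (χ^3)
  have e2 := jac_refl (χ^3) χ
  rw [jacobiSum_comm] at e1
  rw [e1] at e2
  have k1 : χ⁻¹ * (χ^3)⁻¹ = χ^4 := by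
    rw [← mul_inv, inv_eq_iff_mul_eq_one]; rw [← h8]; group
  have k2 : (χ^3)⁻¹ * χ⁻¹ = χ^4 := by
    rw [← mul_inv, inv_eq_iff_mul_eq_one]; rw [← h8]; group
  rw [k1, k2] at e2
  have hu : (χ (-1)) * χ (-1) = 1 := by rw [← map_mul]; simp
  have hs : (χ^3) (-1) = χ (-1) := by
    rw [MulChar.pow_apply' _ (by norm_num)]
    linear_combination χ (-1) * hu
  rw [hs] at e2
  have := congrArg (χ (-1) * ·) e2
  simp only [← mul_assoc, hu, one_mul] at this
  exact this.symm

lemma quad_eq (hq : ringChar F ≠ 2) (φ : MulChar F R) (h2 : φ^2 = 1) (h1 : φ ≠ 1) (t : F) :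
    φ t = (quadraticChar F t : ℤ) := by
  obtain ⟨g, hg⟩ := IsCyclic.exists_generator (α := Fˣ)
  have hsq : ∀ y : F, y ≠ 0 → φ y ^ 2 = 1 := by
    intro y hy
    have := congrArg (fun f : MulChar F R => f y) h2
    rw [MulChar.pow_apply' _ (by norm_num), MulChar.one_apply hy.isUnit] at this
    exact this
  by_cases ht : t = 0
  · subst ht; rw [MulChar.map_zero]; simp
  by_cases hs : IsSquare t
  · rw [(quadraticChar_one_iff_isSquare ht).2 hs]
    obtain ⟨y, rfl⟩ := hs
    have hy : y ≠ 0 := by rintro rfl; simp at ht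
    rw [map_mul, ← pow_two, hsq y hy]; simp
  · rw [quadraticChar_neg_one_iff_not_isSquare.2 hs]
    have hg1 : φ g ≠ 1 := by
      intro h
      apply h1
      rw [MulChar.eq_iff hg, h]; simp
    have hgm : φ g = -1 := by
      have := hsq g (Units.ne_zero g)
      have h0 : (φ g - 1) * (φ g + 1) = 0 := by linear_combination this
      rcases mul_eq_zero.1 h0 with h | h
      · exact absurd (sub_eq_zero.1 h) hg1
      · exact eq_neg_of_add_eq_zero_left h
    obtain ⟨m, hm⟩ := (mem_powers_iff_mem_zpowers.2 (hg (Units.mk0 t ht)))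
    have htm : t = (g:F)^m := by
      have := congrArg (Units.val) hm; simpa using this.symm
    rw [htm, map_pow, hgm]
    have : Odd m := by
      rw [← Nat.not_even_iff_odd]; rintro ⟨l, rfl⟩
      exact hs ⟨(g:F)^l, by rw [htm, pow_add]⟩
    rw [this.neg_one_pow]; simp

lemma jac_y (hq : ringChar F ≠ 2) (φ χ : MulChar F R) (h2 : φ^2 = 1) (h1 : φ ≠ 1) (hχ : χ ≠ 1) :
    jacobiSum φ χ = ∑ y : F, χ (1 - y^2) := by
  have e : ∑ y : F, χ (1 - y^2) = ∑ t : F, (φ t + 1) * χ (1 - t) := by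
    have hc : ∀ t : F, (φ t + 1 : R) = (#{y : F | y^2 = t} : R) := by
      intro t
      have := quadraticChar_card_sqrts hq t
      rw [quad_eq hq φ h2 h1]
      have h := congrArg (Int.cast : ℤ → R) this
      push_cast at h
      rw [← h]
      congr 2
      ext y; simp
    simp_rw [hc]
    rw [← Finset.sum_fiberwise (s := univ) (g := fun y : F => y^2)]
    apply Finset.sum_congr rfl
    intro t _
    rw [Finset.sum_congr rfl (g := fun _ => χ (1 - t))]
    · rw [Finset.sum_const, nsmul_eq_mul]
    · intro y hy
      simp at hy; rw [hy]
  rw [e]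
  simp_rw [add_mul, one_mul]
  rw [Finset.sum_add_distrib]
  have : ∑ t : F, χ (1 - t) = 0 := by
    rw [← MulChar.sum_eq_zero_of_ne_one hχ]
    exact Fintype.sum_equiv (Equiv.subLeft 1) _ _ (fun t => rfl)
  rw [this, add_zero]; rfl

end Jac
end S5

namespace S5
open Finset

section Jac2
variable {F R : Type*} [Field F] [Fintype F] [DecidableEq F] [CommRing R] [IsDomain R] [CharZero R]

lemma jac_prod (φ χ : MulChar F R) (hφ : φ ≠ 1) (hχ : χ ≠ 1) (h : φ * χ ≠ 1) :
    jacobiSum φ χ * jacobiSum φ⁻¹ χ⁻¹ = (Fintype.card F : R) := by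
  have hinj : Function.Injective (algebraMap R (FractionRing R)) := IsFractionRing.injective R (FractionRing R)
  haveI : CharZero (FractionRing R) := charZero_of_injective_algebraMap hinj
  apply hinj
  rw [map_mul, ← jacobiSum_ringHomComp, ← jacobiSum_ringHomComp, ← MulChar.ringHomComp_inv,
    ← MulChar.ringHomComp_inv, jacobiSum_mul_jacobiSum_inv]
  · simp
  · rw [ringChar.eq_zero]
    exact fun h => (CharP.ringChar_ne_zero_of_finite F) h.symm
  · exact (MulChar.ringHomComp_ne_one_iff hinj).mpr hφ
  · exact (MulChar.ringHomComp_ne_one_iff hinj).mpr hχ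
  · rw [← MulChar.ringHomComp_mul]
    exact (MulChar.ringHomComp_ne_one_iff hinj).mpr h

open Classical in
lemma jac_main (hq : Fintype.card F % 8 = 1) (χ : MulChar F R) (h8 : χ^8 = 1) (h4 : χ^4 ≠ 1) :
    ∃ (A B : ℤ) (θ : R), θ^2 = -2 ∧ jacobiSum (χ^4) χ = A + B*θ ∧
      A^2 + 2*B^2 = (Fintype.card F : ℤ) ∧ A % 4 = 3 := by
  have hc2 : ringChar F ≠ 2 := by
    intro h
    have := FiniteField.even_card_iff_char_two.1 h
    omega
  obtain ⟨g, hg⟩ := IsCyclic.exists_generator (α := Fˣ)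
  set ζ : R := χ g with hζ
  have z8 : ζ^8 = 1 := by
    have := congrArg (fun f : MulChar F R => f g) h8
    rw [MulChar.pow_apply' _ (by norm_num), MulChar.one_apply g.isUnit] at this
    exact this
  have z4' : ζ^4 ≠ 1 := by
    intro h
    apply h4
    rw [MulChar.eq_iff hg, MulChar.pow_apply' _ (by norm_num), ← hζ, h, MulChar.one_apply g.isUnit]
  have z4 : ζ^4 = -1 := by
    have h0 : (ζ^4 - 1) * (ζ^4 + 1) = 0 := by linear_combination z8
    rcases mul_eq_zero.1 h0 with h | h
    · exact absurd (sub_eq_zero.1 h) z4'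
    · exact eq_neg_of_add_eq_zero_left h
  have hz0 : ζ ≠ 0 := by
    intro h; rw [h] at z8; simp at z8
  have hprim : IsPrimitiveRoot ζ 8 := by
    have := IsPrimitiveRoot.iff_orderOf (ζ := ζ) (k := 8)
    rw [this]
    exact orderOf_eq_prime_pow (p := 2) (n := 2) (by norm_num; exact z4') (by norm_num; exact z8)
  have hval : ∀ u : F, u ≠ 0 → ∃ m < 8, χ u = ζ^m := by
    intro u hu
    obtain ⟨m, hm⟩ := (mem_powers_iff_mem_zpowers.2 (hg (Units.mk0 u hu)))
    have htm : u = (g:F)^m := by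
      have := congrArg (Units.val) hm; simpa using this.symm
    refine ⟨m % 8, Nat.mod_lt _ (by norm_num), ?_⟩
    rw [htm, map_pow, ← hζ]
    conv_lhs => rw [← Nat.div_add_mod m 8, pow_add, pow_mul, z8, one_pow, one_mul]
  let N : ℕ → ℕ := fun j => #{y : F | χ (1 - y^2) = ζ^j}
  have hsum : ∀ i : ℕ, i ≠ 0 → ∑ y : F, (χ (1 - y^2))^i = ∑ j ∈ range 8, (N j : R) * ζ^(i*j) := by
    intro i hi
    have : ∀ y : F, (χ (1-y^2))^i = ∑ j ∈ range 8, if χ (1-y^2) = ζ^j then ζ^(i*j) else 0 := by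
      intro y
      by_cases hy : 1 - y^2 = 0
      · rw [hy, MulChar.map_zero, zero_pow hi]
        symm
        apply Finset.sum_eq_zero
        intro j _
        rw [if_neg]
        exact (pow_ne_zero _ hz0).symm
      · obtain ⟨m, hm, e⟩ := hval _ hy
        rw [e, Finset.sum_eq_single m]
        · rw [if_pos rfl, ← pow_mul, mul_comm]
        · intro j hj hjm
          rw [if_neg]
          intro h
          exact hjm (hprim.pow_inj (mem_range.1 hj) hm h.symm)
        · intro h; exact absurd (mem_range.2 hm) h
    simp_rw [this]
    rw [Finset.sum_comm]
    apply Finset.sum_congr rfl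
    intro j _
    rw [← Finset.sum_filter, Finset.sum_const, nsmul_eq_mul]
  have hχ1 : χ ≠ 1 := by
    rintro rfl; simp at h4
  have h42 : (χ^4)^2 = 1 := by rw [← pow_mul]; exact h8
  have hne : ∀ i : ℕ, i % 2 = 1 → χ^i ≠ 1 := by
    intro i hi h
    apply h4
    have : χ^4 = (χ^i)^4 := by
      rw [← pow_mul]
      obtain ⟨l, rfl⟩ : ∃ l, i = 2*l+1 := ⟨i/2, by omega⟩
      rw [show (2*l+1)*4 = 8*l+4 by ring, pow_add, pow_mul, h8, one_pow, one_mul]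
    rw [this, h, one_pow]
  have hJ : ∀ i : ℕ, i % 2 = 1 → jacobiSum (χ^4) (χ^i) = ∑ j ∈ range 8, (N j : R) * ζ^(i*j%8) := by
    intro i hi
    have hmod : ∀ m : ℕ, ζ^(m%8) = ζ^m := by
      intro m
      conv_rhs => rw [← Nat.div_add_mod m 8, pow_add, pow_mul, z8, one_pow, one_mul]
    simp_rw [hmod]
    rw [jac_y hc2 (χ^4) (χ^i) h42 h4 (hne i hi), ← hsum i (by omega)]
    apply Finset.sum_congr rfl
    intro y _
    rw [MulChar.pow_apply' _ (by omega)]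
  have J1 := hJ 1 (by norm_num)
  have J3 := hJ 3 (by norm_num)
  have J7 := hJ 7 (by norm_num)
  rw [← jac_eq χ h8] at J3
  rw [pow_one] at J1
  rw [J1] at J3
  simp only [Finset.sum_range_succ, Finset.sum_range_zero] at J1 J3 J7
  norm_num at J1 J3 J7
  have z5 : ζ^5 = -ζ := by linear_combination ζ * z4
  have z6 : ζ^6 = -ζ^2 := by linear_combination ζ^2 * z4
  have z7 : ζ^7 = -ζ^3 := by linear_combination ζ^3 * z4
  rw [z4, z5, z6, z7] at J1 J3 J7
  have hpar : ∀ j, j ≠ 0 → j < 8 → Even (N j) := by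
    intro j hj hj8
    have : ((N j : ℕ) : ZMod 2) = 0 := by
      have h : ∑ y ∈ ({y : F | χ (1 - y^2) = ζ^j} : Finset F), (1 : ZMod 2) = 0 := by
        apply Finset.sum_involution (fun y _ => -y)
        · intro y _; decide
        · intro y hy _ h
          have : y = 0 := by
            have h2 : (2:F) ≠ 0 := Ring.two_ne_zero hc2
            have : 2 * y = 0 := by linear_combination -h
            simpa [h2] using this
          subst this
          simp at hy
          have := hprim.pow_inj (i := 0) (j := j) (by norm_num) hj8 (by simpa using hy)
          exact hj this.symm
        · intro y _; simp
        · intro y hy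
          simpa using hy
      simpa [N] using h
    exact (ZMod.natCast_eq_zero_iff_even).1 this
  have htot : (∑ j ∈ range 8, N j) + 2 = Fintype.card F := by
    have h := hsum 8 (by norm_num)
    have e1 : ∀ y : F, (χ (1-y^2))^8 = 1 - (if y = 1 then 1 else 0) - (if y = -1 then 1 else 0) := by
      intro y
      have h11 : (1:F) ≠ -1 := by
        intro h
        exact Ring.two_ne_zero hc2 (by linear_combination h)
      by_cases h1 : y = 1
      · subst h1; rw [if_pos rfl, if_neg h11]; simp [MulChar.map_zero]
      by_cases h2 : y = -1
      · subst h2; rw [if_pos rfl, if_neg h11.symm]; simp [MulChar.map_zero]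
      have : 1 - y^2 ≠ 0 := by
        intro h
        have : (y-1)*(y+1) = 0 := by linear_combination -h
        rcases mul_eq_zero.1 this with h | h
        · exact h1 (sub_eq_zero.1 h)
        · exact h2 (eq_neg_of_add_eq_zero_left h)
      obtain ⟨m, hm, e⟩ := hval _ this
      rw [e, if_neg h1, if_neg h2, ← pow_mul, mul_comm, pow_mul, z8]; simp
    simp_rw [e1] at h
    rw [Finset.sum_sub_distrib, Finset.sum_sub_distrib] at h
    simp only [Finset.sum_const, Finset.card_univ, Finset.sum_ite_eq', Finset.mem_univ, if_true, pow_mul, z8, one_pow, mul_one, nsmul_eq_mul] at h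
    have : ((∑ j ∈ range 8, N j + 2 : ℕ) : R) = (Fintype.card F : ℕ) := by
      push_cast
      linear_combination -h
    exact_mod_cast this
  simp only [Finset.sum_range_succ, Finset.sum_range_zero] at htot
  have hzz : ((N 1 - N 5 - (N 3 - N 7) : ℤ) : R)^2 + 2 * ((N 2 - N 6 : ℤ) : R)^2 = 0 := by
    push_cast
    have h0 : ((N 1:R) - N 5 - (N 3 - N 7)) * (1 - ζ^2) + 2 * (N 2 - N 6) * ζ = 0 := by
      apply mul_left_cancel₀ hz0
      linear_combination J3
    have : ζ^2 * (((N 1:R) - N 5 - (N 3 - N 7))^2 + 2 * (N 2 - N 6)^2) = 0 := by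
      apply mul_left_cancel₀ (two_ne_zero' R)
      linear_combination -(((N 1:R) - N 5 - (N 3 - N 7)) * (1 - ζ^2) - 2 * (N 2 - N 6) * ζ) * h0 + ((N 1:R) - N 5 - (N 3 - N 7))^2 * z4
    exact (mul_eq_zero.1 this).resolve_left (pow_ne_zero _ hz0)
  have hzz' : ((N 1 - N 5 - (N 3 - N 7) : ℤ))^2 + 2 * ((N 2 - N 6 : ℤ))^2 = 0 := by
    exact_mod_cast hzz
  have hb : (N 1 - N 5 : ℤ) = N 3 - N 7 := by
    nlinarith [sq_nonneg (N 1 - N 5 - (N 3 - N 7) : ℤ), sq_nonneg (N 2 - N 6 : ℤ)]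
  have hcc : (N 2 : ℤ) = N 6 := by
    nlinarith [sq_nonneg (N 1 - N 5 - (N 3 - N 7) : ℤ), sq_nonneg (N 2 - N 6 : ℤ)]
  have hbR : (N 1 - N 5 : R) = N 3 - N 7 := by exact_mod_cast congrArg (Int.cast : ℤ → R) hb
  have hcR : (N 2 : R) = N 6 := by exact_mod_cast congrArg (Int.cast : ℤ → R) hcc
  have hθ : (ζ + ζ^3)^2 = -2 := by
    linear_combination (2 + ζ^2) * z4
  have hA : jacobiSum (χ^4) χ = ((N 0 - N 4 : ℤ) : R) + ((N 1 - N 5 : ℤ) : R) * (ζ + ζ^3) := by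
    rw [J1]
    push_cast
    linear_combination ζ^2 * hcR - ζ^3 * hbR
  have hA7 : jacobiSum (χ^4) (χ^7) = ((N 0 - N 4 : ℤ) : R) - ((N 1 - N 5 : ℤ) : R) * (ζ + ζ^3) := by
    rw [J7]
    push_cast
    linear_combination -ζ^2 * hcR + ζ * hbR
  refine ⟨N 0 - N 4, N 1 - N 5, ζ + ζ^3, hθ, hA, ?_, ?_⟩
  · have hp := jac_prod (χ^4) χ h4 hχ1 (by rw [← pow_succ]; exact hne 5 (by norm_num))
    rw [show (χ^4)⁻¹ = χ^4 by rw [inv_eq_iff_mul_eq_one, ← pow_add, h8],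
      show χ⁻¹ = χ^7 by rw [inv_eq_iff_mul_eq_one, ← pow_succ', h8], hA, hA7] at hp
    have : (((N 0 - N 4 : ℤ)^2 + 2 * (N 1 - N 5 : ℤ)^2 : ℤ) : R) = ((Fintype.card F : ℤ) : R) := by
      rw [Int.cast_natCast, ← hp]
      push_cast
      linear_combination ((N 1:R) - N 5)^2 * hθ
    exact_mod_cast this
  · obtain ⟨a1, h1⟩ := hpar 1 (by norm_num) (by norm_num)
    obtain ⟨a4, h4⟩ := hpar 4 (by norm_num) (by norm_num)
    obtain ⟨a5, h5⟩ := hpar 5 (by norm_num) (by norm_num)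
    obtain ⟨a6, h6⟩ := hpar 6 (by norm_num) (by norm_num)
    obtain ⟨a7, h7⟩ := hpar 7 (by norm_num) (by norm_num)
    omega

end Jac2
end S5

namespace S5
open Finset

section Witt
variable {p : ℕ} [hp : Fact p.Prime] {F : Type*} [Field F] [Fintype F] [DecidableEq F] [CharP F p]

local notation "WW" => WittVector p F

lemma W_dvd (x : WW) (h : x.coeff 0 = 0) : (p : WW) ∣ x := by
  have := (WittVector.mem_span_p_iff_coeff_zero_eq_zero (p := p) x).2 h
  exact Ideal.mem_span_singleton.1 this

lemma W_int1 (n : ℤ) (h : (p : WW) ∣ (n : WW)) : (p : ℤ) ∣ n := by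
  obtain ⟨c, hc⟩ := h
  have := congrArg (WittVector.constantCoeff (p := p) (R := F)) hc
  rw [map_mul, map_intCast, map_natCast, CharP.cast_eq_zero, zero_mul] at this
  exact (CharP.intCast_eq_zero_iff F p n).1 this

lemma W_int (r : ℕ) (n : ℤ) (h : (p : WW)^r ∣ (n : WW)) : (p : ℤ)^r ∣ n := by
  induction r generalizing n with
  | zero => simp
  | succ r ih =>
    obtain ⟨m, rfl⟩ := W_int1 (F := F) n (dvd_trans (dvd_pow_self _ (by omega)) h)
    rw [pow_succ']
    apply mul_dvd_mul_left
    apply ih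
    push_cast at h
    rw [pow_succ'] at h
    exact (mul_dvd_mul_iff_left (WittVector.p_nonzero p F)).1 h

instance W_char : CharZero WW := by
  have : ∀ n : ℕ, (n : WW) = 0 → n = 0 := by
    intro n hn
    by_contra h0
    have h : ((p:ℤ)^n) ∣ (n : ℤ) := by
      apply W_int (F := F)
      simp [hn]
    have h2 : p^n ∣ n := by exact_mod_cast h
    have := Nat.le_of_dvd (by omega) h2
    have := Nat.lt_pow_self (n := n) hp.out.one_lt
    omega
  exact charZero_of_inj_zero this

local notation "ω" => WittVector.teichmuller p (R := F)

lemma om_inj {a b : F} (h : ω a = ω b) : a = b := by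
  have := congrArg (fun x : WW => x.coeff 0) h
  simpa [WittVector.teichmuller_coeff_zero] using this

lemma om_zero : ω (0:F) = 0 := WittVector.teichmuller_zero p

lemma poly_dvd (p U : WW) (h : p ∣ U - 1) : p^3 ∣ 273*U^5 - 210*U^13 + 65*U^21 - 128 := by
  have : 273*U^5 - 210*U^13 + 65*U^21 - 128 = (U-1)^3 * (128+384*U+768*U^2+1280*U^3+1920*U^4+2415*U^5+2765*U^6+2970*U^7+3030*U^8+2945*U^9+2715*U^10+2340*U^11+1820*U^12+1365*U^13+975*U^14+650*U^15+390*U^16+195*U^17+65*U^18) := by ring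
  rw [this]
  exact Dvd.dvd.mul_right (pow_dvd_pow_of_dvd h 3) _

lemma om_sum (h m : ℕ) (hF : Fintype.card F = 8*h+1) (hm : 0 < m) :
    ∑ t : F, (ω t)^m = if 8*h ∣ m then (8*h : WW) else 0 := by
  split_ifs with hd
  · obtain ⟨l, rfl⟩ := hd
    have : ∀ t : F, (ω t)^(8*h*l) = 1 - if t = 0 then 1 else 0 := by
      intro t
      split_ifs with h0
      · rw [h0, om_zero, zero_pow hm.ne']; simp
      · rw [← map_pow, pow_mul, show 8*h = Fintype.card F - 1 by omega, FiniteField.pow_card_sub_one_eq_one t h0]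
        simp
    simp_rw [this]
    rw [Finset.sum_sub_distrib]
    simp [hF]
  · obtain ⟨g, hg⟩ := IsCyclic.exists_generator (α := Fˣ)
    have hgm : ω (g:F)^m ≠ 1 := by
      intro h1
      rw [← map_pow, ← map_one (ω)] at h1
      have h2 := om_inj h1
      have h3 : g^m = 1 := by ext; simpa using h2
      have h4 := orderOf_dvd_of_pow_eq_one h3
      rw [orderOf_eq_card_of_forall_mem_zpowers hg, Nat.card_units, Nat.card_eq_fintype_card, hF] at h4
      exact hd h4
    have e : ∑ t : F, (ω t)^m = ω (g:F)^m * ∑ t : F, (ω t)^m := by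
      rw [Finset.mul_sum]
      symm
      apply Fintype.sum_equiv (Equiv.mulLeft₀ (g:F) (Units.ne_zero g))
      intro t
      simp [mul_pow]
    have : (ω (g:F)^m - 1) * ∑ t : F, (ω t)^m = 0 := by linear_combination -e
    exact (mul_eq_zero.1 this).resolve_left (sub_ne_zero.2 hgm)

lemma om_K (h a : ℕ) (h0 : 0 < h) (hF : Fintype.card F = 8*h+1) :
    ∑ t : F, (ω t)^(4*h) * (1 - ω t)^((8*a+5)*h) =
      8*h * ∑ j ∈ range (a+1), (((8*a+5)*h).choose ((8*j+4)*h) : WW) := by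
  have e : ∀ t : F, (ω t)^(4*h) * (1 - ω t)^((8*a+5)*h) =
      ∑ i ∈ range ((8*a+5)*h+1), (-1)^i * (((8*a+5)*h).choose i : WW) * (ω t)^(4*h+i) := by
    intro t
    rw [show (1 - ω t) = (-ω t + 1) by ring, add_pow, Finset.mul_sum]
    apply Finset.sum_congr rfl
    intro i _
    rw [neg_pow, one_pow, pow_add]; ring
  simp_rw [e]
  rw [Finset.sum_comm]
  simp_rw [← Finset.mul_sum]
  have e2 : ∀ i, ∑ t : F, (ω t)^(4*h+i) = if 8*h ∣ 4*h+i then (8*h : WW) else 0 :=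
    fun i => om_sum h _ hF (by omega)
  simp_rw [e2, mul_ite, mul_zero]
  rw [← Finset.sum_filter, Finset.mul_sum]
  symm
  apply Finset.sum_bij (fun j _ => (8*j+4)*h)
  · intro j hj
    rw [mem_range] at hj
    rw [mem_filter, mem_range]
    constructor
    · have : (8*j+4)*h ≤ (8*a+5)*h := Nat.mul_le_mul_right _ (by omega)
      omega
    · exact ⟨j+1, by ring⟩
  · intro i _ j _ hij
    have := Nat.eq_of_mul_eq_mul_right h0 hij
    omega
  · intro i hi
    rw [mem_filter, mem_range] at hi
    obtain ⟨h1, l, hl⟩ := hi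
    have hl0 : l ≠ 0 := by rintro rfl; omega
    obtain ⟨j, rfl⟩ := Nat.exists_eq_succ_of_ne_zero hl0
    have hi : i = (8*j+4)*h := by rw [Nat.succ_eq_add_one] at hl; nlinarith
    refine ⟨j, ?_, hi.symm⟩
    rw [mem_range]
    by_contra hc
    have : (8*(a+1)+4)*h ≤ (8*j+4)*h := Nat.mul_le_mul_right _ (by omega)
    nlinarith
  · intro j _
    have : (-1:WW)^((8*j+4)*h) = 1 := Even.neg_one_pow ⟨(4*j+2)*h, by ring⟩
    rw [this]; ring

lemma om_cong (h : ℕ) (h0 : 0 < h) (hF : Fintype.card F = 8*h+1) (t : F) :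
    (p : WW)^3 ∣ 273 * (1 - ω t)^(5*h) - 210 * (1 - ω t)^(13*h) + 65 * (1 - ω t)^(21*h) - 128 * ω (1-t)^(5*h) := by
  by_cases ht : t = 1
  · subst ht
    simp [om_zero, h0.ne']
  have hu : 1 - t ≠ 0 := fun h => ht (sub_eq_zero.1 h).symm
  set w := ω (1-t) with hw
  have hw1 : w * ω (1-t)⁻¹ = 1 := by
    rw [hw, ← map_mul, mul_inv_cancel₀ hu, map_one]
  obtain ⟨β, hβ⟩ : (p : WW) ∣ (1 - ω t) - w := by
    apply W_dvd
    rw [← WittVector.constantCoeff_apply, map_sub, map_sub, map_one]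
    rw [WittVector.constantCoeff_apply, WittVector.constantCoeff_apply, hw, WittVector.teichmuller_coeff_zero, WittVector.teichmuller_coeff_zero]
    ring
  have hz : 1 - ω t = w * (1 + p * (ω (1-t)⁻¹ * β)) := by
    linear_combination hβ - p * β * hw1
  set V := 1 + p * (ω (1-t)⁻¹ * β) with hV
  have hU : (p : WW) ∣ V^h - 1 := by
    have h1 : V - 1 ∣ V^h - 1 := by simpa using sub_dvd_pow_sub_pow V 1 h
    refine dvd_trans ⟨ω (1-t)⁻¹ * β, ?_⟩ h1
    rw [hV]; ring
  have w8 : w^(8*h) = 1 := by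
    rw [hw, ← map_pow, show 8*h = Fintype.card F - 1 by omega, FiniteField.pow_card_sub_one_eq_one _ hu, map_one]
  have hd := poly_dvd (p : WW) (V^h) hU
  have : 273 * (1 - ω t)^(5*h) - 210 * (1 - ω t)^(13*h) + 65 * (1 - ω t)^(21*h) - 128 * w^(5*h) =
     w^(5*h) * (273*(V^h)^5 - 210*(V^h)^13 + 65*(V^h)^21 - 128) := by
    rw [hz, mul_pow, mul_pow, mul_pow]
    rw [show w^(13*h) = w^(5*h) * w^(8*h) by rw [← pow_add]; congr 1; ring, show w^(21*h) = w^(5*h) * (w^(8*h))^2 by rw [← pow_mul, ← pow_add]; congr 1; ring, w8]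
    rw [← pow_mul, ← pow_mul, ← pow_mul, mul_comm h 5, mul_comm h 13, mul_comm h 21]
    ring
  rw [this]
  exact Dvd.dvd.mul_left hd _

/-- the character `t ↦ ω(t)^m` -/
noncomputable def omchar (p : ℕ) [hp : Fact p.Prime] (F : Type*) [Field F] [CharP F p] (m : ℕ) (hm : m ≠ 0) : MulChar F (WittVector p F) where
  toFun t := (WittVector.teichmuller p t)^m
  map_one' := by simp
  map_mul' a b := by simp [mul_pow]
  map_nonunit' a ha := by
    have : a = 0 := by simpa using ha
    rw [this, WittVector.teichmuller_zero, zero_pow hm]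

lemma jac_V (h : ℕ) (h0 : 0 < h) (hF : Fintype.card F = 8*h+1) (h8 : 8*h+1 = p^2) :
    ∃ A B : ℤ, A^2 + 2*B^2 = (p:ℤ)^2 ∧ A % 4 = 3 ∧ (p:ℤ)^3 ∣ (VV p h)^2 + 256*A*VV p h + 128^2*p^2 := by
  have hm : 5*h ≠ 0 := by omega
  set χ := omchar p F (5*h) hm with hχ
  have hχt : ∀ t : F, χ t = ω t^(5*h) := fun t => rfl
  have om8 : ∀ t : F, t ≠ 0 → ω t^(8*h) = 1 := by
    intro t ht
    rw [← map_pow, show 8*h = Fintype.card F - 1 by omega, FiniteField.pow_card_sub_one_eq_one _ ht, map_one]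
  have c8 : χ^8 = 1 := by
    ext t
    rw [MulChar.pow_apply' _ (by norm_num), hχt, MulChar.one_apply t.isUnit, ← pow_mul, show 5*h*8 = 8*h*5 by ring, pow_mul, om8 _ (Units.ne_zero t), one_pow]
  have c4t : ∀ t : F, (χ^4) t = ω t^(4*h) := by
    intro t
    rw [MulChar.pow_apply' _ (by norm_num), hχt]
    by_cases ht : t = 0
    · rw [ht, om_zero, zero_pow hm, zero_pow (by norm_num), zero_pow (by omega)]
    rw [← pow_mul, show 5*h*4 = 8*h*2+4*h by ring, pow_add, pow_mul, om8 _ ht, one_pow, one_mul]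
  have c4 : χ^4 ≠ 1 := by
    intro hc
    obtain ⟨g, hg⟩ := IsCyclic.exists_generator (α := Fˣ)
    have h1 := congrArg (fun f : MulChar F WW => f g) hc
    simp only [c4t, MulChar.one_apply g.isUnit] at h1
    rw [← map_pow, ← map_one (ω)] at h1
    have h2 := om_inj h1
    have h3 : g^(4*h) = 1 := by ext; simpa using h2
    have h4 := orderOf_dvd_of_pow_eq_one h3
    rw [orderOf_eq_card_of_forall_mem_zpowers hg, Nat.card_units, Nat.card_eq_fintype_card, hF] at h4
    have := Nat.le_of_dvd (by omega) h4
    omega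
  obtain ⟨A, B, θ, hθ, hJ, hAB, hA4⟩ := jac_main (by omega) χ c8 c4
  rw [hF, h8] at hAB
  push_cast at hAB
  refine ⟨A, B, hAB, hA4, ?_⟩
  set J := jacobiSum (χ^4) χ with hJdef
  have hJV : (p : WW)^3 ∣ -(VV p h : WW) - 128 * J := by
    have hd : (p : WW)^3 ∣ ∑ t : F, (ω t)^(4*h) * (273 * (1 - ω t)^(5*h) - 210 * (1 - ω t)^(13*h) + 65 * (1 - ω t)^(21*h) - 128 * ω (1-t)^(5*h)) :=
      Finset.dvd_sum (fun t _ => Dvd.dvd.mul_left (om_cong h h0 hF t) _)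
    convert hd using 1
    have k0 := om_K (p := p) (F := F) h 0 h0 hF
    have k1 := om_K (p := p) (F := F) h 1 h0 hF
    have k2 := om_K (p := p) (F := F) h 2 h0 hF
    simp only [Finset.sum_range_succ, Finset.sum_range_zero] at k0 k1 k2
    norm_num at k0 k1 k2
    have hJ2 : J = ∑ t : F, (ω t)^(4*h) * ω (1-t)^(5*h) := by
      rw [hJdef, jacobiSum]
      apply Finset.sum_congr rfl
      intro t _
      rw [c4t, hχt]
    have h8' : (8*h+1 : WW) = (p:WW)^2 := by exact_mod_cast congrArg (Nat.cast : ℕ → WW) h8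
    have : ∑ t : F, (ω t)^(4*h) * (273 * (1 - ω t)^(5*h) - 210 * (1 - ω t)^(13*h) + 65 * (1 - ω t)^(21*h) - 128 * ω (1-t)^(5*h)) =
       273 * ∑ t : F, (ω t)^(4*h) * (1 - ω t)^(5*h) - 210 * ∑ t : F, (ω t)^(4*h) * (1 - ω t)^(13*h) + 65 * ∑ t : F, (ω t)^(4*h) * (1 - ω t)^(21*h) - 128 * ∑ t : F, (ω t)^(4*h) * ω (1-t)^(5*h) := by
      simp only [Finset.mul_sum, ← Finset.sum_sub_distrib, ← Finset.sum_add_distrib]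
      apply Finset.sum_congr rfl
      intro t _; ring
    rw [this, k0, k1, k2, ← hJ2, VV]
    push_cast
    rw [← h8']
    ring
  have hq : J^2 - 2*A*J + p^2 = 0 := by
    have hABR : (A:WW)^2 + 2*B^2 = p^2 := by exact_mod_cast congrArg (Int.cast : ℤ → WW) hAB
    rw [hJ, ← hABR]
    linear_combination (B:WW)^2 * hθ
  obtain ⟨c, hc⟩ := hJV
  apply W_int (F := F)
  push_cast
  refine ⟨-c * (VV p h - 128*J) - c * 256 * A, ?_⟩
  linear_combination 128^2 * hq + (-(VV p h - 128*J) - 256*A) * hc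
end Witt
end S5

namespace S5
open Finset

section Fin13
variable {p : ℕ} [hp : Fact p.Prime]

lemma sign_val (A x y : ℤ) (P n : ℕ) (hn : P = 2*n+1) (hp8 : P % 8 = 1 ∨ P % 8 = 3) (hxy : (P:ℤ) = x^2+2*y^2)
    (hA4 : A % 4 = 3) (h : A = x^2-2*y^2 ∨ A = -(x^2-2*y^2)) : A = -(-1)^n * (2*x^2 - P) := by
  have hx : x % 2 = 1 := by
    rcases Int.even_or_odd' x with ⟨k, hk | hk⟩
    · subst hk; ring_nf at hxy; omega
    · omega
  obtain ⟨k, rfl⟩ : ∃ k, x = 2*k+1 := ⟨x/2, by omega⟩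
  obtain ⟨l, hl⟩ := Int.even_mul_succ_self k
  have hx2 : (2*k+1)^2 = 8*l+1 := by linear_combination 4*hl
  rcases Int.even_or_odd' y with ⟨j, hj | hj⟩
  · obtain ⟨m, rfl⟩ : ∃ m, n = 2*m := by
      subst hj; ring_nf at hxy hx2; exact ⟨n/2, by omega⟩
    rw [pow_mul]; norm_num
    rcases h with h | h
    · exfalso; rw [hx2, hj] at h; ring_nf at h; omega
    · rw [h, hxy]; ring
  · obtain ⟨i, hi⟩ := Int.even_mul_succ_self j
    have hy2 : y^2 = 8*i+1 := by rw [hj]; linear_combination 4*hi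
    obtain ⟨m, rfl⟩ : ∃ m, n = 2*m+1 := by
      rw [hx2, hy2] at hxy; exact ⟨n/2, by omega⟩
    rw [pow_succ, pow_mul]; norm_num
    rcases h with h | h
    · rw [h, hxy]; ring
    · exfalso; rw [hx2, hy2] at h; omega

lemma x_ndvd (h2 : p ≠ 2) (x y : ℤ) (hxy : (p:ℤ) = x^2+2*y^2) : ¬ (p:ℤ) ∣ x ∧ ¬ (p:ℤ) ∣ y := by
  have hpos : (1:ℤ) < p := by exact_mod_cast hp.out.one_lt
  have key : ∀ z : ℤ, z^2 ≤ p → (p:ℤ) ∣ z → z = 0 := by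
    rintro z hz ⟨c, rfl⟩
    by_contra h
    have hc : c ≠ 0 := by rintro rfl; simp at h
    have : 1 ≤ c^2 := by
      have := sq_pos_of_ne_zero hc
      omega
    nlinarith [mul_le_mul_of_nonneg_left this (sq_nonneg (p:ℤ))]
  constructor
  · intro h
    have := key x (by nlinarith [sq_nonneg y]) h
    subst this
    have : (2:ℤ) ∣ p := ⟨y^2, by rw [hxy]; ring⟩
    have : 2 ∣ p := by exact_mod_cast this
    exact h2 ((Nat.prime_dvd_prime_iff_eq Nat.prime_two hp.out).1 this).symm
  · intro h
    have := key y (by nlinarith [sq_nonneg x]) h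
    subst this
    have h1 : IsSquare (p:ℤ) := ⟨x, by rw [hxy]; ring⟩
    have := (Nat.prime_iff_prime_int.1 hp.out).irreducible.not_isSquare
    exact this h1

lemma A_val (h2 : p ≠ 2) (A B x y : ℤ) (hxy : (p:ℤ) = x^2+2*y^2) (hAB : A^2+2*B^2 = (p:ℤ)^2)
    (hA : ¬ (p:ℤ) ∣ A) : A = x^2-2*y^2 ∨ A = -(x^2-2*y^2) := by
  have hP : Prime (p:ℤ) := Nat.prime_iff_prime_int.1 hp.out
  obtain ⟨hx, hy⟩ := x_ndvd h2 x y hxy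
  have hp2 : ¬ (p:ℤ) ∣ 2 := by
    intro h
    have : p ∣ 2 := by exact_mod_cast h
    exact h2 ((Nat.prime_dvd_prime_iff_eq hp.out Nat.prime_two).1 this)
  have hpos : (0:ℤ) < p := by exact_mod_cast hp.out.pos
  set a := x^2-2*y^2 with ha
  set b := 2*x*y with hb
  have hab : a^2+2*b^2 = (p:ℤ)^2 := by rw [ha, hb, hxy]; ring
  have hbn : ¬ (p:ℤ) ∣ b := by
    rw [hb]; intro h
    rcases hP.dvd_or_dvd h with h | h
    · rcases hP.dvd_or_dvd h with h | h
      · exact hp2 h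
      · exact hx h
    · exact hy h
  have hd2 : (p:ℤ)^2 ∣ 2 * ((A*b-a*B)*(A*b+a*B)) := ⟨A^2-a^2, by linear_combination A^2*hab - a^2*hAB⟩
  have hd : (p:ℤ)^2 ∣ (A*b-a*B)*(A*b+a*B) := hP.pow_dvd_of_dvd_mul_left 2 hp2 hd2
  have hnb : ¬ ((p:ℤ) ∣ (A*b-a*B) ∧ (p:ℤ) ∣ (A*b+a*B)) := by
    rintro ⟨h, h'⟩
    have : (p:ℤ) ∣ 2 * (A * b) := by
      have := dvd_add h h'
      ring_nf at this ⊢; exact this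
    rcases hP.dvd_or_dvd this with h | h
    · exact hp2 h
    · rcases hP.dvd_or_dvd h with h | h
      · exact hA h
      · exact hbn h
  have small : ∀ z w : ℤ, w^2 + 2*z^2 = (p:ℤ)^4 → (p:ℤ)^2 ∣ z → z = 0 := by
    rintro z w hz ⟨c, rfl⟩
    by_contra h
    have hc : c ≠ 0 := by rintro rfl; simp at h
    have : 1 ≤ c^2 := by
      have := sq_pos_of_ne_zero hc
      omega
    have h4 : (0:ℤ) < (p:ℤ)^4 := by positivity
    nlinarith [sq_nonneg w, mul_le_mul_of_nonneg_left this h4.le]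
  have fin : (A*b-a*B)*(A*b+a*B) = 0 → A = a ∨ A = -a := by
    intro h
    have h0 : (p:ℤ)^2 * (A^2-a^2) = 0 := by linear_combination 2*h - A^2*hab + a^2*hAB
    have : (A-a)*(A+a) = 0 := by
      have := (mul_eq_zero.1 h0).resolve_left (by positivity)
      linear_combination this
    rcases mul_eq_zero.1 this with h | h
    · left; linarith
    · right; linarith
  apply fin
  by_cases h1 : (p:ℤ) ∣ (A*b-a*B)
  · have h3 : ¬ (p:ℤ) ∣ (A*b+a*B) := fun h => hnb ⟨h1, h⟩
    rw [small (A*b-a*B) (A*a+2*B*b) (by linear_combination (a^2+2*b^2)*hAB + (p:ℤ)^2*hab) (hP.pow_dvd_of_dvd_mul_right 2 h3 hd), zero_mul]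
  · rw [small (A*b+a*B) (A*a-2*B*b) (by linear_combination (a^2+2*b^2)*hAB + (p:ℤ)^2*hab) (hP.pow_dvd_of_dvd_mul_left 2 h1 hd), mul_zero]

lemma S0_unit (h3 : 3 < p) (hp8 : p % 8 = 1 ∨ p % 8 = 3) : IsUnit (SS p 0) := by
  rw [S0_eq h3 hp8]
  exact (((Gne _).mul (Gne _)).pow 2).neg

lemma S0_quad (h3 : 3 < p) (hp8 : p % 8 = 1 ∨ p % 8 = 3) : ∃ A B : ℤ, A^2+2*B^2 = (p:ℤ)^2 ∧ A % 4 = 3 ∧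
    (SS p 0)^2 + 2*A*SS p 0 + p^2 = 0 := by
  haveI := Fintype.ofFinite (GaloisField p 2)
  classical
  obtain ⟨h, h8⟩ : ∃ h, 8*h+1 = p^2 := by
    obtain ⟨k, hk⟩ : ∃ k, p = 2*k+1 := by
      rcases hp8 with h | h
      · exact ⟨p/2, by omega⟩
      · exact ⟨p/2, by omega⟩
    obtain ⟨l, hl⟩ := Nat.even_mul_succ_self k
    refine ⟨l, ?_⟩
    rw [hk]
    have : k^2 + k = 2*l := by linarith
    nlinarith
  have hF : Fintype.card (GaloisField p 2) = 8*h+1 := by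
    rw [h8, ← Nat.card_eq_fintype_card, GaloisField.card p 2 (by norm_num)]
  have h0 : 0 < h := by
    rcases Nat.eq_zero_or_pos h with h | h
    · subst h; nlinarith
    · exact h
  obtain ⟨A, B, h1, h2, hd⟩ := jac_V (p := p) h h0 hF h8
  refine ⟨A, B, h1, h2, ?_⟩
  have hz : (((VV p h)^2 + 256*A*VV p h + 128^2*p^2 : ℤ) : ZZ p) = 0 := by
    rw [ZMod.intCast_zmod_eq_zero_iff_dvd]
    · push_cast; exact hd
  push_cast at hz
  rw [VV_S0 h3 hp8 h h8] at hz
  have hu : IsUnit ((128:ZZ p)^2) := by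
    have he := ee_eq (p := p) (by omega)
    apply IsUnit.of_mul_eq_one (2 * ee p^5)
    calc (128:ZZ p)^2 * (2 * ee p^5) = (8 * ee p)^5 := by ring
      _ = 1 := by rw [he, one_pow]
  apply hu.mul_left_cancel
  linear_combination hz

lemma S_final (n : ℕ) (hn : p = 2*n+1) (h3 : 3 < p) (hp8 : p % 8 = 1 ∨ p % 8 = 3) (x y : ℤ) (hxy : (p:ℤ) = x^2+2*y^2) :
    64*(x:ZZ p)^2*((-1)^n * SS p 2) = 8*(x:ZZ p)^4 - 12*p*x^2 + p^2 ∧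
    256*(x:ZZ p)^2*((-1)^n * SS p 3) = 8*(x:ZZ p)^4 - 4*p*x^2 - 5*p^2 := by
  obtain ⟨A, B, hAB, hA4, hq⟩ := S0_quad h3 hp8
  have hu := S0_unit h3 hp8
  have hA : ¬ (p:ℤ) ∣ A := by
    rintro ⟨c, rfl⟩
    have h0 := unit_ne _ hu
    have := congrArg (pi p) hq
    rw [map_zero, map_add, map_add, map_mul, map_pow, map_pow, pi_p, map_mul] at this
    push_cast at this
    rw [map_mul, pi_p] at this
    simp at this
    exact h0 this
  have hAx := sign_val A x y p n hn hp8 hxy hA4 (A_val (by omega) A B x y hxy hAB hA)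
  have hAz : (A : ZZ p) = -(-1)^n * (2*(x:ZZ p)^2 - p) := by rw [hAx]; push_cast; rfl
  have hss : ((-1:ZZ p)^n)^2 = 1 := by rw [← pow_mul, mul_comm, pow_mul]; norm_num
  have r1 := S1_rel n hn h3
  have r2 := S02_rel n hn h3
  have r3 := tele (p := p) (by omega)
  obtain ⟨Ti, hT⟩ := hu.exists_right_inv
  have p3 := p_cube (p := p)
  generalize (-1:ZZ p)^n = s at *
  generalize SS p 0 = S0 at *
  generalize SS p 1 = S1 at *
  generalize SS p 2 = S2 at *
  generalize SS p 3 = S3 at *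
  generalize (p : ZZ p) = P at *
  rw [hAz] at hq
  rw [show (x:ZZ p)^4 = ((x:ZZ p)^2)^2 by ring]
  generalize (x : ZZ p)^2 = u at *
  obtain ⟨X, hXd⟩ : ∃ X, X = s * S0 - 4*u + 2*P := ⟨_, rfl⟩
  have hX : X = -P^2 * s * Ti := by
    have h1 : s * S0 * X = -P^2 := by
      rw [hXd]; linear_combination hq + S0^2 * hss
    linear_combination s * Ti * h1 - X * Ti * S0 * hss - X * hT
  have h4 : 4*u*X = -P^2 := by
    have e1 : P * X = 0 := by rw [hX]; linear_combination -s*Ti*p3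
    have e2 : X * X = 0 := by
      nth_rw 1 [hX]; linear_combination -P * s * Ti * e1
    have h1 : s * S0 * X = -P^2 := by
      rw [hXd]; linear_combination hq + S0^2 * hss
    linear_combination h1 + 2*e1 - e2 + X * hXd
  have hY : s * (32*S2+16*S1+3*S0) = -3*X := by
    rw [hX]
    linear_combination s * Ti * r2 - s * (32*S2+16*S1+3*S0) * hT
  have r1' : 4*(s*S1) + s*S0 = P := by linear_combination s * r1 + P * hss
  have f2 : 64*u*(s*S2) = 8*u^2-12*P*u+P^2 := by
    linear_combination 2*u*hY - 8*u*r1' - 2*u*hXd - h4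
  refine ⟨f2, ?_⟩
  linear_combination 16*u*s*r3 - 3*f2 - 24*u*r1' - 8*u*hXd+2*h4

end Fin13
end S5

namespace S5
open Finset

section D1
variable {p : ℕ} [hp : Fact p.Prime]

lemma fac_Gm (h2 : p ≠ 2) (N : ℕ) (hN : N < p) : (N.factorial : ZZ p) = (-1)^(N+1) * Gm p ((N:ZZ p)+1) := by
  have h := fac_Gi (p := p) N
  rw [Nat.div_eq_of_lt hN] at h
  have := congrArg (Int.cast : ℤ → ZZ p) h
  push_cast at this
  rw [this, Gi_cast, ← Gm_nat h2]
  push_cast; simp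

lemma Gm_exp1 (h3 : 3 < p) (x y : ZZ p) : (p:ZZ p) * Gm p (x + p*y) = p * (Gm p x * (1 + p * LA p x * y)) := by
  rw [Gm_exp h3 x y]
  linear_combination Gm p x * LC p x * y^2 * p_cube (p := p)

lemma harm (h3 : 3 < p) (N : ℕ) (hN : N < p) :
    (p:ZZ p) * LA p ((N:ZZ p)+1) = p * (LA p 0 + ∑ i ∈ Icc 1 N, ((i:ZZ p))⁻¹) := by
  induction N with
  | zero =>
    have := (LA_succ0 h3 0 (map_zero _)).1
    simpa using this
  | succ N ih =>
    have h := (LA_succ h3 ((N:ZZ p)+1) (by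
      have : (N:ZZ p)+1 = ((N+1:ℕ):ZZ p) := by push_cast; rfl
      rw [this, map_natCast, Ne, ZMod.natCast_eq_zero_iff]
      intro h
      have := Nat.le_of_dvd (by omega) h
      omega)).1
    rw [Finset.sum_Icc_succ_top (by omega)]
    push_cast
    rw [h]
    linear_combination ih (by omega)

lemma fac_two (n : ℕ) : (2*n).factorial = 2^n * n.factorial * ∏ i ∈ range n, (2*i+1) := by
  induction n with
  | zero => simp
  | succ n ih =>
    rw [show 2*(n+1) = 2*n+1+1 by ring, Nat.factorial_succ, Nat.factorial_succ, ih, Finset.prod_range_succ, Nat.factorial_succ]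
    ring

lemma two_pow (h3 : 3 < p) (n : ℕ) (hn : p = 2*n+1) :
    (p:ZZ p) * 2^(p-1) = p * (1 + p * (4 * ee p) * (LA p 0 - LA p (4 * ee p))) := by
  have h2 : p ≠ 2 := by omega
  have he := ee_eq (p := p) h2
  have hpz : (p:ZZ p) = 2*n+1 := by
    have := congrArg (Nat.cast : ℕ → ZZ p) hn; push_cast at this; exact this
  obtain ⟨h, hh⟩ : ∃ h, h = 4 * ee p := ⟨_, rfl⟩
  rw [← hh]
  have h2h : 2 * h = 1 := by rw [hh]; linear_combination he
  have e1 := congrArg (Nat.cast : ℕ → ZZ p) (fac_two n)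
  push_cast at e1
  rw [fac_Gm h2 (2*n) (by omega), fac_Gm h2 n (by omega)] at e1
  have e2 : (∏ i ∈ range n, (2*(i:ZZ p)+1)) = 2^n * ∏ i ∈ range n, (h + i) := by
    rw [show (2:ZZ p)^n = ∏ i ∈ range n, 2 by simp, ← Finset.prod_mul_distrib]
    apply Finset.prod_congr rfl
    intro i _
    linear_combination -h2h
  have e3 := Gm_prod h2 h n (by
    intro l hl h0
    have h1 : ((2*l+1 : ℕ) : ZZ p) = 2 * (h + l) := by push_cast; linear_combination -h2h
    have h2 := congrArg (pi p) h1
    rw [map_natCast, map_mul, h0, mul_zero, ZMod.natCast_eq_zero_iff] at h2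
    have := Nat.le_of_dvd (by omega) h2
    omega)
  rw [e2] at e1
  have x1 : ((2*n:ℕ):ZZ p)+1 = 0 + p * 1 := by push_cast; linear_combination -hpz
  have x2 : (n:ZZ p)+1 = h + p * h := by linear_combination -h * hpz - (n+1) * h2h
  have x3 : h + n = 0 + p*h := by linear_combination -h*hpz - n * h2h
  have hs : ((-1:ZZ p)^n)^2 = 1 := by rw [← pow_mul, mul_comm, pow_mul]; norm_num
  rw [x1, x2, pow_succ (-1:ZZ p), pow_succ (-1:ZZ p), pow_mul, neg_one_sq, one_pow] at e1
  rw [x3] at e3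
  have g1 := Gm_exp1 h3 0 1
  have g2 := Gm_exp1 h3 h h
  have g3 := Gm_exp1 h3 0 h
  rw [Gm_zero h2] at g1 g3
  rw [show p - 1 = 2*n by omega, two_mul n, pow_add]
  have p3 := p_cube (p := p)
  have gh := Gne h
  generalize (∏ i ∈ range n, (h + (i:ZZ p))) = Q at *
  generalize (2:ZZ p)^n = T at *
  generalize (-1:ZZ p)^n = s at *
  generalize Gm p (0 + (p:ZZ p)*1) = G1 at *
  generalize Gm p (0 + (p:ZZ p)*h) = G3 at *
  generalize Gm p (h + (p:ZZ p)*h) = G2 at *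
  generalize Gm p h = g at *
  generalize LA p 0 = A0 at *
  generalize LA p h = A4 at *
  generalize (p:ZZ p) = P at *
  -- e1 : 1*(-1)*G1 = T*(s*(-1)*G2)*(T*Q), e3 : G3 = s*Q*g
  have f1 : G1 * g = T*T*G2*G3 := by
    rw [e3]; linear_combination -g*e1
  have f2 : g * (P * (1 + P*A0)) = g * (P * (T*T) * (1 + P*h*(A0+A4))) := by
    linear_combination P * f1 - g * g1 + T*T*G3 * g2 + T*T*g*(1+P*A4*h)*g3 + T*T*g*A0*A4*h^2*p3
  have f3 := gh.mul_left_cancel f2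
  linear_combination (-1 + P*h*(A0+A4))*f3 - P^2*A0*h2h + (T*T*h^2*(A0+A4)^2 - A0*h*(A0+A4)) * p3

lemma inv_two (h2 : p ≠ 2) (x : ZZ p) (hx : pi p x ≠ 0) : 2 * (2*x)⁻¹ = x⁻¹ := by
  have h1 := uinv x hx
  have h3 := uinv (2*x) (by rw [map_mul, map_ofNat]; exact mul_ne_zero (two_neZ h2) hx)
  linear_combination (x⁻¹) * h3 - 2 * (2*x)⁻¹ * h1

lemma dup (h3 : 3 < p) (x : ZZ p) :
    (p:ZZ p) * (2 * LA p (2*x) - LA p x - LA p (x + 4*ee p)) = p * (LA p 0 - LA p (4*ee p)) := by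
  have h2 : p ≠ 2 := by omega
  have he := ee_eq (p := p) h2
  induction x using ZZ_ind with
  | h0 => simp; ring
  | hs x ih =>
    rw [← ih]
    have ex : 2*(x+1) = 2*x+1+1 := by ring
    have ey : x + 1 + 4*ee p = (x+4*ee p) + 1 := by ring
    have ez : 2*x+1 = 2*(x+4*ee p) := by linear_combination -he
    rw [ex, ey]
    have t2 := two_neZ (p := p) h2
    have q1 : p * (2 * LA p (2*x+1)) - p * (2 * LA p (2*x)) = p * LA p (x+1) - p * LA p x := by
      by_cases hx : pi p x = 0
      · have a := (LA_succ0 h3 x hx).1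
        have b := (LA_succ0 h3 (2*x) (by rw [map_mul, hx, mul_zero])).1
        linear_combination 2*b - a
      · have a := (LA_succ h3 x hx).1
        have b := (LA_succ h3 (2*x) (by rw [map_mul, map_ofNat]; exact mul_ne_zero t2 hx)).1
        linear_combination 2*b - a + p * inv_two h2 x hx
    have q2 : p * (2 * LA p (2*x+1+1)) - p * (2 * LA p (2*x+1)) = p * LA p (x+4*ee p+1) - p * LA p (x+4*ee p) := by
      rw [ez]
      generalize x + 4*ee p = x
      by_cases hx : pi p x = 0
      · have a := (LA_succ0 h3 x hx).1
        have b := (LA_succ0 h3 (2*x) (by rw [map_mul, hx, mul_zero])).1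
        linear_combination 2*b - a
      · have a := (LA_succ h3 x hx).1
        have b := (LA_succ h3 (2*x) (by rw [map_mul, map_ofNat]; exact mul_ne_zero t2 hx)).1
        linear_combination 2*b - a + p * inv_two h2 x hx
    linear_combination q1 + q2

lemma A13 (h3 : 3 < p) : (p:ZZ p) * (LA p (ee p) + LA p (3*ee p)) = p * (4 * LA p (4*ee p) - 2 * LA p 0) := by
  have h2 : p ≠ 2 := by omega
  have he := ee_eq (p := p) h2
  have d1 := dup h3 (ee p)
  have d2 := dup h3 (2*ee p)
  have r1 := (LA_refl h3 (3*ee p)).1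
  have r2 := (LA_refl h3 (2*ee p)).1
  rw [show 1 - 3*ee p = ee p + 4*ee p by linear_combination -he] at r1
  rw [show 1 - 2*ee p = 2*ee p + 4*ee p by linear_combination -he] at r2
  rw [show 2*(2*ee p) = 4*ee p by ring] at d2
  linear_combination -d1 - r1 - d2 - r2

end D1
end S5

namespace S5
open Finset

section D2
variable {p : ℕ} [hp : Fact p.Prime]

lemma r1e (h2 : p ≠ 2) : (Gm p (ee p) * Gm p (7 * ee p))^2 = 1 := by
  have he := ee_eq (p := p) h2
  have r1 := rr_sq h2 (ee p)
  rw [rr, show 1 - ee p = 7 * ee p by linear_combination -he] at r1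
  exact r1

lemma r3e (h2 : p ≠ 2) : (Gm p (3 * ee p) * Gm p (5 * ee p))^2 = 1 := by
  have he := ee_eq (p := p) h2
  have r1 := rr_sq h2 (3 * ee p)
  rw [rr, show 1 - 3 * ee p = 5 * ee p by linear_combination -he] at r1
  exact r1

lemma Gm9 (h2 : p ≠ 2) : Gm p (9 * ee p) = - ee p * Gm p (ee p) := by
  have he := ee_eq (p := p) h2
  rw [show 9 * ee p = ee p + 1 by linear_combination he]
  apply Gm_succ h2
  intro h; have := congrArg (pi p) he
  rw [map_mul, h, map_one, mul_zero] at this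
  exact zero_ne_one this

lemma Y_fin (h3 : 3 < p) (P N u v : ZZ p)
    (huv : (u = Gm p (ee p) * Gm p (7 * ee p) ∧ v = Gm p (3 * ee p) * Gm p (5 * ee p)) ∨
      (v = Gm p (ee p) * Gm p (7 * ee p) ∧ u = Gm p (3 * ee p) * Gm p (5 * ee p)))
    (h : P * (Gm p (ee p + p * (2 * ee p)) * Gm p (3 * ee p + p * (2 * ee p))) * u =
      64 * N * (Gm p (5 * ee p + p * (2 * ee p)) * Gm p (7 * ee p + p * (2 * ee p))) * v) :
    (p:ZZ p) * (P * (Gm p (ee p) * Gm p (3 * ee p))^2) = 64 * (p * N) := by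
  have h2 : p ≠ 2 := by omega
  have he := ee_eq (p := p) h2
  have g1 := Gm_exp1 h3 (ee p) (2 * ee p)
  have g3 := Gm_exp1 h3 (3 * ee p) (2 * ee p)
  have g5 := Gm_exp1 h3 (5 * ee p) (2 * ee p)
  have g7 := Gm_exp1 h3 (7 * ee p) (2 * ee p)
  have L1 := (LA_refl h3 (ee p)).1
  have L3 := (LA_refl h3 (3 * ee p)).1
  rw [show 1 - ee p = 7 * ee p by linear_combination -he] at L1
  rw [show 1 - 3 * ee p = 5 * ee p by linear_combination -he] at L3
  have r1 := r1e (p := p) h2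
  have r3 := r3e (p := p) h2
  have p3 := p_cube (p := p)
  rw [L1] at g7
  rw [L3] at g5
  have q : IsUnit ((1 + p * LA p (ee p) * (2 * ee p)) * (1 + p * LA p (3 * ee p) * (2 * ee p))) := by
    apply unit_of
    simp only [map_mul, map_add, map_one, pi_p, zero_mul, add_zero, mul_one]
    exact one_ne_zero
  apply q.mul_left_cancel
  have f : (p:ZZ p) * (P * (Gm p (ee p) * Gm p (3*ee p)) * ((1 + p * LA p (ee p) * (2 * ee p)) * (1 + p * LA p (3 * ee p) * (2 * ee p)))) * u
     = p * (64 * N * (Gm p (5*ee p) * Gm p (7*ee p)) * ((1 + p * LA p (ee p) * (2 * ee p)) * (1 + p * LA p (3 * ee p) * (2 * ee p)))) * v := by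
    generalize Gm p (7*ee p + p*(2*ee p)) = b7 at *
    generalize Gm p (5*ee p + p*(2*ee p)) = b5 at *
    generalize Gm p (3*ee p + p*(2*ee p)) = b3 at *
    generalize Gm p (ee p + p*(2*ee p)) = b1 at *
    generalize Gm p (7*ee p) = a7 at *
    generalize Gm p (5*ee p) = a5 at *
    generalize Gm p (3*ee p) = a3 at *
    generalize Gm p (ee p) = a1 at *
    generalize (1 + p * LA p (ee p) * (2 * ee p)) = x at *
    generalize (1 + p * LA p (3 * ee p) * (2 * ee p)) = y at *
    linear_combination p * h - P * u * b3 * g1 - P * u * (a1 * x) * g3 + 64 * N * v * b7 * g5 + 64 * N * v * (a5 * y) * g7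
  generalize Gm p (7*ee p) = a7 at *
  generalize Gm p (5*ee p) = a5 at *
  generalize Gm p (3*ee p) = a3 at *
  generalize Gm p (ee p) = a1 at *
  generalize ((1 + p * LA p (ee p) * (2 * ee p)) * (1 + p * LA p (3 * ee p) * (2 * ee p))) = x at *
  rcases huv with ⟨rfl, rfl⟩ | ⟨rfl, rfl⟩
  · linear_combination (a1*a7*a1*a3)*f - p*P*(a1*a3)^2*x*r1 + 64*p*N*x*((a1*a7)^2*r3 + r1)
  · linear_combination (a3*a5*a1*a3)*f - p*P*(a1*a3)^2*x*r3 + 64*p*N*x*((a1*a7)^2*r3 + r1)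

lemma Y_five (k : ℕ) (hk : p = 8*k+5) (h3 : 3 < p) :
    (p:ZZ p) * (PP (gW ((p:ZZ p)^2)) ((p:ZZ p)^2) (4*k+2) * (Gm p (ee p) * Gm p (3 * ee p))^2) =
      64 * (p * Nr ((p:ZZ p)^2) (4*k+2)) := by
  have h2 : p ≠ 2 := by omega
  have he := ee_eq (p := p) h2
  have hZ := TW_even ℤ (4*k+2) (2*k+1) (by omega) (by ring)
  have hpz : (2*((4*k+2:ℕ):ℤ)+1) = p := by rw [hk]; push_cast; ring
  rw [hpz] at hZ
  have hE2 : E2 ℤ (2*k+1) = p * ((∏ i ∈ Finset.range (2*k+1), (8*(i:ℤ)+3)) * ((∏ i ∈ Finset.range k, (8*(i:ℤ)+5)) *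
      ∏ i ∈ Finset.range k, (8*(((k+1:ℕ):ℤ)+i)+5))) := by
    rw [E2, Finset.prod_mul_distrib]
    have : (∏ i ∈ Finset.range (2*k+1), (8*(i:ℤ)+5)) = (∏ i ∈ Finset.range k, (8*(i:ℤ)+5)) * p *
      ∏ i ∈ Finset.range k, (8*(((k+1:ℕ):ℤ)+i)+5) := by
      rw [show 2*k+1 = (k+1)+k by ring, Finset.prod_range_add (fun i : ℕ => 8*(i:ℤ)+5),
        Finset.prod_range_succ (fun i : ℕ => 8*(i:ℤ)+5) k]
      have : (8*(k:ℤ)+5) = p := by rw [hk]; push_cast; ring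
      rw [this]; push_cast; ring
    rw [this]; ring
  have hp0 : (p:ℤ) ≠ 0 := by exact_mod_cast hp.out.ne_zero
  have hZ2 : PP (gW ((p:ℤ)^2)) ((p:ℤ)^2) (4*k+2) * ((∏ i ∈ Finset.range (2*k+1), (8*(i:ℤ)+3)) * ((∏ i ∈ Finset.range k, (8*(i:ℤ)+5)) *
      ∏ i ∈ Finset.range k, (8*(((k+1:ℕ):ℤ)+i)+5))) = -1 * Nr ((p:ℤ)^2) (4*k+2) * ((∏ i ∈ Finset.range (2*k+1), (8*(i:ℤ)+7)) *
        ∏ i ∈ Finset.range (2*k+1), (8*(i:ℤ)+9)) := by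
    apply mul_left_cancel₀ hp0
    rw [hE2, E1, Finset.prod_mul_distrib] at hZ
    linear_combination hZ
  have hZ3 := congrArg (Int.castRingHom (ZZ p)) hZ2
  rw [map_mul, map_mul (Int.castRingHom (ZZ p)) (_ * Nr _ _), map_mul (Int.castRingHom (ZZ p)) _ (Nr _ _), map_PPW, map_Nr, map_neg, map_one] at hZ3
  simp only [map_mul, map_prod, map_pow] at hZ3
  simp only [eq_intCast, Int.cast_add, Int.cast_mul, Int.cast_natCast, Int.cast_ofNat] at hZ3
  have c7 := PL h2 7 0 (2*k+1) (fun i hi => ndvd _ (by omega) (by omega) (by omega))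
  have c3 := PL h2 3 0 (2*k+1) (fun i hi => ndvd _ (by omega) (by omega) (by omega))
  have c9 := PL h2 9 0 (2*k+1) (fun i hi => ndvd _ (by omega) (by omega) (by omega))
  have c5 := PL h2 5 0 k (fun i hi => ndvd _ (by omega) (by omega) (by omega))
  have c5' := PL h2 5 (k+1) k (fun i hi => ndvd _ (by omega) (by omega) (by omega))
  simp only [Nat.cast_zero, zero_add, add_zero] at c7 c3 c5 c9
  have hkz : (k:ZZ p) = p * ee p - 5 * ee p := by
    have : (p:ZZ p) = 8*k+5 := by
      have := congrArg (Nat.cast : ℕ → ZZ p) hk; push_cast at this ⊢; exact this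
    linear_combination -(k:ZZ p) * he - ee p * this
  push_cast at c7 c3 c5 c9 c5' hZ3
  rw [show (7:ZZ p) * ee p + (2 * k + 1) = 5 * ee p + p * (2*ee p) by rw [hkz]; linear_combination -he] at c7
  rw [show (9:ZZ p) * ee p + (2 * k + 1) = 7 * ee p + p * (2*ee p) by rw [hkz]; linear_combination -he] at c9
  rw [show (3:ZZ p) * ee p + (2 * k + 1) = ee p + p * (2*ee p) by rw [hkz]; linear_combination -he] at c3
  rw [show (5:ZZ p) * ee p + (k + 1) + k = 3 * ee p + p * (2*ee p) by rw [hkz]; linear_combination -he,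
    show (5:ZZ p) * ee p + (k + 1) = p * ee p + 1 by rw [hkz]; ring,
    Gm_succ0 h2 _ (by rw [map_mul, pi_p, zero_mul])] at c5'
  rw [show (5:ZZ p) * ee p + k = p * ee p by rw [hkz]; ring] at c5
  rw [Gm9 h2] at c9
  have hs : ((-1:ZZ p)^k)^2 = 1 := by rw [← pow_mul, mul_comm, pow_mul]; norm_num
  rw [show (-1:ZZ p)^(2*k+1) = -1 by rw [pow_succ (-1:ZZ p), pow_mul]; norm_num,
    show (8:ZZ p)^(2*k+1) = 8*(8^k)^2 by rw [pow_succ (8:ZZ p), mul_comm 2 k, pow_mul]; ring] at c7 c9 c3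
  apply Y_fin h3 _ _ _ _ (Or.inl ⟨rfl, rfl⟩)
  have hwu : IsUnit ((8:ZZ p)^k) := by
    have : IsUnit (8:ZZ p) := unit_of _ (by rw [map_ofNat]; exact eight_ne h2)
    exact (this.pow _)
  have u8 : IsUnit (8:ZZ p) := unit_of _ (by rw [map_ofNat]; exact eight_ne h2)
  have hGp := Gne (p := p) (p * ee p)
  generalize (∏ i ∈ Finset.range (2*k+1), (8*(i:ZZ p)+7)) = Q7 at *
  generalize (∏ i ∈ Finset.range (2*k+1), (8*(i:ZZ p)+3)) = Q3 at *
  generalize (∏ i ∈ Finset.range (2*k+1), (8*(i:ZZ p)+9)) = Q9 at *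
  generalize (∏ i ∈ Finset.range k, (8*(i:ZZ p)+5)) = Qa at *
  generalize (∏ i ∈ Finset.range k, (8*((k:ZZ p)+1+i)+5)) = Qb at *
  generalize Gm p (p * ee p) = gp at *
  generalize Gm p (7*ee p + p*(2*ee p)) = b7 at *
  generalize Gm p (5*ee p + p*(2*ee p)) = b5 at *
  generalize Gm p (3*ee p + p*(2*ee p)) = b3 at *
  generalize Gm p (ee p + p*(2*ee p)) = b1 at *
  generalize Gm p (7*ee p) = a7 at *
  generalize Gm p (5*ee p) = a5 at *
  generalize Gm p (3*ee p) = a3 at *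
  generalize Gm p (ee p) = a1 at *
  generalize PP (gW ((p:ZZ p)^2)) ((p:ZZ p)^2) (4*k+2) = P at *
  generalize Nr ((p:ZZ p)^2) (4*k+2) = N at *
  generalize (8:ZZ p)^k = w at *
  generalize (-1:ZZ p)^k = s at *
  have hab : b3 * (w*w) = - (Qa * Qb) * a5 := by
    apply hGp.mul_left_cancel
    linear_combination gp * w * c5' - s * Qb * gp * c5 - Qa * Qb * a5 * gp * hs
  apply (((hwu.mul hwu).mul (hwu.mul hwu)).mul u8).mul_left_cancel
  linear_combination (P*a1*a7*8*w^2*b1) * hab - (P*a1*a7*Qa*Qb*a5)*c3 + a1*a7*a3*a5*hZ3 + 8*N*a3*a5*(- b7*8*w^2*c7 + Q7*a7*c9) + N*Q7*Q9*a1*a7*a3*a5*he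

lemma Y_seven (k : ℕ) (hk : p = 8*k+7) (h3 : 3 < p) :
    (p:ZZ p) * (PP (gW ((p:ZZ p)^2)) ((p:ZZ p)^2) (4*k+3) * (Gm p (ee p) * Gm p (3 * ee p))^2) =
      64 * (p * Nr ((p:ZZ p)^2) (4*k+3)) := by
  have h2 : p ≠ 2 := by omega
  have he := ee_eq (p := p) h2
  have hZ := TW_odd ℤ (4*k+3) (2*k+1) (by omega) (by ring)
  have hpz : (2*((4*k+3:ℕ):ℤ)+1) = p := by rw [hk]; push_cast; ring
  rw [hpz] at hZ
  have hE2 : E1 ℤ (2*k+1) = p * ((∏ i ∈ Finset.range (2*k+1), (8*(i:ℤ)+9)) * ((∏ i ∈ Finset.range k, (8*(i:ℤ)+7)) *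
      ∏ i ∈ Finset.range k, (8*(((k+1:ℕ):ℤ)+i)+7))) := by
    rw [E1, Finset.prod_mul_distrib]
    have : (∏ i ∈ Finset.range (2*k+1), (8*(i:ℤ)+7)) = (∏ i ∈ Finset.range k, (8*(i:ℤ)+7)) * p *
      ∏ i ∈ Finset.range k, (8*(((k+1:ℕ):ℤ)+i)+7) := by
      rw [show 2*k+1 = (k+1)+k by ring, Finset.prod_range_add (fun i : ℕ => 8*(i:ℤ)+7),
        Finset.prod_range_succ (fun i : ℕ => 8*(i:ℤ)+7) k]
      have : (8*(k:ℤ)+7) = p := by rw [hk]; push_cast; ring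
      rw [this]; push_cast; ring
    rw [this]; ring
  have hp0 : (p:ℤ) ≠ 0 := by exact_mod_cast hp.out.ne_zero
  have hZ2 : PP (gW ((p:ℤ)^2)) ((p:ℤ)^2) (4*k+3) * ((∏ i ∈ Finset.range (2*k+1), (8*(i:ℤ)+9)) * ((∏ i ∈ Finset.range k, (8*(i:ℤ)+7)) *
      ∏ i ∈ Finset.range k, (8*(((k+1:ℕ):ℤ)+i)+7))) = -1 * Nr ((p:ℤ)^2) (4*k+3) * ((∏ i ∈ Finset.range (2*k+1+1), (8*(i:ℤ)+3)) *
        ∏ i ∈ Finset.range (2*k+1+1), (8*(i:ℤ)+5)) := by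
    apply mul_left_cancel₀ hp0
    rw [hE2, E2, Finset.prod_mul_distrib] at hZ
    linear_combination hZ
  have hZ3 := congrArg (Int.castRingHom (ZZ p)) hZ2
  rw [map_mul, map_mul (Int.castRingHom (ZZ p)) (_ * Nr _ _), map_mul (Int.castRingHom (ZZ p)) _ (Nr _ _), map_PPW, map_Nr, map_neg, map_one] at hZ3
  simp only [map_mul, map_prod, map_pow] at hZ3
  simp only [eq_intCast, Int.cast_add, Int.cast_mul, Int.cast_natCast, Int.cast_ofNat] at hZ3
  have c3 := PL h2 3 0 (2*k+1+1) (fun i hi => ndvd _ (by omega) (by omega) (by omega))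
  have c5 := PL h2 5 0 (2*k+1+1) (fun i hi => ndvd _ (by omega) (by omega) (by omega))
  have c9 := PL h2 9 0 (2*k+1) (fun i hi => ndvd _ (by omega) (by omega) (by omega))
  have c7 := PL h2 7 0 k (fun i hi => ndvd _ (by omega) (by omega) (by omega))
  have c7' := PL h2 7 (k+1) k (fun i hi => ndvd _ (by omega) (by omega) (by omega))
  simp only [Nat.cast_zero, zero_add, add_zero] at c7 c3 c5 c9
  have hkz : (k:ZZ p) = p * ee p - 7 * ee p := by
    have : (p:ZZ p) = 8*k+7 := by
      have := congrArg (Nat.cast : ℕ → ZZ p) hk; push_cast at this ⊢; exact this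
    linear_combination -(k:ZZ p) * he - ee p * this
  push_cast at c7 c3 c5 c9 c7' hZ3
  rw [show (3:ZZ p) * ee p + (2 * k + 1 + 1) = 5 * ee p + p * (2*ee p) by rw [hkz]; linear_combination -2*he] at c3
  rw [show (5:ZZ p) * ee p + (2 * k + 1 + 1) = 7 * ee p + p * (2*ee p) by rw [hkz]; linear_combination -2*he] at c5
  rw [show (9:ZZ p) * ee p + (2 * k + 1) = 3 * ee p + p * (2*ee p) by rw [hkz]; linear_combination -he] at c9
  rw [show (7:ZZ p) * ee p + (k + 1) + k = ee p + p * (2*ee p) by rw [hkz]; linear_combination -he,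
    show (7:ZZ p) * ee p + (k + 1) = p * ee p + 1 by rw [hkz]; ring,
    Gm_succ0 h2 _ (by rw [map_mul, pi_p, zero_mul])] at c7'
  rw [show (7:ZZ p) * ee p + k = p * ee p by rw [hkz]; ring] at c7
  rw [Gm9 h2] at c9
  have hs : ((-1:ZZ p)^k)^2 = 1 := by rw [← pow_mul, mul_comm, pow_mul]; norm_num
  rw [show (-1:ZZ p)^(2*k+1) = -1 by rw [pow_succ (-1:ZZ p), pow_mul]; norm_num,
    show (8:ZZ p)^(2*k+1) = 8*(8^k)^2 by rw [pow_succ (8:ZZ p), mul_comm 2 k, pow_mul]; ring] at c9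
  rw [show (-1:ZZ p)^(2*k+1+1) = 1 by rw [pow_succ (-1:ZZ p), pow_succ (-1:ZZ p), pow_mul]; norm_num,
    show (8:ZZ p)^(2*k+1+1) = 64*(8^k)^2 by rw [pow_succ (8:ZZ p), pow_succ (8:ZZ p), mul_comm 2 k, pow_mul]; ring] at c3 c5
  apply Y_fin h3 _ _ _ _ (Or.inr ⟨rfl, rfl⟩)
  have hwu : IsUnit ((8:ZZ p)^k) := by
    have : IsUnit (8:ZZ p) := unit_of _ (by rw [map_ofNat]; exact eight_ne h2)
    exact (this.pow _)
  have u8 : IsUnit (8:ZZ p) := unit_of _ (by rw [map_ofNat]; exact eight_ne h2)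
  have hGp := Gne (p := p) (p * ee p)
  generalize (∏ i ∈ Finset.range (2*k+1+1), (8*(i:ZZ p)+5)) = Q5 at *
  generalize (∏ i ∈ Finset.range (2*k+1+1), (8*(i:ZZ p)+3)) = Q3 at *
  generalize (∏ i ∈ Finset.range (2*k+1), (8*(i:ZZ p)+9)) = Q9 at *
  generalize (∏ i ∈ Finset.range k, (8*(i:ZZ p)+7)) = Qa at *
  generalize (∏ i ∈ Finset.range k, (8*((k:ZZ p)+1+i)+7)) = Qb at *
  generalize Gm p (p * ee p) = gp at *
  generalize Gm p (7*ee p + p*(2*ee p)) = b7 at *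
  generalize Gm p (5*ee p + p*(2*ee p)) = b5 at *
  generalize Gm p (3*ee p + p*(2*ee p)) = b3 at *
  generalize Gm p (ee p + p*(2*ee p)) = b1 at *
  generalize Gm p (7*ee p) = a7 at *
  generalize Gm p (5*ee p) = a5 at *
  generalize Gm p (3*ee p) = a3 at *
  generalize Gm p (ee p) = a1 at *
  generalize PP (gW ((p:ZZ p)^2)) ((p:ZZ p)^2) (4*k+3) = P at *
  generalize Nr ((p:ZZ p)^2) (4*k+3) = N at *
  generalize (8:ZZ p)^k = w at *
  generalize (-1:ZZ p)^k = s at *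
  have hab : b1 * (w*w) = - (Qa * Qb) * a7 := by
    apply hGp.mul_left_cancel
    linear_combination gp * w * c7' - s * Qb * gp * c7 - Qa * Qb * a7 * gp * hs
  apply (((hwu.mul hwu).mul (hwu.mul hwu)).mul (u8.mul u8)).mul_left_cancel
  linear_combination (P*a3*a5*64*w^2*b3) * hab - (8*P*a3*a5*Qa*Qb*a7)*c9 - a1*a7*a3*a5*hZ3 - N*a1*a7*(b7*64*w^2*c3 + Q3*a3*c5) - P*Qa*Qb*Q9*a1*a7*a3*a5*he

lemma Y_main (n : ℕ) (hn : p = 2*n+1) (h3 : 3 < p) (hp8 : p % 8 = 5 ∨ p % 8 = 7) :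
    (p:ZZ p) * ((32*SS p 2 + 16*SS p 1 + 3*SS p 0) * (Gm p (ee p) * Gm p (3 * ee p))^2) = 64 * p := by
  have key : (p:ZZ p) * (PP (gW ((p:ZZ p)^2)) ((p:ZZ p)^2) n * (Gm p (ee p) * Gm p (3 * ee p))^2) =
      64 * (p * Nr ((p:ZZ p)^2) n) := by
    rcases hp8 with h | h
    · have := Y_five (p := p) (p/8) (by omega) h3
      rwa [show 4*(p/8)+2 = n by omega] at this
    · have := Y_seven (p := p) (p/8) (by omega) h3
      rwa [show 4*(p/8)+3 = n by omega] at this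
  rw [← mul_assoc, (p_PP n).2, Nr_pp n hn h3, PW_SS n hn] at key
  apply (unit_of _ (Nr_unit n hn)).mul_left_cancel
  linear_combination key

end D2
end S5

namespace S5
open Finset

section D3
variable {p : ℕ} [hp : Fact p.Prime]

lemma R_gen (h3 : 3 < p) (n : ℕ) (hn : p = 2*n+1) (x C H d t : ZZ p) (hdt : d * t = 3)
    (hA : (p:ZZ p) * (LA p x + LA p (d * ee p)) = p * (4 * LA p (4*ee p) - 2 * LA p 0))
    (hH : (p:ZZ p)^2 * H = p^2 * (LA p x - LA p 0))
    (hc : C * Gm p (x + p * ee p) * ((d * ee p + p * (3 * ee p)) * Gm p (d * ee p + p * (3 * ee p))) = Gm p (4*ee p + p*(4*ee p))) :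
    (p:ZZ p) * (d^2 * (1 + 2*t*p - 4*(2^(p-1)-1) - 4*ee p*p*H) * C^2 * (Gm p x * Gm p (d * ee p))^2)
      = 64 * (Gm p (4*ee p))^2 * p := by
  have h2 : p ≠ 2 := by omega
  have he := ee_eq (p := p) h2
  have hT := two_pow h3 n hn
  have gA := Gm_exp1 h3 x (ee p)
  have gB := Gm_exp1 h3 (d * ee p) (3 * ee p)
  have g4 := Gm_exp1 h3 (4 * ee p) (4 * ee p)
  have p3 := p_cube (p := p)
  generalize Gm p (x + p * ee p) = GA at *
  generalize Gm p (d * ee p + p * (3 * ee p)) = GB at *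
  generalize Gm p (4*ee p + p*(4*ee p)) = G4 at *
  generalize Gm p x = a at *
  generalize Gm p (d * ee p) = b at *
  generalize Gm p (4 * ee p) = a4 at *
  generalize LA p x = A at *
  generalize LA p (d * ee p) = B at *
  generalize LA p (4 * ee p) = A4 at *
  generalize LA p 0 = A0 at *
  generalize (2:ZZ p)^(p-1) = T at *
  generalize ee p = e at *
  generalize (p:ZZ p) = P at *
  -- first order
  have f1 : P * (C * (a * (1 + P*A*e)) * ((d*e + P*(3*e)) * (b * (1 + P*B*(3*e))))) = P * (a4 * (1 + P*A4*(4*e))) := by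
    linear_combination P * hc - C*((d*e+P*(3*e))*GB)*gA - C*(a*(1+P*A*e))*(d*e+P*(3*e))*gB + g4
  have f2 : P * (C * a * b * d * (1 + P*(A*e + 3*B*e + t))) = 8 * (P * (a4 * (1 + P*A4*(4*e)))) := by
    linear_combination 8*f1 - P*C*a*b*(d+3*P)*(1+P*A*e)*(1+3*P*B*e)*he + P*C*a*b*P*(1+P*A*e)*(1+3*P*B*e)*hdt - C*a*b*d*(t*A*e+3*t*B*e+3*A*B*e^2+3*P*t*A*B*e^2)*p3
  have f3 : P * (C * a * b * d)^2 * (1 + 2*P*(A*e + 3*B*e + t)) = 64 * (P * a4^2 * (1 + P*A4)) := by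
    linear_combination (C*a*b*d*(1+P*(A*e+3*B*e+t)) + 8*(a4*(1+P*A4*(4*e))))*f2 - (C*a*b*d)^2*(A*e+3*B*e+t)^2*p3 + 64*a4^2*16*e^2*A4^2*p3 + 64*P^2*a4^2*A4*he
  have f4 : P * (1 + 2*t*P - 4*(T-1) - 4*e*P*H) = P * (1 + 2*P*(A*e+3*B*e+t)) * (1 - P*A4) := by
    linear_combination -4*hT - 4*e*hH - 6*e*P*hA - P^2*A4*he + 2*(A*e+3*B*e+t)*A4*p3
  linear_combination (C*a*b*d)^2 * f4 + (1 - P*A4)*f3 - 64*a4^2*A4^2*p3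

lemma choose_G (h2 : p ≠ 2) (n k : ℕ) (hk : k ≤ n) (hn : n < p) :
    (n.choose k : ZZ p) * Gm p ((k:ZZ p)+1) * Gm p (((n-k:ℕ):ZZ p)+1) = - Gm p ((n:ZZ p)+1) := by
  have h := congrArg (Nat.cast : ℕ → ZZ p) (Nat.choose_mul_factorial_mul_factorial hk)
  push_cast at h
  rw [fac_Gm h2 k (by omega), fac_Gm h2 (n-k) (by omega), fac_Gm h2 n hn] at h
  have e1 : (-1:ZZ p)^(k+1) * (-1)^(n-k+1) = (-1)^n := by
    rw [← pow_add, show k+1+(n-k+1) = n+2 by omega, pow_add (-1:ZZ p)]; norm_num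
  have hs : ((-1:ZZ p)^n)^2 = 1 := by rw [← pow_mul, mul_comm, pow_mul]; norm_num
  rw [pow_succ (-1:ZZ p) n] at h
  generalize (n.choose k : ZZ p) = C at *
  generalize Gm p ((k:ZZ p)+1) = x at *
  generalize Gm p (((n-k:ℕ):ZZ p)+1) = y at *
  generalize Gm p ((n:ZZ p)+1) = z at *
  generalize (-1:ZZ p)^n = s at *
  generalize (-1:ZZ p)^(k+1) = s1 at *
  generalize (-1:ZZ p)^(n-k+1) = s2 at *
  linear_combination s*h - s*C*x*y*e1 - (z + C*x*y)*hs

noncomputable def RZ (p n k : ℕ) : ZZ p :=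
  (5 - 4*(-1)^n) * (1 + (4 + 2*(-1)^n)*p - 4*(2^(p-1) - 1) - 4*ee p * p * ∑ i ∈ Icc 1 k, ((i:ZZ p))⁻¹) * (n.choose k : ZZ p)^2

lemma a4_sq (n : ℕ) (hn : p = 2*n+1) : (Gm p (4*ee p))^2 = -(-1)^n := by
  have h2 : p ≠ 2 := by omega
  have hpos := hp.out.two_le
  have he := ee_eq (p := p) h2
  have h := rr_ee h2 4 (n+1) (by omega) (by omega) (-4) (by rw [hn]; push_cast; ring)
  push_cast at h
  rw [rr, show 1 - 4*ee p = 4*ee p by linear_combination -he, pow_succ (-1:ZZ p)] at h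
  linear_combination h

lemma R_main (n : ℕ) (hn : p = 2*n+1) (h3 : 3 < p) (hp8 : p % 8 = 5 ∨ p % 8 = 7) :
    (p:ZZ p) * (RZ p n (p/8) * (Gm p (ee p) * Gm p (3 * ee p))^2) = -64 * (-1)^n * p := by
  have h2 : p ≠ 2 := by omega
  have he := ee_eq (p := p) h2
  have h4 := a4_sq n hn
  have e1 : (n:ZZ p) + 1 = 4*ee p + p*(4*ee p) := by
    have : (p:ZZ p) = 2*n+1 := by
      have := congrArg (Nat.cast : ℕ → ZZ p) hn; push_cast at this ⊢; exact this
    linear_combination -(n+1) * he - 4*ee p * this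
  have hC := choose_G h2 n (p/8) (by omega) (by omega)
  have hH := harm h3 (p/8) (by omega)
  have h13 := A13 (p := p) h3
  generalize hk : p/8 = k at hC hH ⊢
  rcases hp8 with h | h
  · have hk5 : p = 8*k+5 := by omega
    have hn4 : n = 4*k+2 := by omega
    have hkz : (k:ZZ p) = p * ee p - 5 * ee p := by
      have : (p:ZZ p) = 8*k+5 := by
        have := congrArg (Nat.cast : ℕ → ZZ p) hk5; push_cast at this ⊢; exact this
      linear_combination -(k:ZZ p) * he - ee p * this
    have e2 : (k:ZZ p) + 1 = 3*ee p + p*ee p := by rw [hkz]; linear_combination -he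
    have e3 : (((n-k:ℕ)):ZZ p) = 1 * ee p + p * (3*ee p) := by
      rw [show n-k = 3*k+2 by omega]; push_cast; rw [hkz]; linear_combination -2*he
    have hne : pi p (((n-k:ℕ)):ZZ p) ≠ 0 := by
      rw [map_natCast, Ne, ZMod.natCast_eq_zero_iff]; exact ndvd _ (by omega) (by omega) (by omega)
    rw [Gm_succ h2 _ hne, e1, e2, e3] at hC
    have hs : (-1:ZZ p)^n = 1 := by rw [hn4, show 4*k+2 = 2*(2*k+1) by ring, pow_mul]; norm_num
    rw [e2] at hH
    have hsh := LA_shift2 h3 (3*ee p) (ee p)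
    have := R_gen h3 n hn (3*ee p) (n.choose k) (∑ i ∈ Icc 1 k, ((i:ZZ p))⁻¹) 1 3 (by norm_num)
      (by rw [one_mul]; linear_combination h13) (by linear_combination -p*hH + hsh) (by linear_combination -hC)
    rw [h4, hs, one_mul] at this
    rw [RZ, hs]
    linear_combination this
  · have hk5 : p = 8*k+7 := by omega
    have hn4 : n = 4*k+3 := by omega
    have hkz : (k:ZZ p) = p * ee p - 7 * ee p := by
      have : (p:ZZ p) = 8*k+7 := by
        have := congrArg (Nat.cast : ℕ → ZZ p) hk5; push_cast at this ⊢; exact this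
      linear_combination -(k:ZZ p) * he - ee p * this
    have e2 : (k:ZZ p) + 1 = ee p + p*ee p := by rw [hkz]; linear_combination -he
    have e3 : (((n-k:ℕ)):ZZ p) = 3 * ee p + p * (3*ee p) := by
      rw [show n-k = 3*k+3 by omega]; push_cast; rw [hkz]; linear_combination -3*he
    have hne : pi p (((n-k:ℕ)):ZZ p) ≠ 0 := by
      rw [map_natCast, Ne, ZMod.natCast_eq_zero_iff]; exact ndvd _ (by omega) (by omega) (by omega)
    rw [Gm_succ h2 _ hne, e1, e2, e3] at hC
    have hs : (-1:ZZ p)^n = -1 := by rw [hn4, show 4*k+3 = 2*(2*k+1)+1 by ring, pow_succ (-1:ZZ p), pow_mul]; norm_num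
    rw [e2] at hH
    have hsh := LA_shift2 h3 (ee p) (ee p)
    have := R_gen h3 n hn (ee p) (n.choose k) (∑ i ∈ Icc 1 k, ((i:ZZ p))⁻¹) 3 1 (by norm_num)
      (by linear_combination h13) (by linear_combination -p*hH + hsh) (by linear_combination -hC)
    rw [h4, hs] at this
    rw [RZ, hs]
    linear_combination this

lemma D_final (n : ℕ) (hn : p = 2*n+1) (h3 : 3 < p) (hp8 : p % 8 = 5 ∨ p % 8 = 7) :
    (p:ZZ p) * (32 * ((-1)^n * SS p 2)) = p * (-RZ p n (p/8) - 4*p) ∧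
    (p:ZZ p) * (128 * ((-1)^n * SS p 3)) = p * (3 * RZ p n (p/8)) := by
  have h2 : p ≠ 2 := by omega
  have he := ee_eq (p := p) h2
  have hR := R_main n hn h3 hp8
  have hY := Y_main n hn h3 hp8
  have h02 := S02_rel n hn h3
  have h1 := S1_rel n hn h3
  have ht := tele (p := p) h2
  have hu := ((Gne (p := p) (ee p)).mul (Gne (p := p) (3*ee p))).pow 2
  have hs : ((-1:ZZ p)^n)^2 = 1 := by rw [← pow_mul, mul_comm, pow_mul]; norm_num
  have p3 := p_cube (p := p)
  generalize (Gm p (ee p) * Gm p (3*ee p))^2 = u at *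
  generalize RZ p n (p/8) = R at *
  generalize (-1:ZZ p)^n = s at *
  generalize SS p 0 = S0 at *
  generalize SS p 1 = S1 at *
  generalize SS p 2 = S2 at *
  generalize SS p 3 = S3 at *
  generalize ee p = e at *
  generalize (p:ZZ p) = P at *
  have hS0 : P * S0 = 0 := by
    linear_combination e^2*(-S0 * hY + P*u*h02 + 3*u*p3) - P*S0*(8*e+1)*he
  have hRY : P * R = -(s*P*(32*S2+16*S1+3*S0)) := by
    apply hu.mul_left_cancel
    linear_combination hR + s*hY
  constructor
  · linear_combination hRY + s*hS0 - 4*P*s*h1 - 4*P^2*hs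
  · linear_combination 8*P*s*ht - 3*hRY + s*hS0

end D3
end S5

namespace S5
open Finset

section E1
variable {p : ℕ} [hp : Fact p.Prime]

/-- `z` is the reduction mod `p^3` of the `p`-integral rational `a`. -/
def Red (p : ℕ) (a : ℚ) (z : ZZ p) : Prop := ∃ (m : ℤ) (d : ℕ), Nat.Coprime p d ∧ a * d = m ∧ z * d = m

lemma Red.int (m : ℤ) : Red p m m := ⟨m, 1, by simp, by simp, by simp⟩
lemma Red.nat (m : ℕ) : Red p m m := ⟨m, 1, by simp, by simp, by simp⟩
lemma Red.one : Red p 1 1 := ⟨1, 1, by simp, by simp, by simp⟩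
lemma Red.ofNat (m : ℕ) [m.AtLeastTwo] : Red p (OfNat.ofNat m) (OfNat.ofNat m) :=
  ⟨OfNat.ofNat m, 1, by simp, by simp, by simp⟩

lemma Red.add {a b : ℚ} {z w : ZZ p} (h : Red p a z) (h' : Red p b w) : Red p (a+b) (z+w) := by
  obtain ⟨m, d, c, e, f⟩ := h
  obtain ⟨m', d', c', e', f'⟩ := h'
  refine ⟨m*d' + m'*d, d*d', c.mul_right c', ?_, ?_⟩
  · push_cast; linear_combination d' * e + d * e'
  · push_cast; linear_combination d' * f + d * f'

lemma Red.mul {a b : ℚ} {z w : ZZ p} (h : Red p a z) (h' : Red p b w) : Red p (a*b) (z*w) := by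
  obtain ⟨m, d, c, e, f⟩ := h
  obtain ⟨m', d', c', e', f'⟩ := h'
  refine ⟨m*m', d*d', c.mul_right c', ?_, ?_⟩
  · push_cast; linear_combination b*d' * e + m * e'
  · push_cast; linear_combination w*d' * f + m * f'

lemma Red.neg {a : ℚ} {z : ZZ p} (h : Red p a z) : Red p (-a) (-z) := by
  obtain ⟨m, d, c, e, f⟩ := h
  refine ⟨-m, d, c, ?_, ?_⟩
  · push_cast; linear_combination -e
  · push_cast; linear_combination -f

lemma Red.sub {a b : ℚ} {z w : ZZ p} (h : Red p a z) (h' : Red p b w) : Red p (a-b) (z-w) := by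
  rw [sub_eq_add_neg, sub_eq_add_neg]; exact h.add h'.neg

lemma Red.pow {a : ℚ} {z : ZZ p} (h : Red p a z) (k : ℕ) : Red p (a^k) (z^k) := by
  induction k with
  | zero => simpa using Red.one
  | succ k ih => rw [pow_succ a, pow_succ z]; exact ih.mul h

lemma Red.sum (s : Finset ℕ) (f : ℕ → ℚ) (g : ℕ → ZZ p) (h : ∀ i ∈ s, Red p (f i) (g i)) :
    Red p (∑ i ∈ s, f i) (∑ i ∈ s, g i) := by
  induction s using Finset.induction_on with
  | empty => simpa using Red.nat (p := p) 0
  | insert a s ha ih =>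
    rw [Finset.sum_insert ha, Finset.sum_insert ha]
    exact (h a (by simp)).add (ih (fun i hi => h i (by simp [hi])))

lemma Red.inv (c : ℕ) (hc : Nat.Coprime p c) (hc0 : c ≠ 0) (w : ZZ p) (hw : w * c = 1) : Red p (1/(c:ℚ)) w := by
  refine ⟨1, c, hc, ?_, by simpa using hw⟩
  have : (c:ℚ) ≠ 0 := by exact_mod_cast hc0
  field_simp; simp

lemma Red.dvd3 {a : ℚ} {z : ZZ p} (h : Red p a z) (hz : z = 0) : (p:ℤ)^3 ∣ a.num := by
  obtain ⟨m, d, c, e, f⟩ := h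
  rw [hz, zero_mul] at f
  have hm : ((p^3:ℕ):ℤ) ∣ m := (ZMod.intCast_zmod_eq_zero_iff_dvd m (p^3)).1 f.symm
  have e2 : a.num * d = m * a.den := by
    have h0 : (a.den:ℚ) ≠ 0 := by exact_mod_cast a.den_nz
    have : (a.num:ℚ) * d = m * a.den := by
      rw [← e]; nth_rewrite 2 [← Rat.num_div_den a]; field_simp
    exact_mod_cast this
  have hcop : IsCoprime ((p:ℤ)^3) (d:ℤ) := (Nat.isCoprime_iff_coprime.2 c).pow_left
  apply hcop.dvd_of_dvd_mul_right
  rw [e2]; push_cast at hm; exact hm.mul_right _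

lemma Red.dvd2 {a : ℚ} {z : ZZ p} (h : Red p a z) (hz : (p:ZZ p) * z = 0) : (p:ℤ)^2 ∣ a.num := by
  have h1 := (Red.nat p).mul h
  obtain ⟨m, d, c, e, f⟩ := h
  have f' : (((p:ℤ)*m : ℤ) : ZZ p) = 0 := by
    push_cast; rw [← f]; linear_combination d * hz
  have hm : ((p^3:ℕ):ℤ) ∣ p*m := (ZMod.intCast_zmod_eq_zero_iff_dvd _ (p^3)).1 f'
  have hp0 : (p:ℤ) ≠ 0 := by exact_mod_cast hp.out.ne_zero
  have hm2 : (p:ℤ)^2 ∣ m := by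
    push_cast at hm
    rw [show (p:ℤ)^3 = p * p^2 by ring] at hm
    exact (mul_dvd_mul_iff_left hp0).1 hm
  have e2 : a.num * d = m * a.den := by
    have h0 : (a.den:ℚ) ≠ 0 := by exact_mod_cast a.den_nz
    have : (a.num:ℚ) * d = m * a.den := by
      rw [← e]; nth_rewrite 2 [← Rat.num_div_den a]; field_simp
    exact_mod_cast this
  have hcop : IsCoprime ((p:ℤ)^2) (d:ℤ) := (Nat.isCoprime_iff_coprime.2 c).pow_left
  apply hcop.dvd_of_dvd_mul_right
  rw [e2]; exact hm2.mul_right _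

lemma cop2 (h2 : p ≠ 2) (k : ℕ) : Nat.Coprime p (2^k) :=
  Nat.Coprime.pow_right _ ((Nat.coprime_primes hp.out Nat.prime_two).2 h2)

lemma cop_inv (c : ℕ) (hc : Nat.Coprime p c) : ∃ w : ZZ p, w * c = 1 :=
  ⟨(c:ZZ p)⁻¹, by
    rw [mul_comm]; exact ZMod.coe_mul_inv_eq_one c (hc.symm.pow_right 3)⟩

lemma Red.SS (h2 : p ≠ 2) (j : ℕ) :
    Red p (∑ k ∈ Finset.range p, (k:ℚ)^j * ((2*k).choose k : ℚ)^3 / (-64)^k) (SS p j) := by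
  rw [S5.SS]
  apply Red.sum
  intro k _
  have hw := ww_eq (p := p) h2
  have r : Red p (-1/64) (ww p) := ⟨-1, 64, cop2 h2 6, by norm_num, by push_cast; linear_combination -hw⟩
  have := ((Red.nat (p := p) k).pow j).mul (((Red.nat (p := p) ((2*k).choose k)).pow 3).mul (r.pow k))
  convert this using 1
  rw [mul_div_assoc, div_eq_mul_inv (_^3), ← inv_pow]
  norm_num

lemma Red.sgn (n : ℕ) : Red p ((-1)^n) ((-1)^n) := (Red.one.neg).pow n

lemma caseC (h3 : 3 < p) (hp8 : p % 8 = 1 ∨ p % 8 = 3) (x y : ℤ) (hxy : (p:ℤ) = x^2+2*y^2) :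
      ratCongr p 3
        ((-1:ℚ)^((p-1)/2) *
          ∑ k ∈ Finset.range p, (k:ℚ)^2 * ((2*k).choose k : ℚ)^3 / (-64)^k)
        (1/8*(x:ℚ)^2 - 3/16*(p:ℚ) + (p:ℚ)^2/(64*(x:ℚ)^2)) ∧
      ratCongr p 3
        ((-1:ℚ)^((p-1)/2) *
          ∑ k ∈ Finset.range p, (k:ℚ)^3 * ((2*k).choose k : ℚ)^3 / (-64)^k)
        (1/32*(x:ℚ)^2 - (p:ℚ)/64 - 5*(p:ℚ)^2/(256*(x:ℚ)^2)) := by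
  have h2 : p ≠ 2 := by omega
  obtain ⟨n, hn⟩ : ∃ n, n = (p-1)/2 := ⟨_, rfl⟩
  have hn2 : p = 2*n+1 := by omega
  rw [← hn]
  have hx := (x_ndvd h2 x y hxy).1
  have hS := S_final n hn2 h3 hp8 x y hxy
  have hxc : Nat.Coprime p x.natAbs := by
    rw [Nat.Prime.coprime_iff_not_dvd hp.out, ← Int.natCast_dvd]; exact hx
  have hx0 : x ≠ 0 := by rintro rfl; exact hx (dvd_zero _)
  have hxq : (x:ℚ) ≠ 0 := by exact_mod_cast hx0
  have hna : ((x.natAbs : ℕ) : ℚ)^2 = (x:ℚ)^2 := by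
    have := congrArg (Int.cast : ℤ → ℚ) (Int.natAbs_sq x)
    push_cast at this; simpa using this
  have hnz : ((x.natAbs : ℕ) : ZZ p)^2 = (x:ZZ p)^2 := by
    have := congrArg (Int.cast : ℤ → ZZ p) (Int.natAbs_sq x)
    push_cast at this; simpa using this
  have c1 : Nat.Coprime p (64*x.natAbs^2) := Nat.Coprime.mul_right (cop2 h2 6) (hxc.pow_right 2)
  have c2 : Nat.Coprime p (256*x.natAbs^2) := Nat.Coprime.mul_right (cop2 h2 8) (hxc.pow_right 2)
  have n0 : x.natAbs ≠ 0 := by simpa using hx0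
  obtain ⟨w1, hw1⟩ := cop_inv _ c1
  obtain ⟨w2, hw2⟩ := cop_inv _ c2
  have r1 := Red.inv _ c1 (by positivity) w1 hw1
  have r2 := Red.inv _ c2 (by positivity) w2 hw2
  push_cast at hw1 hw2 r1 r2
  rw [hnz] at hw1 hw2
  rw [hna] at r1 r2
  have X := Red.int (p := p) x
  have P := Red.nat (p := p) p
  constructor
  · have key := ((Red.sgn n).mul (Red.SS h2 2)).sub (((((Red.ofNat 8).mul (X.pow 4)).sub (((Red.ofNat 12).mul P).mul (X.pow 2))).add (P.pow 2)).mul r1)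
    have := key.dvd3 (by linear_combination w1 * hS.1 - ((-1)^n * S5.SS p 2) * hw1)
    rw [ratCongr]
    convert this using 4
    field_simp; ring
  · have key := ((Red.sgn n).mul (Red.SS h2 3)).sub (((((Red.ofNat 8).mul (X.pow 4)).sub (((Red.ofNat 4).mul P).mul (X.pow 2))).sub ((Red.ofNat 5).mul (P.pow 2))).mul r2)
    have := key.dvd3 (by linear_combination w2 * hS.2 - ((-1)^n * S5.SS p 3) * hw2)
    rw [ratCongr]
    convert this using 4
    field_simp; ring

lemma Red.R2 (h2 : p ≠ 2) (n : ℕ) (hn : (p-1)/2 = n) : Red p (_root_.R2 p) (RZ p n (p/8)) := by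
  have he := ee_eq (p := p) h2
  have S := Red.sgn (p := p) n
  have P := Red.nat (p := p) p
  have E := Red.inv (p := p) 8 (cop2 h2 3) (by norm_num) (ee p) (by push_cast; linear_combination he)
  have HH : Red p (∑ k ∈ Finset.Icc 1 (p/8), (1:ℚ)/k) (∑ i ∈ Icc 1 (p/8), ((i:ZZ p))⁻¹) := by
    apply Red.sum
    intro i hi
    rw [Finset.mem_Icc] at hi
    have hc : Nat.Coprime p i := by
      rw [Nat.Prime.coprime_iff_not_dvd hp.out]
      intro h
      have := Nat.le_of_dvd (by omega) h
      omega
    exact Red.inv i hc (by omega) _ (by rw [mul_comm]; exact ZMod.coe_mul_inv_eq_one i (hc.symm.pow_right 3))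
  have key := (((Red.ofNat 5).sub ((Red.ofNat 4).mul S)).mul ((((Red.one).add (((Red.ofNat 4).add ((Red.ofNat 2).mul S)).mul P)).sub
    ((Red.ofNat 4).mul (((Red.ofNat 2).pow (p-1)).sub Red.one))).sub ((((Red.ofNat 4).mul E).mul P).mul HH))).mul
      ((Red.nat (p := p) (n.choose (p/8))).pow 2)
  rw [_root_.R2, RZ, hn]
  convert key using 4
  push_cast; ring

lemma caseD (h3 : 3 < p) (hp8 : p % 8 = 5 ∨ p % 8 = 7) :
      ratCongr p 2
        ((-1:ℚ)^((p-1)/2) *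
          ∑ k ∈ Finset.range p, (k:ℚ)^2 * ((2*k).choose k : ℚ)^3 / (-64)^k)
        (-(1/32)*R2 p - (p:ℚ)/8) ∧
      ratCongr p 2
        ((-1:ℚ)^((p-1)/2) *
          ∑ k ∈ Finset.range p, (k:ℚ)^3 * ((2*k).choose k : ℚ)^3 / (-64)^k)
        (3/128*R2 p) := by
  have h2 : p ≠ 2 := by omega
  obtain ⟨n, hn⟩ : ∃ n, (p-1)/2 = n := ⟨_, rfl⟩
  have hn2 : p = 2*n+1 := by omega
  have r := Red.R2 (p := p) h2 n hn
  rw [hn]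
  have hD := D_final n hn2 h3 hp8
  have P := Red.nat (p := p) p
  obtain ⟨w1, hw1⟩ := cop_inv (p := p) 32 (cop2 h2 5)
  obtain ⟨w2, hw2⟩ := cop_inv (p := p) 128 (cop2 h2 7)
  have r1 := Red.inv (p := p) 32 (cop2 h2 5) (by norm_num) w1 hw1
  have r2 := Red.inv (p := p) 128 (cop2 h2 7) (by norm_num) w2 hw2
  push_cast at hw1 hw2
  constructor
  · have key := ((Red.sgn n).mul (Red.SS h2 2)).sub ((r.neg.sub ((Red.ofNat 4).mul P)).mul r1)
    have := key.dvd2 (by linear_combination w1 * hD.1 - p * ((-1)^n * S5.SS p 2) * hw1)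
    rw [ratCongr]
    convert this using 4
    push_cast; ring
  · have key := ((Red.sgn n).mul (Red.SS h2 3)).sub (((Red.ofNat 3).mul r).mul r2)
    have := key.dvd2 (by linear_combination w2 * hD.2 - p * ((-1)^n * S5.SS p 3) * hw2)
    rw [ratCongr]
    convert this using 2
    push_cast; ring

end E1

lemma case3 (x y : ℤ) (hxy : (3:ℤ) = x^2+2*y^2) :
      ratCongr 3 3
        ((-1:ℚ)^((3-1)/2) *
          ∑ k ∈ Finset.range 3, (k:ℚ)^2 * ((2*k).choose k : ℚ)^3 / (-64)^k)
        (1/8*(x:ℚ)^2 - 3/16*((3:ℕ):ℚ) + ((3:ℕ):ℚ)^2/(64*(x:ℚ)^2)) ∧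
      ratCongr 3 3
        ((-1:ℚ)^((3-1)/2) *
          ∑ k ∈ Finset.range 3, (k:ℚ)^3 * ((2*k).choose k : ℚ)^3 / (-64)^k)
        (1/32*(x:ℚ)^2 - ((3:ℕ):ℚ)/64 - 5*((3:ℕ):ℚ)^2/(256*(x:ℚ)^2)) := by
  have hx : x^2 = 1 := by
    have h1 : y^2 ≤ 1 := by nlinarith [sq_nonneg x]
    have h2 : y ≤ 1 := by nlinarith
    have h3 : -1 ≤ y := by nlinarith
    have h4 : x ≤ 1 := by nlinarith
    have h5 : -1 ≤ x := by nlinarith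
    interval_cases y <;> interval_cases x <;> omega
  have hq : (x:ℚ)^2 = 1 := by exact_mod_cast hx
  have c2 : ((2*2).choose 2 : ℕ) = 6 := by decide
  simp only [ratCongr, hq, Finset.sum_range_succ, Finset.sum_range_zero]
  rw [c2]
  constructor <;> norm_num

end S5

theorem statement5 (p : ℕ) (hp : p.Prime) (hp2 : p ≠ 2) :
    (∀ x y : ℤ, (p % 8 = 1 ∨ p % 8 = 3) → (p : ℤ) = x^2 + 2*y^2 →
      ratCongr p 3
        ((-1:ℚ)^((p-1)/2) *
          ∑ k ∈ Finset.range p, (k:ℚ)^2 * ((2*k).choose k : ℚ)^3 / (-64)^k)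
        (1/8*(x:ℚ)^2 - 3/16*(p:ℚ) + (p:ℚ)^2/(64*(x:ℚ)^2)) ∧
      ratCongr p 3
        ((-1:ℚ)^((p-1)/2) *
          ∑ k ∈ Finset.range p, (k:ℚ)^3 * ((2*k).choose k : ℚ)^3 / (-64)^k)
        (1/32*(x:ℚ)^2 - (p:ℚ)/64 - 5*(p:ℚ)^2/(256*(x:ℚ)^2))) ∧
    ((p % 8 = 5 ∨ p % 8 = 7) →
      ratCongr p 2
        ((-1:ℚ)^((p-1)/2) *
          ∑ k ∈ Finset.range p, (k:ℚ)^2 * ((2*k).choose k : ℚ)^3 / (-64)^k)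
        (-(1/32)*R2 p - (p:ℚ)/8) ∧
      ratCongr p 2
        ((-1:ℚ)^((p-1)/2) *
          ∑ k ∈ Finset.range p, (k:ℚ)^3 * ((2*k).choose k : ℚ)^3 / (-64)^k)
        (3/128*R2 p)) := by
  have : Fact p.Prime := ⟨hp⟩
  have h2 := hp.two_le
  refine ⟨fun x y h8 hxy => ?_, fun h8 => S5.caseD (by omega) h8⟩
  by_cases h3 : p = 3
  · subst h3
    exact S5.case3 x y (by exact_mod_cast hxy)
  · exact S5.caseC (by omega) h8 x y hxy
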